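/- arXiv:2502.04545 — 3 statements merged into one kernel-verified Lean document; each statement's English description precedes it below -/
import Mathlib

section
/- Let k and n be integers with 3 ≤ k ≤ 12 and n ≥ k + 3. Then the multiplicative inverse function f_inv on F_{2^n} is not kth order sum-free; that is, there exists a k-dimensional F_2-affine subspace A of F_{2^n} with ∑_{x∈A} f_inv(x) = 0. -/
section

open Finset

set_option linter.unusedSectionVars false

variable {F : Type*} [Field F] [Fintype F] [DecidableEq F] [Algebra (ZMod 2) F]

/-- `L` is additive with a kernel of size `2 ^ d`, the inverses of the elements of the kernel sum
to `s`, and the inverses of the elements of any other fibre `L ⁻¹ {t}` sum to `a / t`. -/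
structure InvSumData (L : F →ₗ[ZMod 2] F) (a s : F) (d : ℕ) : Prop where
  ne_zero : a ≠ 0
  card_ker : #{y | L y = 0} = 2 ^ d
  sum_fiber : ∀ x, L x ≠ 0 → ∑ y with L y = L x, y⁻¹ = a * (L x)⁻¹
  sum_ker : ∑ y with L y = 0, y⁻¹ = s

namespace InvSumData

variable {L L₁ L₂ : F →ₗ[ZMod 2] F} {a a₁ a₂ s s₁ s₂ : F} {d d₁ d₂ : ℕ}

theorem card_fiber (h : InvSumData L a s d) (x : F) : #{y | L y = L x} = 2 ^ d := by
  rw [← h.card_ker]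
  refine card_bij (fun y _ => y - x) ?_ ?_ ?_
  · intro y hy
    simp_all
  · intro y _ z _ hyz
    simpa using hyz
  · intro y hy
    exact ⟨y + x, by simp_all, by simp⟩

theorem card_fiber_le (h : InvSumData L a s d) (t : F) : #{y | L y = t} ≤ 2 ^ d := by
  by_cases ht : ∃ x, L x = t
  · obtain ⟨x, rfl⟩ := ht
    exact (h.card_fiber x).le
  · push Not at ht
    simp [ht]

theorem id : InvSumData (LinearMap.id : F →ₗ[ZMod 2] F) 1 0 0 where
  ne_zero := one_ne_zero
  card_ker := by simp [Finset.filter_eq']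
  sum_fiber x _ := by simp [Finset.filter_eq']
  sum_ker := by simp [Finset.filter_eq']

theorem comp (h₁ : InvSumData L₁ a₁ s₁ d₁) (h₂ : InvSumData L₂ a₂ s₂ d₂)
    (hk : ∀ u, L₂ u = 0 → ∃ x, L₁ x = u) :
    InvSumData (L₂ ∘ₗ L₁) (a₁ * a₂) (s₁ + a₁ * s₂) (d₁ + d₂) where
  ne_zero := mul_ne_zero h₁.ne_zero h₂.ne_zero
  card_ker := by
    have hm : ∀ x ∈ univ.filter (fun y => (L₂ ∘ₗ L₁) y = 0), L₁ x ∈ univ.filter (L₂ · = 0) := by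
      simp
    rw [card_eq_sum_card_fiberwise hm, pow_add, mul_comm, ← h₂.card_ker, ← smul_eq_mul,
      ← sum_const]
    refine sum_congr rfl fun u hu => ?_
    simp only [mem_filter, mem_univ, true_and] at hu
    obtain ⟨x, rfl⟩ := hk u hu
    rw [← h₁.card_fiber x, filter_filter]
    congr 1
    ext y
    simp only [mem_filter, mem_univ, true_and, LinearMap.comp_apply]
    exact ⟨fun h => h.2, fun h => ⟨h ▸ hu, h⟩⟩
  sum_fiber x hx := by
    have hm : ∀ y ∈ univ.filter (fun y => (L₂ ∘ₗ L₁) y = (L₂ ∘ₗ L₁) x),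
        L₁ y ∈ univ.filter (L₂ · = L₂ (L₁ x)) := by
      simp
    rw [← sum_fiberwise_of_maps_to hm, mul_assoc, LinearMap.comp_apply, ← h₂.sum_fiber _ hx,
      mul_sum]
    refine sum_congr rfl fun u hu => ?_
    simp only [mem_filter, mem_univ, true_and] at hu
    obtain ⟨w, hw⟩ := hk (u - L₁ x) (by simp [hu])
    obtain ⟨v, rfl⟩ : ∃ v, L₁ v = u := ⟨w + x, by simp [hw]⟩
    rw [← h₁.sum_fiber v, filter_filter]
    · congr 1
      ext y
      simp only [mem_filter, mem_univ, true_and, LinearMap.comp_apply]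
      exact ⟨fun h => h.2, fun h => ⟨by rw [h, hu], h⟩⟩
    · intro h0
      exact hx (by rw [LinearMap.comp_apply, ← hu, h0, map_zero])
  sum_ker := by
    have hm : ∀ y ∈ univ.filter (fun y => (L₂ ∘ₗ L₁) y = 0), L₁ y ∈ univ.filter (L₂ · = 0) := by
      simp
    have h0 : (0 : F) ∈ univ.filter (L₂ · = 0) := by simp
    rw [← sum_fiberwise_of_maps_to hm, ← add_sum_erase _ _ h0, ← h₂.sum_ker,
      ← add_sum_erase _ _ h0, inv_zero, zero_add, mul_sum, ← h₁.sum_ker]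
    congr 1
    · rw [filter_filter]
      congr 1
      ext y
      simp only [mem_filter, mem_univ, true_and, LinearMap.comp_apply]
      exact ⟨fun h => h.2, fun h => ⟨by rw [h, map_zero], h⟩⟩
    · refine sum_congr rfl fun u hu => ?_
      simp only [mem_erase, mem_filter, mem_univ, true_and] at hu
      obtain ⟨v, rfl⟩ := hk u hu.2
      rw [← h₁.sum_fiber v hu.1, filter_filter]
      congr 1
      ext y
      simp only [mem_filter, mem_univ, true_and, LinearMap.comp_apply]
      exact ⟨fun h => h.2, fun h => ⟨by rw [h, hu.2], h⟩⟩

theorem smul (h : InvSumData L a s d) {c : F} (hc : c ≠ 0) :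
    InvSumData (L ∘ₗ LinearMap.mulLeft (ZMod 2) c⁻¹) (c⁻¹ * a) (c⁻¹ * s) d := by
  have key : ∀ t, univ.filter (fun y => (L ∘ₗ LinearMap.mulLeft (ZMod 2) c⁻¹) y = t) =
      (univ.filter (L · = t)).map ⟨(c * ·), mul_right_injective₀ hc⟩ := by
    intro t
    ext y
    rw [mem_filter_univ, mem_map, LinearMap.comp_apply, LinearMap.mulLeft_apply]
    constructor
    · intro hy
      exact ⟨c⁻¹ * y, by simpa using hy, mul_inv_cancel_left₀ hc y⟩
    · rintro ⟨z, hz, rfl⟩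
      rw [mem_filter_univ] at hz
      simpa [inv_mul_cancel_left₀ hc] using hz
  refine ⟨mul_ne_zero (inv_ne_zero hc) h.ne_zero, ?_, ?_, ?_⟩
  · rw [key, card_map, h.card_ker]
  · intro x hx
    rw [key, sum_map, LinearMap.comp_apply, mul_assoc, ← h.sum_fiber _ hx, mul_sum]
    simp [mul_comm]
  · rw [key, sum_map, ← h.sum_ker, mul_sum]
    simp [mul_comm]

end InvSumData

variable [CharP F 2]

/-- The additive map `x ↦ x (x + c)` of a field of characteristic two. -/
def mulAddMap (c : F) : F →ₗ[ZMod 2] F :=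
  AddMonoidHom.toZModLinearMap 2
    { toFun := fun x => x * (x + c)
      map_zero' := by simp
      map_add' := fun x y => by
        have h2 : (2 : F) = 0 := CharTwo.two_eq_zero
        linear_combination x * y * h2 }

theorem mulAddMap_apply (c x : F) : mulAddMap c x = x * (x + c) := rfl

theorem mulAddMap_eq_iff (c x y : F) : mulAddMap c y = mulAddMap c x ↔ y = x ∨ y = x + c := by
  have h2 : (2 : F) = 0 := CharTwo.two_eq_zero
  rw [mulAddMap_apply, mulAddMap_apply, ← sub_eq_zero (b := x), ← sub_eq_zero (b := x + c),
    ← mul_eq_zero, ← sub_eq_zero]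
  rw [show (y - x) * (y - (x + c)) = y * (y + c) - x * (x + c) by
    linear_combination (x * x + x * c - y * x - y * c) * h2]

theorem mulAddMap_eq_zero_iff (c y : F) : mulAddMap c y = 0 ↔ y = 0 ∨ y = c := by
  have := mulAddMap_eq_iff c 0 y
  rwa [map_zero, zero_add] at this

theorem invSumData_mulAddMap {c : F} (hc : c ≠ 0) : InvSumData (mulAddMap c) c c⁻¹ 1 where
  ne_zero := hc
  card_ker := by
    simp only [mulAddMap_eq_zero_iff]
    rw [filter_or, filter_eq', filter_eq']
    simp only [mem_univ, if_true]
    rw [← insert_eq, card_pair hc.symm, pow_one]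
  sum_fiber x hx := by
    simp only [mulAddMap_eq_iff]
    rw [filter_or, filter_eq', filter_eq']
    simp only [mem_univ, if_true]
    rw [mulAddMap_apply, mul_ne_zero_iff] at hx
    rw [← insert_eq, sum_pair (by simpa using hc), mulAddMap_apply]
    have h2 : (2 : F) = 0 := CharTwo.two_eq_zero
    have := hx.1
    have := hx.2
    field_simp
    linear_combination x * h2
  sum_ker := by
    simp only [mulAddMap_eq_zero_iff]
    rw [filter_or, filter_eq', filter_eq']
    simp only [mem_univ, if_true]
    rw [← insert_eq, sum_pair hc.symm, inv_zero, zero_add]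

theorem InvSumData.extend {L : F →ₗ[ZMod 2] F} {a s : F} {d : ℕ} (h : InvSumData L a s d) {v : F}
    (hv : L v ≠ 0) :
    InvSumData (mulAddMap (L v) ∘ₗ L) (a * L v) (s + a * (L v)⁻¹) (d + 1) := by
  refine h.comp (invSumData_mulAddMap hv) fun u hu => ?_
  rcases (mulAddMap_eq_zero_iff _ _).1 hu with rfl | rfl
  · exact ⟨0, map_zero _⟩
  · exact ⟨v, rfl⟩

theorem exists_invSumData {d : ℕ} (hd : 2 ^ d ≤ Fintype.card F) :
    ∃ (L : F →ₗ[ZMod 2] F) (a s : F), InvSumData L a s d := by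
  induction d with
  | zero => exact ⟨_, _, _, InvSumData.id⟩
  | succ d ih =>
    obtain ⟨L, a, s, h⟩ := ih (le_trans (Nat.pow_le_pow_right two_pos d.le_succ) hd)
    obtain ⟨v, hv⟩ : ∃ v, L v ≠ 0 := by
      by_contra! hL
      have := h.card_ker
      simp only [hL, filter_true, card_univ] at this
      rw [this] at hd
      exact absurd hd (not_le.2 (Nat.pow_lt_pow_right one_lt_two d.lt_succ_self))
    exact ⟨_, _, _, h.extend hv⟩

variable (F) in
/-- Some `d`-dimensional `𝔽₂`-subspace of `F` has inverses summing to zero. -/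
def HasInvSumZero (d : ℕ) : Prop :=
  ∃ (L : F →ₗ[ZMod 2] F) (a : F), InvSumData L a 0 d

theorem finrank_ker_of_card {L : F →ₗ[ZMod 2] F} {d : ℕ} (h : #{y | L y = 0} = 2 ^ d) :
    Module.finrank (ZMod 2) (LinearMap.ker L) = d := by
  have := Fintype.ofFinite (LinearMap.ker L)
  have h1 := Module.card_eq_pow_finrank (K := ZMod 2) (V := LinearMap.ker L)
  rw [ZMod.card] at h1
  have h2 : Fintype.card (LinearMap.ker L) = #{y | L y = 0} := by
    rw [Fintype.card_of_subtype (univ.filter (L · = 0)) (by simp)]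
  exact Nat.pow_right_injective le_rfl (by simp only; rw [← h1, h2, h])

theorem HasInvSumZero.exists_submodule {d : ℕ} (h : HasInvSumZero F d) :
    ∃ E : Submodule (ZMod 2) F, Module.finrank (ZMod 2) E = d ∧ ∑ᶠ u : E, (u : F)⁻¹ = 0 := by
  obtain ⟨L, a, h⟩ := h
  have := Fintype.ofFinite (LinearMap.ker L)
  refine ⟨LinearMap.ker L, finrank_ker_of_card h.card_ker, ?_⟩
  rw [finsum_eq_sum_of_fintype, ← h.sum_ker]
  exact (sum_subtype (univ.filter (L · = 0)) (p := (· ∈ LinearMap.ker L)) (by simp)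
    (fun y => y⁻¹)).symm

/-- Two subspaces with vanishing inverse sums can be combined after scaling one of them. -/
theorem HasInvSumZero.add {j m : ℕ} (hj : HasInvSumZero F j) (hm : HasInvSumZero F m)
    (hF : 2 ^ (j * m) < Fintype.card F) : HasInvSumZero F (j + m) := by
  obtain ⟨L₁, a₁, h₁⟩ := hj
  obtain ⟨L₂, a₂, h₂⟩ := hm
  let Φ : F →ₗ[ZMod 2] (LinearMap.ker L₂ →ₗ[ZMod 2] (F ⧸ LinearMap.range L₁)) :=
    { toFun := fun c => (LinearMap.range L₁).mkQ ∘ₗ LinearMap.mulLeft (ZMod 2) c ∘ₗ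
        (LinearMap.ker L₂).subtype
      map_add' := fun c c' => by ext; simp [add_mul]
      map_smul' := fun r c => by ext; simp }
  have hr : Module.finrank (ZMod 2) (F ⧸ LinearMap.range L₁) = j := by
    have e1 := Submodule.finrank_quotient_add_finrank (LinearMap.range L₁)
    have e2 := LinearMap.finrank_range_add_finrank_ker L₁
    rw [finrank_ker_of_card h₁.card_ker] at e2
    omega
  obtain ⟨c, hc, hc0⟩ : ∃ c ∈ LinearMap.ker Φ, c ≠ 0 := by
    rw [← Submodule.ne_bot_iff]
    refine LinearMap.ker_ne_bot_of_finrank_lt ?_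
    rw [Module.finrank_linearMap, hr, finrank_ker_of_card h₂.card_ker]
    rw [Module.card_eq_pow_finrank (K := ZMod 2) (V := F), ZMod.card] at hF
    rw [mul_comm]
    exact (Nat.pow_lt_pow_iff_right one_lt_two).1 hF
  have h := h₁.comp (h₂.smul hc0) fun u hu => by
    have hu' : c⁻¹ * u ∈ LinearMap.ker L₂ := hu
    have := LinearMap.congr_fun hc ⟨_, hu'⟩
    simpa [Φ, mul_inv_cancel_left₀ hc0] using this
  refine ⟨_, _, by simpa using h⟩

theorem index_range_mulAddMap_one :
    (LinearMap.range (mulAddMap (1 : F))).toAddSubgroup.index = 2 := by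
  have h1 := AddSubgroup.card_mul_index (LinearMap.range (mulAddMap (1 : F))).toAddSubgroup
  have h2 := Module.card_eq_pow_finrank (K := ZMod 2) (V := F)
  have := Fintype.ofFinite (LinearMap.range (mulAddMap (1 : F)))
  have h3 := Module.card_eq_pow_finrank (K := ZMod 2) (V := LinearMap.range (mulAddMap (1 : F)))
  have h4 := LinearMap.finrank_range_add_finrank_ker (mulAddMap (1 : F))
  rw [finrank_ker_of_card (invSumData_mulAddMap one_ne_zero).card_ker] at h4
  rw [ZMod.card] at h2 h3
  rw [← h4, pow_succ] at h2
  rw [Nat.card_eq_fintype_card (α := F), h2, ← h3, ← Nat.card_eq_fintype_card] at h1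
  exact Nat.eq_of_mul_eq_mul_left Nat.card_pos h1

variable (F) in
/-- The nontrivial quadratic character of `F` that is trivial on the elements `y (y + 1)`. -/
theorem exists_addChar : ∃ ψ : AddChar F ℤ, ψ.IsPrimitive ∧ (∀ x, |ψ x| = 1) ∧
    ∀ x, 0 < ψ x → ∃ y, mulAddMap 1 y = x := by
  classical
  set H := (LinearMap.range (mulAddMap (1 : F))).toAddSubgroup with hH
  have hi : H.index = 2 := index_range_mulAddMap_one
  let ψ : AddChar F ℤ :=
    { toFun := fun x => if x ∈ H then 1 else -1
      map_zero_eq_one' := by simp [H.zero_mem]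
      map_add_eq_mul' := fun x y => by
        simp only [AddSubgroup.add_mem_iff_of_index_two hi]
        by_cases hx : x ∈ H <;> by_cases hy : y ∈ H <;> simp [hx, hy] }
  have hψ : ∀ x, ψ x = if x ∈ H then 1 else -1 := fun _ => rfl
  refine ⟨ψ, ?_, ?_, ?_⟩
  · intro a ha h
    have hT : H = ⊤ := by
      rw [AddSubgroup.eq_top_iff']
      intro x
      have h1 := DFunLike.congr_fun h (a⁻¹ * x)
      rw [AddChar.mulShift_apply, mul_inv_cancel_left₀ ha, hψ, AddChar.one_apply] at h1
      by_contra hx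
      simp [hx] at h1
    rw [hT, AddSubgroup.index_top] at hi
    omega
  · intro x
    rw [hψ]
    split_ifs <;> simp
  · intro x hx
    rw [hψ] at hx
    split_ifs at hx with h
    · exact h
    · omega

variable {ψ : AddChar F ℤ}

theorem sum_addChar_mul (hψ : ψ.IsPrimitive) (b : F) :
    ∑ x, ψ (x * b) = if b = 0 then (Fintype.card F : ℤ) else 0 := by
  rw [AddChar.sum_mulShift b hψ]
  split_ifs <;> simp

variable (ψ) in
/-- The Kloosterman sum of `ψ`, including the term at `0` with the convention `0⁻¹ = 0`. -/
def kloosterman (a b : F) : ℤ := ∑ v, ψ (a * v⁻¹ + b * v)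

theorem kloosterman_zero_zero : kloosterman ψ 0 0 = Fintype.card F := by
  simp [kloosterman]

theorem kloosterman_mul_inv (a b : F) {t : F} (ht : t ≠ 0) :
    kloosterman ψ (a * t) (b * t⁻¹) = kloosterman ψ a b := by
  unfold kloosterman
  refine (Fintype.sum_equiv (Equiv.mulLeft₀ t ht) _ _ fun v => ?_).symm
  change ψ (a * v⁻¹ + b * v) = ψ (a * t * (t * v)⁻¹ + b * t⁻¹ * (t * v))
  rw [mul_inv, mul_assoc a, mul_inv_cancel_left₀ ht, mul_assoc b, inv_mul_cancel_left₀ ht]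

theorem kloosterman_sq (a b : F) : kloosterman ψ a b ^ 2 =
    ∑ p : F × F, ψ (a * (p.1⁻¹ + p.2⁻¹) + b * (p.1 + p.2)) := by
  rw [pow_two, kloosterman, sum_mul_sum, Fintype.sum_prod_type]
  refine sum_congr rfl fun x _ => sum_congr rfl fun y _ => ?_
  rw [← AddChar.map_add_eq_mul]
  congr 1
  ring

theorem sum_kloosterman_pow_four (hψ : ψ.IsPrimitive) :
    ∑ a, ∑ b, kloosterman ψ a b ^ 4 = (Fintype.card F : ℤ) ^ 2 * ∑ p : F × F,
      (#{r : F × F | r.1⁻¹ + r.2⁻¹ = p.1⁻¹ + p.2⁻¹ ∧ r.1 + r.2 = p.1 + p.2} : ℤ) := by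
  have h1 : ∀ a b, kloosterman ψ a b ^ 4 = ∑ p : F × F, ∑ r : F × F,
      ψ (a * (p.1⁻¹ + p.2⁻¹ + (r.1⁻¹ + r.2⁻¹))) * ψ (b * (p.1 + p.2 + (r.1 + r.2))) := by
    intro a b
    rw [show 4 = 2 * 2 from rfl, pow_mul, kloosterman_sq, pow_two, sum_mul_sum]
    refine sum_congr rfl fun x _ => sum_congr rfl fun y _ => ?_
    rw [← AddChar.map_add_eq_mul, ← AddChar.map_add_eq_mul]
    congr 1
    ring
  have h2 : ∀ x y : F, x + y = 0 ↔ y = x := fun x y => by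
    rw [CharTwo.add_eq_zero, eq_comm]
  calc ∑ a, ∑ b, kloosterman ψ a b ^ 4
      = ∑ p : F × F, ∑ r : F × F, (∑ a, ψ (a * (p.1⁻¹ + p.2⁻¹ + (r.1⁻¹ + r.2⁻¹)))) *
          ∑ b, ψ (b * (p.1 + p.2 + (r.1 + r.2))) := by
        simp only [h1, sum_mul_sum]
        rw [sum_congr rfl fun a _ => sum_comm, sum_comm]
        refine sum_congr rfl fun p _ => ?_
        rw [sum_congr rfl fun a _ => sum_comm, sum_comm]
    _ = _ := by
        rw [mul_sum]
        refine sum_congr rfl fun p _ => ?_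
        simp only [sum_addChar_mul hψ, h2]
        rw [card_filter, Nat.cast_sum, mul_sum]
        refine sum_congr rfl fun r _ => ?_
        by_cases hx : r.1⁻¹ + r.2⁻¹ = p.1⁻¹ + p.2⁻¹ <;> by_cases hy : r.1 + r.2 = p.1 + p.2 <;>
          simp [hx, hy, pow_two]

theorem card_filter_mulAddMap_le {c : F} (hc : c ≠ 0) (t : F) : #{x | mulAddMap c x = t} ≤ 2 :=
  (invSumData_mulAddMap hc).card_fiber_le t

theorem card_add_eq_inv_add_inv_eq_le {u w : F} (hw : w ≠ 0) :
    #{r : F × F | r.1⁻¹ + r.2⁻¹ = u ∧ r.1 + r.2 = w} ≤ 4 := by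
  have h2 : (2 : F) = 0 := CharTwo.two_eq_zero
  have : #{r : F × F | r.1⁻¹ + r.2⁻¹ = u ∧ r.1 + r.2 = w} ≤
      #(univ.filter (fun x => mulAddMap w x = 0) ∪ univ.filter (mulAddMap w · = w * u⁻¹)) := by
    refine card_le_card_of_injOn Prod.fst ?_ ?_
    · rintro ⟨x, y⟩ h
      simp only [coe_filter, mem_univ, true_and, Set.mem_ofPred_eq] at h
      obtain ⟨h1, h3⟩ := h
      simp only [coe_union, coe_filter, mem_univ, true_and, Set.mem_union, Set.mem_ofPred_eq,
        mulAddMap_eq_zero_iff]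
      by_cases hx : x = 0
      · exact Or.inl (Or.inl hx)
      by_cases hy : y = 0
      · refine Or.inl (Or.inr ?_)
        rw [← h3, hy, add_zero]
      right
      have e : w = x * y * u := by
        rw [← h1, ← h3]
        field_simp
        ring
      have hu : u ≠ 0 := by
        rintro rfl
        simp [e] at hw
      rw [mulAddMap_apply, eq_mul_inv_iff_mul_eq₀ hu, ← h3]
      rw [← h3] at e
      linear_combination x * x * u * h2 - e
    · rintro ⟨x, y⟩ h ⟨x', y'⟩ h' hxx
      simp only [coe_filter, mem_univ, true_and, Set.mem_ofPred_eq] at h h' hxx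
      subst hxx
      rw [Prod.mk.injEq]
      exact ⟨rfl, add_left_cancel (h.2.trans h'.2.symm)⟩
  refine this.trans ((card_union_le _ _).trans ?_)
  have := card_filter_mulAddMap_le hw 0
  have := card_filter_mulAddMap_le hw (w * u⁻¹)
  omega

theorem sum_card_add_eq_inv_add_inv_eq_le :
    ∑ p : F × F, #{r : F × F | r.1⁻¹ + r.2⁻¹ = p.1⁻¹ + p.2⁻¹ ∧ r.1 + r.2 = p.1 + p.2} ≤
      5 * Fintype.card F ^ 2 := by
  have h : ∀ x y : F,
      #{r : F × F | r.1⁻¹ + r.2⁻¹ = x⁻¹ + y⁻¹ ∧ r.1 + r.2 = x + y} ≤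
        4 + if y = x then Fintype.card F else 0 := by
    intro x y
    split_ifs with hxy
    · refine le_add_left ?_
      rw [← card_univ]
      refine card_le_card_of_injOn Prod.fst (by simp) ?_
      rintro ⟨x, y⟩ h ⟨x', y'⟩ h' hxx
      simp only [coe_filter, mem_univ, true_and, Set.mem_ofPred_eq] at h h' hxx
      subst hxx
      rw [Prod.mk.injEq]
      exact ⟨rfl, add_left_cancel (h.2.trans h'.2.symm)⟩
    · refine card_add_eq_inv_add_inv_eq_le ?_
      rwa [ne_eq, CharTwo.add_eq_zero, eq_comm]
  rw [Fintype.sum_prod_type]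
  calc _ ≤ ∑ x : F, ∑ y : F, (4 + if y = x then Fintype.card F else 0) :=
        sum_le_sum fun x _ => sum_le_sum fun y _ => h x y
    _ = _ := by
        simp only [sum_add_distrib, sum_ite_eq', mem_univ, if_true, sum_const, card_univ,
          smul_eq_mul]
        ring

theorem kloosterman_pow_four_le (hψ : ψ.IsPrimitive) {a : F} (ha : a ≠ 0) (b : F) :
    (Fintype.card F - 1 : ℤ) * kloosterman ψ a b ^ 4 ≤ 4 * (Fintype.card F : ℤ) ^ 4 := by
  set q : ℤ := (Fintype.card F : ℤ) with hq
  have h1 : ∑ p : F × F, kloosterman ψ p.1 p.2 ^ 4 ≤ q ^ 2 * (5 * q ^ 2) := by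
    rw [Fintype.sum_prod_type, sum_kloosterman_pow_four hψ]
    refine mul_le_mul_of_nonneg_left ?_ (sq_nonneg _)
    rw [hq]
    exact_mod_cast sum_card_add_eq_inv_add_inv_eq_le (F := F)
  have h0 : ((0 : F), (0 : F)) ∉ (univ.erase (0 : F)).image fun t => (a * t, b * t⁻¹) := by
    simp [ha]
  have h2 : ∑ p ∈ insert ((0 : F), (0 : F)) ((univ.erase (0 : F)).image fun t => (a * t, b * t⁻¹)),
      kloosterman ψ p.1 p.2 ^ 4 ≤ ∑ p : F × F, kloosterman ψ p.1 p.2 ^ 4 :=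
    sum_le_sum_of_subset_of_nonneg (subset_univ _) fun p _ _ => by positivity
  rw [sum_insert h0, sum_image, kloosterman_zero_zero,
    sum_congr rfl fun t ht => by rw [kloosterman_mul_inv a b (ne_of_mem_erase ht)], sum_const,
    card_erase_of_mem (mem_univ _), card_univ, nsmul_eq_mul, Nat.cast_sub Fintype.card_pos,
    Nat.cast_one, ← hq] at h2
  · linarith
  · intro t _ t' _ htt
    simp only [Prod.mk.injEq] at htt
    exact mul_left_cancel₀ ha htt.1

theorem mul_abs_kloosterman_le (hψ : ψ.IsPrimitive) {c : ℤ}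
    (hcF : 4 * c ^ 4 + 1 ≤ Fintype.card F) {a : F} (ha : a ≠ 0) (b : F) :
    c * |kloosterman ψ a b| ≤ Fintype.card F := by
  have h := kloosterman_pow_four_le hψ ha b
  set q : ℤ := (Fintype.card F : ℤ) with hq
  have hq1 : 1 < Fintype.card F := Fintype.one_lt_card
  have hq1 : 1 < q := by
    rw [hq]
    exact_mod_cast hq1
  have h4 : (c * |kloosterman ψ a b|) ^ 4 ≤ q ^ 4 := by
    have e : |kloosterman ψ a b| ^ 4 = kloosterman ψ a b ^ 4 := by
      rw [show 4 = 2 * 2 from rfl, pow_mul, pow_mul, sq_abs]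
    rw [mul_pow, e]
    have h5 : (q - 1) * (c ^ 4 * kloosterman ψ a b ^ 4) ≤ (q - 1) * q ^ 4 := by
      have : c ^ 4 * ((q - 1) * kloosterman ψ a b ^ 4) ≤ c ^ 4 * (4 * q ^ 4) :=
        mul_le_mul_of_nonneg_left h (by positivity)
      have : (4 * c ^ 4) * q ^ 4 ≤ (q - 1) * q ^ 4 :=
        mul_le_mul_of_nonneg_right (by linarith) (by positivity)
      linarith
    exact le_of_mul_le_mul_left h5 (by linarith)
  exact le_of_pow_le_pow_left₀ (by norm_num) (by linarith) h4

/-- A bound for a character sum over the nonzero values of an additive map. -/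
theorem mul_abs_sum_addChar_inv_le (hψ : ψ.IsPrimitive) {c : ℤ} (hc : 0 ≤ c)
    (hcF : 4 * c ^ 4 + 1 ≤ Fintype.card F) {a : F} (ha : a ≠ 0) (L : F →ₗ[ZMod 2] F) :
    c * |∑ z, ψ (a * (L z)⁻¹)| ≤ #{z | L z = 0} * (Fintype.card F : ℤ) := by
  classical
  set q : ℤ := (Fintype.card F : ℤ) with hq
  have hq0 : 0 < q := by
    rw [hq]
    exact_mod_cast (Fintype.card_pos : 0 < Fintype.card F)
  let M : F → ℤ := fun s => ∑ z, ψ (s * L z)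
  have hM : ∀ s, 0 ≤ M s := by
    intro s
    have := AddChar.sum_eq_ite
      (ψ.compAddMonoidHom ((AddMonoidHom.mulLeft s).comp L.toAddMonoidHom))
    simp only [AddChar.compAddMonoidHom_apply, AddMonoidHom.comp_apply,
      AddMonoidHom.coe_mulLeft, LinearMap.toAddMonoidHom_coe] at this
    simp only [M, this]
    split_ifs <;> positivity
  have hMsum : ∑ s, M s = q * #{z | L z = 0} := by
    rw [sum_comm]
    simp only [sum_addChar_mul hψ]
    rw [← sum_filter, sum_const, nsmul_eq_mul, mul_comm]
  have hS : q * ∑ z, ψ (a * (L z)⁻¹) = ∑ s, kloosterman ψ a s * M s := by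
    simp only [kloosterman, M, sum_mul_sum]
    rw [sum_congr rfl fun s _ => sum_comm, sum_comm, mul_sum]
    refine sum_congr rfl fun z _ => ?_
    rw [sum_comm]
    have : ∀ v s, ψ (a * v⁻¹ + s * v) * ψ (s * L z) = ψ (a * v⁻¹) * ψ (s * (v + L z)) := by
      intro v s
      rw [← AddChar.map_add_eq_mul, ← AddChar.map_add_eq_mul]
      congr 1
      ring
    simp only [this, ← mul_sum, sum_addChar_mul hψ, CharTwo.add_eq_zero]
    simp [← hq, mul_comm]
  have : q * (c * |∑ z, ψ (a * (L z)⁻¹)|) ≤ q * (#{z | L z = 0} * q) := by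
    calc q * (c * |∑ z, ψ (a * (L z)⁻¹)|) = c * |∑ s, kloosterman ψ a s * M s| := by
          rw [← hS, abs_mul, abs_of_pos hq0]
          ring
      _ ≤ c * ∑ s, |kloosterman ψ a s| * M s := by
          refine mul_le_mul_of_nonneg_left ((abs_sum_le_sum_abs _ _).trans ?_) hc
          exact sum_le_sum fun s _ => by rw [abs_mul, abs_of_nonneg (hM s)]
      _ = ∑ s, (c * |kloosterman ψ a s|) * M s := by
          rw [mul_sum]
          exact sum_congr rfl fun s _ => by ring
      _ ≤ ∑ s, q * M s := sum_le_sum fun s _ =>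
          mul_le_mul_of_nonneg_right (mul_abs_kloosterman_le hψ hcF ha s) (hM s)
      _ = q * (#{z | L z = 0} * q) := by
          rw [← mul_sum, hMsum]
          ring
  exact le_of_mul_le_mul_left this hq0

/-- The sum of the inverses of the elements of the subspace spanned by `ker L`, `y` and `z`, when
`L` comes with the constants `a` and `s` of `InvSumData`. -/
def extInvSum (L : F →ₗ[ZMod 2] F) (a s y z : F) : F :=
  s + a * (L y)⁻¹ + a * (L z)⁻¹ + a * (L y + L z)⁻¹

theorem extInvSum_comm (L : F →ₗ[ZMod 2] F) (a s y z : F) :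
    extInvSum L a s y z = extInvSum L a s z y := by
  unfold extInvSum
  rw [add_comm (L y) (L z)]
  ring

theorem extInvSum_add_left (L : F →ₗ[ZMod 2] F) (a s y z : F) :
    extInvSum L a s (y + z) z = extInvSum L a s y z := by
  unfold extInvSum
  rw [map_add, add_assoc (L y), CharTwo.add_self_eq_zero, add_zero]
  ring

theorem extInvSum_eq (L : F →ₗ[ZMod 2] F) (a s : F) {y z : F}
    (hz : mulAddMap (L y) (L z) ≠ 0) :
    extInvSum L a s y z = s + a * (L y)⁻¹ + a * L y * (mulAddMap (L y) (L z))⁻¹ := by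
  have h2 : (2 : F) = 0 := CharTwo.two_eq_zero
  rw [mulAddMap_apply, mul_ne_zero_iff] at hz
  obtain ⟨hz1, hz2⟩ := hz
  rw [mulAddMap_apply]
  unfold extInvSum
  rw [add_comm (L y) (L z), add_assoc _ (a * (L z)⁻¹)]
  congr 1
  field_simp
  linear_combination a * L z * h2

namespace InvSumData

variable {L : F →ₗ[ZMod 2] F} {a s : F} {e : ℕ}

theorem mul_abs_sum_extInvSum_le (h : InvSumData L a s e) (hψ : ψ.IsPrimitive)
    (hψ1 : ∀ x, |ψ x| = 1) {c : ℤ} (hc : 0 ≤ c) (hcF : 4 * c ^ 4 + 1 ≤ Fintype.card F) {k y : F}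
    (hk : k ≠ 0) (hy : L y ≠ 0) :
    c * |∑ z, ψ (k * extInvSum L a s y z)| ≤
      2 ^ (e + 1) * (Fintype.card F : ℤ) + c * 2 ^ (e + 2) := by
  have h1 := h.extend hy
  set L₁ := mulAddMap (L y) ∘ₗ L
  set s₁ := s + a * (L y)⁻¹
  set a₁ := a * L y
  have hd : ∀ z, |ψ (k * extInvSum L a s y z) - ψ (k * s₁) * ψ (k * a₁ * (L₁ z)⁻¹)| ≤
      if L₁ z = 0 then 2 else 0 := by
    intro z
    rw [← AddChar.map_add_eq_mul]
    split_ifs with hz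
    · refine (abs_sub _ _).trans ?_
      rw [hψ1, hψ1]
      norm_num
    · rw [extInvSum_eq L a s hz, mul_assoc k, ← mul_add]
      simp [L₁, s₁, a₁]
  have hs : |∑ z, ψ (k * extInvSum L a s y z)| ≤
      |∑ z, ψ (k * a₁ * (L₁ z)⁻¹)| + 2 ^ (e + 2) := by
    have e1 : ∑ z, ψ (k * extInvSum L a s y z) = ψ (k * s₁) * ∑ z, ψ (k * a₁ * (L₁ z)⁻¹) +
        ∑ z, (ψ (k * extInvSum L a s y z) - ψ (k * s₁) * ψ (k * a₁ * (L₁ z)⁻¹)) := by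
      rw [sum_sub_distrib, mul_sum]
      ring
    rw [e1]
    refine (abs_add_le _ _).trans (add_le_add ?_ ?_)
    · rw [abs_mul, hψ1, one_mul]
    · refine (abs_sum_le_sum_abs _ _).trans ((sum_le_sum fun z _ => hd z).trans ?_)
      rw [← sum_filter, sum_const, h1.card_ker, nsmul_eq_mul]
      push_cast
      exact le_of_eq (by ring)
  have hm := mul_abs_sum_addChar_inv_le hψ hc hcF (mul_ne_zero hk h1.ne_zero) L₁
  rw [h1.card_ker] at hm
  push_cast at hm
  calc _ ≤ c * (|∑ z, ψ (k * a₁ * (L₁ z)⁻¹)| + 2 ^ (e + 2)) := mul_le_mul_of_nonneg_left hs hc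
    _ ≤ _ := by
      rw [mul_add]
      linarith

theorem mul_abs_sum_sum_extInvSum_le (h : InvSumData L a s e) (hψ : ψ.IsPrimitive)
    (hψ1 : ∀ x, |ψ x| = 1) {c : ℤ} (hc : 0 ≤ c) (hcF : 4 * c ^ 4 + 1 ≤ Fintype.card F) {k : F → F}
    (hk : ∀ y, L y ≠ 0 → k y ≠ 0) :
    c * |∑ y, ∑ z, ψ (k y * extInvSum L a s y z)| ≤ (Fintype.card F : ℤ) *
      (2 ^ (e + 1) * (Fintype.card F : ℤ) + c * (2 ^ (e + 2) + 2 ^ e)) := by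
  set q : ℤ := (Fintype.card F : ℤ) with hq
  have hy : ∀ y, c * |∑ z, ψ (k y * extInvSum L a s y z)| ≤
      (2 ^ (e + 1) * q + c * 2 ^ (e + 2)) + if L y = 0 then c * q else 0 := by
    intro y
    split_ifs with hy
    · have : c * |∑ z, ψ (k y * extInvSum L a s y z)| ≤ c * q := by
        refine mul_le_mul_of_nonneg_left ((abs_sum_le_sum_abs _ _).trans ?_) hc
        simp [hψ1, hq]
      have : 0 ≤ 2 ^ (e + 1) * q + c * 2 ^ (e + 2) := by positivity
      linarith
    · rw [add_zero]
      exact h.mul_abs_sum_extInvSum_le hψ hψ1 hc hcF (hk y hy) hy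
  calc _ ≤ c * ∑ y, |∑ z, ψ (k y * extInvSum L a s y z)| :=
        mul_le_mul_of_nonneg_left (abs_sum_le_sum_abs _ _) hc
    _ ≤ ∑ y, ((2 ^ (e + 1) * q + c * 2 ^ (e + 2)) + if L y = 0 then c * q else 0) := by
        rw [mul_sum]
        exact sum_le_sum fun y _ => hy y
    _ = _ := by
        rw [sum_add_distrib, ← sum_filter, sum_const, sum_const, h.card_ker, card_univ,
          nsmul_eq_mul, nsmul_eq_mul, ← hq]
        push_cast
        ring

theorem le_mul_sum_sum_extInvSum (h : InvSumData L a s e) (hψ : ψ.IsPrimitive)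
    (hψ1 : ∀ x, |ψ x| = 1) {c : ℤ} (hc : 0 ≤ c) (hcF : 4 * c ^ 4 + 1 ≤ Fintype.card F) :
    c * (Fintype.card F : ℤ) ^ 2 - (2 ^ (e + 2) - 1) * ((Fintype.card F : ℤ) *
      (2 ^ (e + 1) * (Fintype.card F : ℤ) + c * (2 ^ (e + 2) + 2 ^ e))) ≤
    c * ∑ y, ∑ z, (∑ u with L u = 0, ψ (u * extInvSum L a s y z)) *
      ((1 + ψ (y * extInvSum L a s y z)) * (1 + ψ (z * extInvSum L a s y z))) := by
  set q : ℤ := (Fintype.card F : ℤ) with hq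
  set R : ℤ := q * (2 ^ (e + 1) * q + c * (2 ^ (e + 2) + 2 ^ e)) with hR
  set S := extInvSum L a s with hS
  have key : ∀ k : F → F, (∀ y, L y ≠ 0 → k y ≠ 0) → -R ≤ c * ∑ y, ∑ z, ψ (k y * S y z) := by
    intro k hk
    have := h.mul_abs_sum_sum_extInvSum_le hψ hψ1 hc hcF hk
    rw [← abs_of_nonneg hc, ← abs_mul, abs_of_nonneg hc] at this
    exact (abs_le.1 this).1
  have key2 : ∀ u, L u = 0 → ∀ y, L y ≠ 0 → u + y ≠ 0 := by
    intro u hu y hy h0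
    apply hy
    have := congrArg L h0
    rwa [map_add, hu, zero_add, map_zero] at this
  have e1 : ∑ y, ∑ z, (∑ u with L u = 0, ψ (u * S y z)) *
      ((1 + ψ (y * S y z)) * (1 + ψ (z * S y z))) =
      ∑ u with L u = 0, ((∑ y, ∑ z, ψ (u * S y z)) + ((∑ y, ∑ z, ψ ((u + y) * S y z)) +
        (∑ y, ∑ z, ψ ((u + z) * S y z)) + ∑ y, ∑ z, ψ ((u + (y + z)) * S y z))) := by
    simp only [← sum_add_distrib]
    rw [sum_comm, sum_comm]
    simp only [sum_mul]
    rw [sum_congr rfl fun y _ => sum_comm, sum_comm]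
    refine sum_congr rfl fun u _ => sum_congr rfl fun y _ => sum_congr rfl fun z _ => ?_
    simp only [add_mul, AddChar.map_add_eq_mul]
    ring
  have b1 : ∀ u, L u = 0 → -R ≤ c * ∑ y, ∑ z, ψ ((u + y) * S y z) := fun u hu =>
    key (u + ·) (key2 u hu)
  have b2 : ∀ u, L u = 0 → -R ≤ c * ∑ y, ∑ z, ψ ((u + z) * S y z) := by
    intro u hu
    have e2 : ∑ y, ∑ z, ψ ((u + z) * S y z) = ∑ y, ∑ z, ψ ((u + y) * S y z) := by
      rw [sum_comm]
      exact sum_congr rfl fun y _ => sum_congr rfl fun z _ => by rw [hS, extInvSum_comm]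
    rw [e2]
    exact b1 u hu
  have b3 : ∀ u, L u = 0 → -R ≤ c * ∑ y, ∑ z, ψ ((u + (y + z)) * S y z) := by
    intro u hu
    have := b1 u hu
    rw [sum_comm] at this ⊢
    convert this using 2
    refine sum_congr rfl fun z _ => ?_
    refine Fintype.sum_equiv (Equiv.addRight z) _ _ fun y => ?_
    rw [Equiv.coe_addRight, hS, extInvSum_add_left]
  have b0 : ∀ u, L u = 0 → u ≠ 0 → -R ≤ c * ∑ y, ∑ z, ψ (u * S y z) := fun u _ hu0 =>
    key (fun _ => u) fun _ _ => hu0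
  rw [e1, mul_sum]
  have h0 : (0 : F) ∈ univ.filter (L · = 0) := by simp
  have hb : ∀ u ∈ univ.filter (L · = 0), (if u = 0 then c * q ^ 2 + R else 0) + (-(4 * R)) ≤
      c * ((∑ y, ∑ z, ψ (u * S y z)) + ((∑ y, ∑ z, ψ ((u + y) * S y z)) +
        (∑ y, ∑ z, ψ ((u + z) * S y z)) + ∑ y, ∑ z, ψ ((u + (y + z)) * S y z))) := by
    intro u hu
    rw [mem_filter_univ] at hu
    have t1 := b1 u hu
    have t2 := b2 u hu
    have t3 := b3 u hu
    rw [mul_add, mul_add c (_ + _), mul_add c (∑ y, ∑ z, ψ ((u + y) * S y z))]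
    split_ifs with hu0
    · have t0 : c * ∑ y : F, ∑ z : F, ψ (u * S y z) = c * q ^ 2 := by
        simp [hu0, hq, pow_two]
      linarith
    · have t0 := b0 u hu hu0
      linarith
  refine le_trans (le_of_eq ?_) (sum_le_sum hb)
  rw [sum_add_distrib, sum_ite_eq' _ _ _, if_pos h0, sum_const, h.card_ker, nsmul_eq_mul]
  push_cast
  ring

theorem card_extInvSum_degenerate_le (h : InvSumData L a s e) {y : F} (hy : L y ≠ 0) :
    #{z | L z = 0 ∨ L z = L y ∨ extInvSum L a s y z = 0} ≤ 2 ^ (e + 2) := by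
  have h1 := h.extend hy
  set L₁ := mulAddMap (L y) ∘ₗ L with hL₁
  set s₁ := s + a * (L y)⁻¹
  set a₁ := a * L y
  have : univ.filter (fun z => L z = 0 ∨ L z = L y ∨ extInvSum L a s y z = 0) ⊆
      univ.filter (L₁ · = 0) ∪ univ.filter (L₁ · = a₁ * s₁⁻¹) := by
    intro z hz
    rw [mem_filter_univ] at hz
    rw [mem_union, mem_filter_univ, mem_filter_univ]
    by_cases h0 : L₁ z = 0
    · exact Or.inl h0
    right
    have hz3 : extInvSum L a s y z = 0 := by
      rcases hz with hz | hz | hz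
      · exact absurd ((mulAddMap_eq_zero_iff _ _).2 (Or.inl hz)) h0
      · exact absurd ((mulAddMap_eq_zero_iff _ _).2 (Or.inr hz)) h0
      · exact hz
    have h0' : mulAddMap (L y) (L z) ≠ 0 := h0
    rw [extInvSum_eq L a s h0', CharTwo.add_eq_zero] at hz3
    change s₁ = a₁ * (L₁ z)⁻¹ at hz3
    rw [hz3, mul_inv, inv_inv, mul_inv_cancel_left₀ h1.ne_zero]
  refine (card_le_card this).trans ((card_union_le _ _).trans ?_)
  have t1 := h1.card_fiber_le 0
  have t2 := h1.card_fiber_le (a₁ * s₁⁻¹)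
  rw [pow_succ]
  omega

theorem sum_addChar_ker_mul (L : F →ₗ[ZMod 2] F) (ψ : AddChar F ℤ) (t : F)
    (h : ∑ u with L u = 0, ψ (u * t) ≠ 0) : ∀ u, L u = 0 → ψ (u * t) = 1 := by
  classical
  have := Fintype.ofFinite (LinearMap.ker L)
  have h1 := AddChar.sum_eq_ite (ψ.compAddMonoidHom
    ((AddMonoidHom.mulRight t).comp (LinearMap.ker L).subtype.toAddMonoidHom))
  have h2 : ∑ u with L u = 0, ψ (u * t) = ∑ u : LinearMap.ker L, ψ ((u : F) * t) :=
    sum_subtype (univ.filter (L · = 0)) (p := (· ∈ LinearMap.ker L)) (by simp)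
      (fun u => ψ (u * t))
  have h3 : ψ.compAddMonoidHom
      ((AddMonoidHom.mulRight t).comp (LinearMap.ker L).subtype.toAddMonoidHom) = 0 := by
    by_contra h0
    rw [if_neg h0] at h1
    exact h (h2.trans h1)
  intro u hu
  exact DFunLike.congr_fun h3 (⟨u, hu⟩ : LinearMap.ker L)

theorem hasInvSumZero_of_extInvSum (h : InvSumData L a s e)
    (hψ0 : ∀ x, 0 < ψ x → ∃ y, mulAddMap 1 y = x) {y z : F} (hy : L y ≠ 0) (hz : L z ≠ 0)
    (hyz : L z ≠ L y) (hS : extInvSum L a s y z ≠ 0)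
    (hu : ∀ u, L u = 0 → ψ (u * extInvSum L a s y z) = 1)
    (hy1 : ψ (y * extInvSum L a s y z) = 1) (hz1 : ψ (z * extInvSum L a s y z) = 1) :
    HasInvSumZero F (e + 3) := by
  have h1 := h.extend hy
  have h0 : mulAddMap (L y) (L z) ≠ 0 := by
    rw [ne_eq, mulAddMap_eq_zero_iff]
    tauto
  have h2 := h1.extend (v := z) h0
  rw [LinearMap.comp_apply, ← extInvSum_eq L a s h0] at h2
  set S := extInvSum L a s y z
  have h3 := (invSumData_mulAddMap (one_ne_zero (α := F))).comp (h2.smul hS) fun u hu0 => by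
    refine hψ0 u ?_
    have key : ∀ w, L w = 0 ∨ L w = L y → ψ (w * S) = 1 := by
      rintro w (hw | hw)
      · exact hu w hw
      · have := hu (w - y) (by rw [map_sub, hw, sub_self])
        rw [← sub_add_cancel w y, add_mul, AddChar.map_add_eq_mul, this, hy1, one_mul]
    obtain ⟨w, rfl⟩ : ∃ w, w * S = u := ⟨u * S⁻¹, inv_mul_cancel_right₀ hS u⟩
    simp only [LinearMap.comp_apply, LinearMap.mulLeft_apply] at hu0
    rw [mul_comm w S, inv_mul_cancel_left₀ hS, mulAddMap_eq_zero_iff, mulAddMap_eq_zero_iff] at hu0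
    rcases hu0 with hw | hw
    · rw [key w hw]
      exact one_pos
    · have := key (w - z) (by rw [← mulAddMap_eq_zero_iff, map_sub, map_sub, hw, sub_self])
      rw [← sub_add_cancel w z, add_mul, AddChar.map_add_eq_mul, this, hz1, one_mul]
      exact one_pos
  rw [inv_mul_cancel₀ hS, mul_one, inv_one, CharTwo.add_self_eq_zero] at h3
  exact ⟨_, _, by convert h3 using 1; ring⟩

end InvSumData

/-- If `F` is large enough, it has an `(e + 3)`-dimensional subspace with vanishing inverse sum. -/
theorem hasInvSumZero_of_card {e : ℕ} {c : ℤ} (he : 2 ^ e ≤ Fintype.card F) (hc : 0 ≤ c)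
    (hcF : 4 * c ^ 4 + 1 ≤ Fintype.card F)
    (hF : (2 ^ (e + 2) - 1) * (2 ^ (e + 1) * (Fintype.card F : ℤ) + c * (2 ^ (e + 2) + 2 ^ e)) +
      c * (2 ^ (e + 2) * (2 ^ (e + 2) + 2 ^ e)) < c * Fintype.card F) :
    HasInvSumZero F (e + 3) := by
  obtain ⟨L, a, s, h⟩ := exists_invSumData he
  obtain ⟨ψ, hψ, hψ1, hψ0⟩ := exists_addChar F
  by_contra hno
  have hlow := h.le_mul_sum_sum_extInvSum hψ hψ1 hc hcF
  set q : ℤ := (Fintype.card F : ℤ) with hq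
  set S := extInvSum L a s with hS
  have hq0 : 0 < q := by
    rw [hq]
    exact_mod_cast (Fintype.card_pos : 0 < Fintype.card F)
  have hψle : ∀ x, ψ x ≤ 1 := fun x => (le_abs_self _).trans (hψ1 x).le
  have hψor : ∀ x, ψ x = 1 ∨ ψ x = -1 := fun x => by
    have := hψ1 x
    rwa [abs_eq zero_le_one] at this
  have hI : ∀ y z, (∑ u with L u = 0, ψ (u * S y z)) * ((1 + ψ (y * S y z)) * (1 + ψ (z * S y z))) ≤
      if L y = 0 ∨ (L z = 0 ∨ L z = L y ∨ S y z = 0) then 2 ^ (e + 2) else 0 := by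
    intro y z
    have hnn : 0 ≤ (1 + ψ (y * S y z)) * (1 + ψ (z * S y z)) ∧
        (1 + ψ (y * S y z)) * (1 + ψ (z * S y z)) ≤ 4 := by
      rcases hψor (y * S y z) with h1 | h1 <;> rcases hψor (z * S y z) with h2 | h2 <;>
        rw [h1, h2] <;> norm_num
    split_ifs with hb
    · have hle : ∑ u with L u = 0, ψ (u * S y z) ≤ 2 ^ e := by
        refine (sum_le_sum fun u _ => hψle _).trans ?_
        rw [sum_const, h.card_ker]
        simp
      calc _ ≤ 2 ^ e * ((1 + ψ (y * S y z)) * (1 + ψ (z * S y z))) :=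
            mul_le_mul_of_nonneg_right hle hnn.1
        _ ≤ 2 ^ e * 4 := mul_le_mul_of_nonneg_left hnn.2 (by positivity)
        _ = _ := by ring
    · push Not at hb
      obtain ⟨hy, hz, hyz, hS0⟩ := hb
      by_contra! hpos
      have hne := hpos.ne'
      rw [mul_ne_zero_iff, mul_ne_zero_iff] at hne
      obtain ⟨n1, n2, n3⟩ := hne
      refine hno (h.hasInvSumZero_of_extInvSum hψ0 hy hz hyz hS0
        (InvSumData.sum_addChar_ker_mul L ψ _ n1) ?_ ?_)
      · rcases hψor (y * S y z) with h1 | h1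
        · exact h1
        · rw [h1] at n2
          exact absurd rfl n2
      · rcases hψor (z * S y z) with h1 | h1
        · exact h1
        · rw [h1] at n3
          exact absurd rfl n3
  have hup : ∑ y, ∑ z, (∑ u with L u = 0, ψ (u * S y z)) *
      ((1 + ψ (y * S y z)) * (1 + ψ (z * S y z))) ≤ q * (2 ^ (e + 2) * (2 ^ (e + 2) + 2 ^ e)) := by
    have hy : ∀ y, ∑ z, (∑ u with L u = 0, ψ (u * S y z)) *
        ((1 + ψ (y * S y z)) * (1 + ψ (z * S y z))) ≤
        2 ^ (e + 2) * 2 ^ (e + 2) + if L y = 0 then 2 ^ (e + 2) * q else 0 := by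
      intro y
      refine (sum_le_sum fun z _ => hI y z).trans ?_
      rw [← sum_filter, sum_const, nsmul_eq_mul, mul_comm]
      split_ifs with hy
      · refine le_add_of_nonneg_of_le (by positivity) ?_
        refine mul_le_mul_of_nonneg_left ?_ (by positivity)
        rw [hq]
        exact_mod_cast card_le_univ _
      · rw [add_zero]
        refine mul_le_mul_of_nonneg_left ?_ (by positivity)
        simp only [hy, false_or]
        exact_mod_cast h.card_extInvSum_degenerate_le hy
    refine (sum_le_sum fun y _ => hy y).trans (le_of_eq ?_)
    rw [sum_add_distrib, ← sum_filter, sum_const, sum_const, h.card_ker, card_univ, nsmul_eq_mul,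
      nsmul_eq_mul, ← hq]
    push_cast
    ring
  have h1 := mul_le_mul_of_nonneg_left hup hc
  have h2 := mul_lt_mul_of_pos_left hF hq0
  linarith [hlow.trans h1]

/-- `force n f` is `f n`, arranged so that the kernel evaluates `n` before substituting it. -/
def force {α : Type*} (n : ℕ) (f : ℕ → α) : α :=
  Nat.rec (f 0) (fun m _ => f (m + 1)) n

theorem force_eq {α : Type*} (n : ℕ) (f : ℕ → α) : force n f = f n := by
  cases n <;> rfl

section BitPolynomials

variable {R : Type*} [CommRing R]

/-- The value at `θ` of the polynomial over `𝔽₂` whose coefficients are the binary digits of the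
given number. -/
def bitEval (θ : R) : ℕ → R
  | 0 => 0
  | m + 1 => ((m + 1) % 2 : ℕ) + θ * bitEval θ ((m + 1) / 2)
decreasing_by omega

theorem bitEval_zero (θ : R) : bitEval θ 0 = 0 := by
  rw [bitEval]

theorem bitEval_eq (θ : R) (m : ℕ) : bitEval θ m = (m % 2 : ℕ) + θ * bitEval θ (m / 2) := by
  cases m with
  | zero => simp [bitEval_zero]
  | succ m => rw [bitEval]

theorem bitEval_one (θ : R) : bitEval θ 1 = 1 := by
  rw [bitEval_eq]; simp [bitEval_zero]

theorem bitEval_two_mul (θ : R) (r : ℕ) : bitEval θ (2 * r) = θ * bitEval θ r := by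
  rw [bitEval_eq]; simp

theorem bitEval_two (θ : R) : bitEval θ 2 = θ := by
  rw [show 2 = 2 * 1 from rfl, bitEval_two_mul, bitEval_one, mul_one]

theorem bitEval_mod_two_mul (θ : R) (c a : ℕ) :
    bitEval θ (c % 2 * a) = (c % 2 : ℕ) * bitEval θ a := by
  rcases Nat.mod_two_eq_zero_or_one c with h | h <;> simp [h, bitEval_zero]

theorem map_bitEval {S : Type*} [CommRing S] (g : R →+* S) (θ : R) (m : ℕ) :
    g (bitEval θ m) = bitEval (g θ) m := by
  induction m using Nat.strong_induction_on with
  | _ m ih =>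
    rcases Nat.eq_zero_or_pos m with rfl | hm
    · simp [bitEval_zero]
    · rw [bitEval_eq, bitEval_eq (g θ), map_add, map_mul, map_natCast, ih _ (by omega)]

theorem bitEval_xor (h2 : (2 : R) = 0) (θ : R) (a b : ℕ) :
    bitEval θ (a ^^^ b) = bitEval θ a + bitEval θ b := by
  induction a using Nat.strong_induction_on generalizing b with
  | _ a ih =>
    rcases Nat.eq_zero_or_pos a with rfl | ha
    · simp [bitEval_zero]
    · rw [bitEval_eq, bitEval_eq θ a, bitEval_eq θ b, Nat.xor_div_two, ih _ (by omega)]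
      have : (((a ^^^ b) % 2 : ℕ) : R) = (a % 2 : ℕ) + (b % 2 : ℕ) := by
        rw [Nat.xor_mod_two_eq]
        rcases Nat.mod_two_eq_zero_or_one a with h | h <;>
          rcases Nat.mod_two_eq_zero_or_one b with h' | h' <;>
          simp [Nat.add_mod, h, h', one_add_one_eq_two, h2]
      rw [this]
      ring

/-- The product of two binary polynomials modulo the polynomial `p` of degree `n`, by Horner's rule
on the first `fuel` binary digits of the second factor. -/
def mulModAux (p n a : ℕ) : ℕ → ℕ → ℕ
  | 0, _ => 0
  | fuel + 1, b => force (b / 2) fun b' => force (mulModAux p n a fuel b') fun r =>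
      (2 * r ^^^ 2 * r / 2 ^ n % 2 * p) ^^^ b % 2 * a

theorem bitEval_mulModAux (h2 : (2 : R) = 0) {θ : R} {p : ℕ} (hp : bitEval θ p = 0) (n a : ℕ)
    (fuel b : ℕ) (hb : b < 2 ^ fuel) :
    bitEval θ (mulModAux p n a fuel b) = bitEval θ a * bitEval θ b := by
  induction fuel generalizing b with
  | zero =>
    obtain rfl : b = 0 := by simpa using hb
    simp [mulModAux, bitEval_zero]
  | succ fuel ih =>
    rw [mulModAux, force_eq, force_eq, bitEval_xor h2, bitEval_xor h2, bitEval_two_mul,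
      bitEval_mod_two_mul, bitEval_mod_two_mul, hp, ih _ (by rw [pow_succ] at hb; omega),
      bitEval_eq θ b]
    ring

/-- The product of two binary polynomials modulo the polynomial `p` of degree `n`. -/
def mulMod (p n a b : ℕ) : ℕ :=
  force a fun a => force b fun b => mulModAux p n a (b.log2 + 1) b

theorem bitEval_mulMod (h2 : (2 : R) = 0) {θ : R} {p : ℕ} (hp : bitEval θ p = 0) (n a b : ℕ) :
    bitEval θ (mulMod p n a b) = bitEval θ a * bitEval θ b := by
  rw [mulMod, force_eq, force_eq]
  exact bitEval_mulModAux h2 hp n a _ b Nat.lt_log2_self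

/-- The `2 ^ t`-th power of a binary polynomial modulo the polynomial `p` of degree `n`. -/
def frobMod (p n : ℕ) : ℕ → ℕ → ℕ
  | 0, a => a
  | t + 1, a => force (mulMod p n a a) (frobMod p n t)

theorem bitEval_frobMod (h2 : (2 : R) = 0) {θ : R} {p : ℕ} (hp : bitEval θ p = 0) (n t a : ℕ) :
    bitEval θ (frobMod p n t a) = bitEval θ a ^ 2 ^ t := by
  induction t generalizing a with
  | zero => simp [frobMod]
  | succ t ih => rw [frobMod, force_eq, ih, bitEval_mulMod h2 hp, ← pow_two, ← pow_mul, pow_succ']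

theorem bitEval_X_ne_zero {m : ℕ} (hm : m ≠ 0) :
    bitEval (Polynomial.X : Polynomial (ZMod 2)) m ≠ 0 := by
  induction m using Nat.strong_induction_on with
  | _ m ih =>
    intro h
    rw [bitEval_eq] at h
    have h0 : ((m % 2 : ℕ) : ZMod 2) = 0 := by
      simpa using congrArg (Polynomial.eval 0) h
    rcases Nat.mod_two_eq_zero_or_one m with h' | h'
    · rw [h', Nat.cast_zero, zero_add] at h
      exact ih (m / 2) (by omega) (by omega) ((mul_eq_zero.1 h).resolve_left Polynomial.X_ne_zero)
    · rw [h', Nat.cast_one] at h0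
      exact one_ne_zero h0

theorem natDegree_bitEval_X_ne_zero {p : ℕ} (hp : 2 ≤ p) :
    (bitEval (Polynomial.X : Polynomial (ZMod 2)) p).natDegree ≠ 0 := by
  rw [bitEval_eq, ← Polynomial.C_eq_natCast, Polynomial.natDegree_C_add,
    Polynomial.natDegree_X_mul (bitEval_X_ne_zero (by omega))]
  exact Nat.succ_ne_zero _

theorem bitEval_X_dvd {p n N : ℕ} (hfrob : frobMod p n n 2 = 2) (hN : n ∣ N) :
    bitEval (Polynomial.X : Polynomial (ZMod 2)) p ∣ Polynomial.X ^ 2 ^ N - Polynomial.X := by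
  set P := bitEval (Polynomial.X : Polynomial (ZMod 2)) p with hP
  have h2 : (2 : AdjoinRoot P) = 0 := by
    rw [← map_ofNat (AdjoinRoot.of P) 2]
    exact map_zero _
  have hp : bitEval (AdjoinRoot.root P) p = 0 := by
    rw [← AdjoinRoot.mk_X, ← map_bitEval, ← hP, AdjoinRoot.mk_self]
  have hn : AdjoinRoot.root P ^ 2 ^ n = AdjoinRoot.root P := by
    have := bitEval_frobMod h2 hp n n 2
    rw [hfrob, bitEval_two] at this
    exact this.symm
  obtain ⟨t, rfl⟩ := hN
  have ht : AdjoinRoot.root P ^ 2 ^ (n * t) = AdjoinRoot.root P := by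
    induction t with
    | zero => simp
    | succ t ih => rw [Nat.mul_succ, pow_add, pow_mul, ih, hn]
  rw [← AdjoinRoot.mk_eq_zero, map_sub, map_pow, AdjoinRoot.mk_X, ht, sub_self]

end BitPolynomials

theorem exists_bitEval_eq_zero {p n N : ℕ} (hp : 2 ≤ p) (hfrob : frobMod p n n 2 = 2) (hN : n ∣ N)
    (hF : Fintype.card F = 2 ^ N) : ∃ θ : F, bitEval θ p = 0 := by
  have hdvd := Polynomial.map_dvd (algebraMap (ZMod 2) F) (bitEval_X_dvd hfrob hN)
  set P := (bitEval (Polynomial.X : Polynomial (ZMod 2)) p).map (algebraMap (ZMod 2) F) with hP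
  rw [Polynomial.map_sub, Polynomial.map_pow, Polynomial.map_X, ← hF] at hdvd
  have hs : (Polynomial.X ^ Fintype.card F - Polynomial.X : Polynomial F).Splits := by
    rw [Polynomial.splits_iff_card_roots, FiniteField.roots_X_pow_card_sub_X,
      FiniteField.X_pow_card_sub_X_natDegree_eq _ Fintype.one_lt_card]
    rfl
  have hPs : P.Splits := hs.of_dvd
    (FiniteField.X_pow_card_sub_X_ne_zero _ Fintype.one_lt_card) hdvd
  obtain ⟨θ, hθ⟩ := hPs.exists_eval_eq_zero (fun h => natDegree_bitEval_X_ne_zero hp (by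
    rw [← Polynomial.natDegree_map (algebraMap (ZMod 2) F), ← hP]
    exact Polynomial.natDegree_eq_of_degree_eq_some h))
  refine ⟨θ, ?_⟩
  rw [hP, Polynomial.eval_map_algebraMap] at hθ
  have := map_bitEval (Polynomial.aeval θ : Polynomial (ZMod 2) →ₐ[ZMod 2] F).toRingHom
    Polynomial.X p
  simp only [AlgHom.toRingHom_eq_coe, RingHom.coe_coe, Polynomial.aeval_X] at this
  rw [← this, hθ]

/-- The composition of the maps `x ↦ x (x + l)`, for `l` in the list `ls`, applied to `v`. -/
def iterMulAdd (p n : ℕ) (ls : List ℕ) (v : ℕ) : ℕ :=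
  ls.foldl (fun x l => mulMod p n x (x ^^^ l)) v

/-- Extends the data of `InvSumData` along the vectors in the list, and checks that the sum of
inverses ends up zero. The constants `a` and `a * s` are represented by `a₀` and `a₁`, and `w` is
the expected inverse of the last value of `a`. -/
def checkVectors (p n w : ℕ) : List ℕ → List ℕ → ℕ → ℕ → Bool
  | [], _, a₀, a₁ => a₁.beq 0 && (mulMod p n a₀ w).beq 1
  | v :: vs, ls, a₀, a₁ =>
    force (iterMulAdd p n ls v) fun l =>
    force (mulMod p n a₀ l) fun b₀ =>
    force (mulMod p n a₀ a₀ ^^^ mulMod p n l a₁) fun b₁ =>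
    checkVectors p n w vs (ls ++ [l]) b₀ b₁

theorem bitEval_ne_zero_of_checkVectors {θ : F} {p n w : ℕ} (hp : bitEval θ p = 0)
    {vs ls : List ℕ} {a₀ a₁ : ℕ} (h : checkVectors p n w vs ls a₀ a₁ = true) :
    bitEval θ a₀ ≠ 0 := by
  have h2 : (2 : F) = 0 := CharTwo.two_eq_zero
  induction vs generalizing ls a₀ a₁ with
  | nil =>
    rw [checkVectors, Bool.and_eq_true, Nat.beq_eq, Nat.beq_eq] at h
    have := bitEval_mulMod h2 hp n a₀ w
    rw [h.2, bitEval_one] at this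
    exact left_ne_zero_of_mul (this ▸ one_ne_zero)
  | cons v vs ih =>
    rw [checkVectors, force_eq, force_eq, force_eq] at h
    have := ih h
    rw [bitEval_mulMod h2 hp] at this
    exact left_ne_zero_of_mul this

theorem hasInvSumZero_of_checkVectors {θ : F} {p n w : ℕ} (hp : bitEval θ p = 0)
    {vs ls : List ℕ} {a₀ a₁ d : ℕ} (h : checkVectors p n w vs ls a₀ a₁ = true)
    {L : F →ₗ[ZMod 2] F} {s : F} (hL : InvSumData L (bitEval θ a₀) s d)
    (hs : bitEval θ a₀ * s = bitEval θ a₁)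
    (hls : ∀ m, L (bitEval θ m) = bitEval θ (iterMulAdd p n ls m)) :
    HasInvSumZero F (d + vs.length) := by
  have h2 : (2 : F) = 0 := CharTwo.two_eq_zero
  induction vs generalizing ls a₀ a₁ d L s with
  | nil =>
    have ha := bitEval_ne_zero_of_checkVectors hp h
    rw [checkVectors, Bool.and_eq_true, Nat.beq_eq, Nat.beq_eq] at h
    rw [h.1, bitEval_zero] at hs
    obtain rfl : s = 0 := (mul_eq_zero.1 hs).resolve_left ha
    exact ⟨L, _, hL⟩
  | cons v vs ih =>
    rw [checkVectors, force_eq, force_eq, force_eq] at h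
    have ha := bitEval_ne_zero_of_checkVectors hp h
    rw [bitEval_mulMod h2 hp, ← hls] at ha
    have hv := right_ne_zero_of_mul ha
    rw [List.length_cons, add_comm vs.length, ← add_assoc]
    refine ih h (L := mulAddMap (L (bitEval θ v)) ∘ₗ L)
      (s := s + bitEval θ a₀ * (L (bitEval θ v))⁻¹) ?_ ?_ fun m => ?_
    · rw [bitEval_mulMod h2 hp, ← hls]
      exact hL.extend hv
    · rw [bitEval_mulMod h2 hp, bitEval_xor h2, bitEval_mulMod h2 hp, bitEval_mulMod h2 hp, ← hls,
        ← hs]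
      field_simp
      ring
    · rw [iterMulAdd, List.foldl_append, List.foldl_cons, List.foldl_nil, bitEval_mulMod h2 hp,
        bitEval_xor h2, ← iterMulAdd, ← hls, ← hls, LinearMap.comp_apply, mulAddMap_apply]

/-- A certificate for the existence of a subspace of `𝔽₂[X] / (p)` whose inverses sum to zero. The
subspace is spanned by the powers of `X` below `X ^ dim` and by `extras`. -/
structure InvSumCert where
  /-- The degree of the extension of `𝔽₂`. -/
  degree : ℕ
  /-- The defining polynomial of the extension. -/
  poly : ℕ
  /-- The number of powers of `X` in the basis. -/
  dim : ℕ
  /-- The other elements of the basis. -/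
  extras : List ℕ
  /-- The inverse of the last value of the constant `a` of `InvSumData`. -/
  witness : ℕ

namespace InvSumCert

/-- The dimension of the subspace. -/
def order (c : InvSumCert) : ℕ := c.dim + c.extras.length

/-- The verification of the certificate. -/
def check (c : InvSumCert) : Bool :=
  Nat.ble 2 c.poly && (frobMod c.poly c.degree c.degree 2).beq 2 &&
    checkVectors c.poly c.degree c.witness ((List.range c.dim).map (2 ^ ·) ++ c.extras) [] 1 0

theorem hasInvSumZero {c : InvSumCert} (hc : c.check = true) {N : ℕ} (hN : c.degree ∣ N)
    (hF : Fintype.card F = 2 ^ N) : HasInvSumZero F c.order := by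
  rw [check, Bool.and_eq_true, Bool.and_eq_true, Nat.ble_eq, Nat.beq_eq] at hc
  obtain ⟨⟨hp, hfrob⟩, hv⟩ := hc
  obtain ⟨θ, hθ⟩ := exists_bitEval_eq_zero hp hfrob hN hF
  have := hasInvSumZero_of_checkVectors hθ hv (L := LinearMap.id) (s := 0) (d := 0)
    (by rw [bitEval_one]; exact InvSumData.id) (by rw [bitEval_zero, mul_zero]) fun m => rfl
  simpa [order] using this

end InvSumCert

/-- Certificates for the pairs of a small degree and an order. -/
def invSumCerts : List InvSumCert := [
  ⟨6, 67, 1, [14, 22], 1⟩,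
  ⟨7, 131, 1, [24, 98], 25⟩,
  ⟨8, 283, 1, [6, 40], 105⟩,
  ⟨7, 131, 2, [4, 16], 1⟩,
  ⟨8, 283, 2, [96, 188], 219⟩,
  ⟨8, 283, 2, [32, 24, 196], 86⟩,
  ⟨9, 515, 0, [261, 7, 115], 234⟩,
  ⟨9, 515, 1, [120, 8, 402], 292⟩,
  ⟨9, 515, 1, [507, 460, 66, 142], 96⟩,
  ⟨9, 515, 1, [483, 388, 214, 2, 32], 221⟩,
  ⟨10, 1033, 0, [192, 15, 258], 363⟩,
  ⟨10, 1033, 1, [999, 10, 422], 440⟩,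
  ⟨10, 1033, 2, [58, 12, 276], 491⟩,
  ⟨10, 1033, 2, [798, 886, 4, 8, 176], 920⟩,
  ⟨11, 2053, 1, [24, 1838], 591⟩,
  ⟨11, 2053, 1, [1824, 26, 994], 22⟩,
  ⟨11, 2053, 2, [1090, 4, 688], 438⟩,
  ⟨11, 2053, 3, [937, 418, 144, 1088], 462⟩,
  ⟨11, 2053, 2, [1517, 2005, 121, 1922, 24, 136], 1342⟩,
  ⟨12, 4105, 1, [356, 22, 3720], 1841⟩,
  ⟨12, 4105, 2, [2527, 48, 456], 1398⟩,
  ⟨12, 4105, 3, [3224, 1395, 160, 560], 226⟩,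
  ⟨12, 4105, 3, [2816, 2894, 3761, 40, 264], 65⟩,
  ⟨12, 4105, 1, [1131, 3610, 2958, 2537, 3282, 1970, 6, 56], 1755⟩,
  ⟨13, 8219, 1, [6, 7546], 4368⟩,
  ⟨13, 8219, 2, [72, 1920], 3366⟩,
  ⟨13, 8219, 2, [1897, 48, 792], 5116⟩,
  ⟨13, 8219, 4, [3729, 6504, 704, 1328], 4800⟩,
  ⟨13, 8219, 4, [961, 3331, 7014, 32, 1360], 3896⟩,
  ⟨13, 8219, 3, [6893, 4483, 7102, 5503, 7959, 48, 128], 3074⟩,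
  ⟨14, 16417, 2, [7060, 36, 1820], 11136⟩,
  ⟨14, 16417, 4, [13930, 2994, 736, 5616], 3629⟩,
  ⟨14, 16417, 5, [13824, 11360, 672, 3488], 8228⟩,
  ⟨14, 16417, 5, [10682, 4425, 6985, 224, 512], 13795⟩,
  ⟨14, 16417, 3, [12537, 13672, 4504, 4232, 2430, 7904, 40, 64], 11895⟩,
  ⟨15, 32771, 2, [60, 18760], 21268⟩,
  ⟨15, 32771, 3, [8, 8672], 2966⟩,
  ⟨15, 32771, 5, [26029, 800, 4096], 29507⟩,
  ⟨15, 32771, 5, [6752, 24420, 160, 256], 24303⟩,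
  ⟨15, 32771, 5, [19747, 13363, 4923, 608, 2496], 11999⟩,
  ⟨15, 32771, 5, [24298, 28638, 22406, 32092, 544, 1408], 3220⟩,
  ⟨15, 32771, 1, [24125, 16304, 10200, 13990, 25965, 29075, 17874, 27927, 22148, 6, 112], 24026⟩,
  ⟨16, 65579, 5, [55513, 53239, 64, 18944], 555⟩,
  ⟨16, 65579, 6, [6235, 36853, 960, 1280], 10062⟩,
  ⟨16, 65579, 6, [42798, 45526, 33007, 576, 2432], 62276⟩,
  ⟨16, 65579, 5, [35873, 1713, 642, 48749, 37416, 288, 18528], 35982⟩,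
  ⟨17, 131081, 2, [16, 91976], 104949⟩,
  ⟨17, 131081, 3, [64, 103608], 36520⟩,
  ⟨17, 131081, 6, [33405, 128, 86592], 88027⟩,
  ⟨17, 131081, 6, [116328, 102697, 576, 13632], 91426⟩,
  ⟨17, 131081, 5, [119559, 113087, 57321, 16622, 736, 3552], 51226⟩,
  ⟨17, 131081, 7, [16289, 120135, 9914, 512, 16512], 117323⟩,
  ⟨18, 262153, 6, [163257, 512, 11584], 99449⟩,
  ⟨18, 262153, 7, [160855, 896, 107520], 93479⟩,
  ⟨18, 262153, 3, [78400, 168826, 77755, 107989, 199894, 63816, 736, 3520], 8367⟩,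
  ⟨18, 262153, 5, [15322, 202329, 72998, 206516, 181249, 96, 21664], 226286⟩,
  ⟨19, 524327, 2, [36, 482500], 122997⟩,
  ⟨19, 524327, 3, [88, 348688], 199390⟩,
  ⟨19, 524327, 7, [25369, 256, 109184], 48315⟩,
  ⟨19, 524327, 7, [437394, 411290, 512, 6528], 453618⟩,
  ⟨19, 524327, 5, [246367, 423299, 83868, 454052, 394259, 224, 3360], 125139⟩,
  ⟨20, 1048585, 7, [1041120, 128, 107008], 1030160⟩,
  ⟨20, 1048585, 6, [904422, 320282, 941092, 256, 120320], 127934⟩,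
  ⟨20, 1048585, 5, [515464, 76916, 742824, 194927, 354502, 384, 32928], 500834⟩,
  ⟨21, 2097157, 3, [128, 1671520], 332649⟩,
  ⟨21, 2097157, 6, [1792983, 1282399, 320, 501312], 425191⟩,
  ⟨21, 2097157, 7, [894342, 1768908, 512, 5120], 891505⟩,
  ⟨21, 2097157, 5, [711174, 221062, 1218600, 1905373, 188282, 352, 58400], 1645419⟩,
  ⟨22, 4194307, 7, [4089225, 2719136, 768, 822272], 1146350⟩,
  ⟨22, 4194307, 5, [9767, 23323, 2793752, 223835, 1805401, 768, 557408], 2367453⟩,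
  ⟨23, 8388641, 3, [304, 2854984], 2537363⟩,
  ⟨23, 8388641, 6, [7295327, 577451, 6172873, 384, 196800], 7622104⟩,
  ⟨23, 8388641, 7, [6005547, 6163970, 1049070, 768, 169088], 5472965⟩,
  ⟨24, 16777243, 5, [4473152, 2863023, 8729770, 9949063, 896, 200160], 5228599⟩,
  ⟨24, 16777243, 7, [12834786, 4189301, 8306034, 384, 79360], 13341266⟩,
  ⟨25, 33554441, 3, [32, 462280], 21532762⟩,
  ⟨25, 33554441, 4, [26010173, 23207168, 15093421, 4472068, 2313799, 15384625, 272, 121472], 8293091⟩,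
  ⟨26, 67108891, 5, [7639917, 48896132, 44226234, 41118258, 28616491, 448, 2066944], 10090546⟩,
  ⟨27, 134217767, 5, [56988416, 10574416, 5021955, 120196167, 82009913, 416, 17091808], 91059390⟩,
  ⟨29, 536870917, 3, [136, 451130488], 167307914⟩]

theorem check_invSumCerts : invSumCerts.all InvSumCert.check = true := by
  decide +kernel

/-- The extension degree from which on a general argument applies to subspaces of dimension `k`. -/
def degreeBound (k : ℕ) : ℕ :=
  [14, 22, 30, 10, 13, 16, 19, 22, 25, 28].getD (k - 3) 0

theorem any_invSumCerts : ∀ k < 13, ∀ n < 30, 3 ≤ k → k + 3 ≤ n → n < degreeBound k →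
    invSumCerts.any fun c => c.degree ∣ n ∧ c.order = k := by
  decide +kernel

theorem hasInvSumZero_of_lt_degreeBound {n k : ℕ} (hk3 : 3 ≤ k) (hk12 : k ≤ 12) (hn : k + 3 ≤ n)
    (hnb : n < degreeBound k) (hF : Fintype.card F = 2 ^ n) : HasInvSumZero F k := by
  have hb : ∀ k < 13, degreeBound k ≤ 30 := by decide
  obtain ⟨c, hc, h⟩ := List.any_eq_true.1 <| any_invSumCerts k (by omega) n
    (hnb.trans_le (hb k (by omega))) hk3 hn hnb
  obtain ⟨hdvd, rfl⟩ := of_decide_eq_true h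
  exact InvSumCert.hasInvSumZero (List.all_eq_true.1 check_invSumCerts c hc) hdvd hF

theorem hasInvSumZero_of_le_twelve {n k : ℕ} (hk3 : 3 ≤ k) (hk12 : k ≤ 12) (hn : k + 3 ≤ n)
    (hF : Fintype.card F = 2 ^ n) : HasInvSumZero F k := by
  rcases lt_or_ge n (degreeBound k) with hnb | hnb
  · exact hasInvSumZero_of_lt_degreeBound hk3 hk12 hn hnb hF
  have hq : ∀ {b}, b ≤ n → 2 ^ b ≤ Fintype.card F := fun h => by
    rw [hF]; exact Nat.pow_le_pow_right two_pos h
  have hlt : ∀ {b}, b < n → 2 ^ b < Fintype.card F := fun h => by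
    rw [hF]; exact Nat.pow_lt_pow_right one_lt_two h
  have h3 : 6 ≤ n → HasInvSumZero F 3 := fun h => by
    rcases lt_or_ge n 14 with h' | h'
    · exact hasInvSumZero_of_lt_degreeBound le_rfl (by norm_num) h h' hF
    · have := hq h'
      zify at this
      refine hasInvSumZero_of_card (e := 0) (c := 7) ?_ ?_ ?_ ?_ <;> norm_num at this ⊢ <;> omega
  have h4 : 7 ≤ n → HasInvSumZero F 4 := fun h => by
    rcases lt_or_ge n 22 with h' | h'
    · exact hasInvSumZero_of_lt_degreeBound (by norm_num) (by norm_num) h h' hF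
    · have := hq h'
      zify at this
      refine hasInvSumZero_of_card (e := 1) (c := 30) ?_ ?_ ?_ ?_ <;> norm_num at this ⊢ <;> omega
  have h5 : 8 ≤ n → HasInvSumZero F 5 := fun h => by
    rcases lt_or_ge n 30 with h' | h'
    · exact hasInvSumZero_of_lt_degreeBound (by norm_num) (by norm_num) h h' hF
    · have := hq h'
      zify at this
      refine hasInvSumZero_of_card (e := 2) (c := 127) ?_ ?_ ?_ ?_ <;> norm_num at this ⊢ <;> omega
  have h6 : 10 ≤ n → HasInvSumZero F 6 := fun h =>
    (h3 (by omega)).add (h3 (by omega)) (hlt (by omega))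
  have h7 : 13 ≤ n → HasInvSumZero F 7 := fun h =>
    (h3 (by omega)).add (h4 (by omega)) (hlt (by omega))
  have h8 : 16 ≤ n → HasInvSumZero F 8 := fun h =>
    (h3 (by omega)).add (h5 (by omega)) (hlt (by omega))
  have h9 : 19 ≤ n → HasInvSumZero F 9 := fun h =>
    (h3 (by omega)).add (h6 (by omega)) (hlt (by omega))
  interval_cases k
  · exact h3 hn
  · exact h4 hn
  · exact h5 hn
  all_goals simp only [degreeBound, List.getD_eq_getElem?_getD] at hnb
  all_goals norm_num at hnb
  · exact h6 hnb
  · exact h7 hnb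
  · exact h8 hnb
  · exact h9 hnb
  · exact (h3 (by omega)).add (h7 (by omega)) (hlt hnb)
  · exact (h3 (by omega)).add (h8 (by omega)) (hlt hnb)
  · exact (h3 (by omega)).add (h9 (by omega)) (hlt hnb)

end

/-- Let `3 ≤ k ≤ 12` and `n ≥ k + 3`.  Then the multiplicative inverse function
`f_inv(x) = x⁻¹` (with `f_inv(0) = 0`) on `F_{2^n}` is not `k`th order sum-free:
there is a `k`-dimensional `F₂`-affine subspace `A = v + E` of `F_{2^n}` with
`∑_{x ∈ A} f_inv(x) = 0`. -/
theorem inv_not_sum_free_of_k_le_twelve (n k : ℕ) (hk3 : 3 ≤ k) (hk12 : k ≤ 12)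
    (hn : k + 3 ≤ n) :
    ∃ (E : Submodule (ZMod 2) (GaloisField 2 n)) (v : GaloisField 2 n),
      Module.finrank (ZMod 2) E = k ∧
      ∑ᶠ u : E, (v + (u : GaloisField 2 n))⁻¹ = 0 := by
  classical
  have := Fintype.ofFinite (GaloisField 2 n)
  have hF : Fintype.card (GaloisField 2 n) = 2 ^ n := by
    rw [← Nat.card_eq_fintype_card, GaloisField.card 2 n (by omega)]
  obtain ⟨E, hE, hsum⟩ := (hasInvSumZero_of_le_twelve hk3 hk12 hn hF).exists_submodule
  exact ⟨E, 0, hE, by simpa only [zero_add] using hsum⟩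
end

section
/- Let n be an odd integer with 3 ≤ n ≤ 27 and let k be an integer with 1 ≤ k ≤ n − 1. Then the multiplicative inverse function f_inv on F_{2^n} is kth order sum-free if and only if k ∈ {1, 2, n−2, n−1}. -/
open Polynomial

/-! ### Sums of inverses over affine subspaces -/

section SumFree

open scoped Classical in
/-- `L` is a linear map with `∑_{u ∈ ker L} (v + u)⁻¹ = A / L v` for all `v ∉ ker L`. -/
def HasCosetSum {K : Type*} [Field K] [Fintype K] [Algebra (ZMod 2) K]
    (L : K →ₗ[ZMod 2] K) (A : K) : Prop :=
  A ≠ 0 ∧ ∀ v, L v ≠ 0 → ∑ u with L u = 0, (v + u)⁻¹ = A / L v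

variable {K : Type*} [Field K] [Fintype K] [CharP K 2] [Algebra (ZMod 2) K]

/-- The additive map `x ↦ L x * (L x + b)`. -/
def quadStep (L : K →ₗ[ZMod 2] K) (b : K) : K →ₗ[ZMod 2] K :=
  AddMonoidHom.toZModLinearMap 2 <|
    AddMonoidHom.mk' (fun x => L x * (L x + b)) fun x y => by
      rw [map_add]
      linear_combination (L x * L y) * CharTwo.two_eq_zero (R := K)

omit [Fintype K] in
@[simp] lemma quadStep_apply (L : K →ₗ[ZMod 2] K) (b x : K) :
    quadStep L b x = L x * (L x + b) := rfl

omit [Fintype K] in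
lemma quadStep_eq_zero_iff (L : K →ₗ[ZMod 2] K) (w x : K) :
    quadStep L (L w) x = 0 ↔ L x = 0 ∨ L x = L w := by
  rw [quadStep_apply, mul_eq_zero, CharTwo.add_eq_zero]

open scoped Classical in
lemma sum_quadStep (L : K →ₗ[ZMod 2] K) {w : K} (hw : L w ≠ 0) (f : K → K) :
    ∑ u with quadStep L (L w) u = 0, f u =
      ∑ u with L u = 0, f u + ∑ u with L u = 0, f (w + u) := by
  simp only [quadStep_eq_zero_iff]
  rw [Finset.filter_or, Finset.sum_union]
  · congr 1
    refine Finset.sum_bij' (fun u _ => w + u) (fun u _ => w + u) ?_ ?_ ?_ ?_ ?_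
    · intro a ha
      simp only [Finset.mem_filter, Finset.mem_univ, true_and] at ha ⊢
      rw [map_add, ha, CharTwo.add_self_eq_zero]
    · intro a ha
      simp only [Finset.mem_filter, Finset.mem_univ, true_and] at ha ⊢
      rw [map_add, ha, add_zero]
    · intro a _
      rw [← add_assoc, CharTwo.add_self_eq_zero, zero_add]
    · intro a _
      rw [← add_assoc, CharTwo.add_self_eq_zero, zero_add]
    · intro a _
      rw [← add_assoc, CharTwo.add_self_eq_zero, zero_add]
  · rw [Finset.disjoint_filter]
    intro x _ h h'
    exact hw (h'.symm.trans h)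

lemma HasCosetSum.quadStep {L : K →ₗ[ZMod 2] K} {A : K} (h : HasCosetSum L A) {w : K}
    (hw : L w ≠ 0) : HasCosetSum (quadStep L (L w)) (L w * A) := by
  refine ⟨mul_ne_zero hw h.1, fun v hv => ?_⟩
  have h1 : L v ≠ 0 := fun h0 => hv ((quadStep_eq_zero_iff L w v).2 (Or.inl h0))
  have h2 : L v + L w ≠ 0 := fun h0 =>
    hv ((quadStep_eq_zero_iff L w v).2 (Or.inr (CharTwo.add_eq_zero.1 h0)))
  rw [sum_quadStep L hw, h.2 v h1]
  simp only [← add_assoc]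
  rw [h.2 (v + w) (by rwa [map_add]), map_add, quadStep_apply]
  field_simp
  linear_combination (A * L v) * CharTwo.two_eq_zero (R := K)

omit [CharP K 2] in
lemma HasCosetSum.id : HasCosetSum (LinearMap.id : K →ₗ[ZMod 2] K) 1 := by
  refine ⟨one_ne_zero, fun v _ => ?_⟩
  rw [Finset.sum_eq_single 0] <;> simp

omit [Fintype K] in
lemma ker_quadStep (L : K →ₗ[ZMod 2] K) (w : K) :
    LinearMap.ker (quadStep L (L w)) = Submodule.span (ZMod 2) {w} ⊔ LinearMap.ker L := by
  ext x
  rw [LinearMap.mem_ker, quadStep_eq_zero_iff, Submodule.mem_sup]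
  constructor
  · rintro (h | h)
    · exact ⟨0, zero_mem _, x, h, zero_add x⟩
    · refine ⟨w, Submodule.mem_span_singleton_self w, x - w, ?_, by ring⟩
      rw [LinearMap.mem_ker, map_sub, h, sub_self]
  · rintro ⟨y, hy, z, hz, rfl⟩
    rw [LinearMap.mem_ker] at hz
    obtain ⟨c, rfl⟩ := Submodule.mem_span_singleton.1 hy
    rw [map_add, hz, map_smul, add_zero]
    fin_cases c
    · left; exact zero_smul _ _
    · right; exact one_smul _ _

lemma finrank_ker_quadStep (L : K →ₗ[ZMod 2] K) {w : K} (hw : L w ≠ 0) :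
    Module.finrank (ZMod 2) (LinearMap.ker (quadStep L (L w))) =
      Module.finrank (ZMod 2) (LinearMap.ker L) + 1 := by
  have hw0 : w ≠ 0 := by rintro rfl; exact hw (map_zero L)
  have hdisj : Submodule.span (ZMod 2) {w} ⊓ LinearMap.ker L = ⊥ := by
    rw [← disjoint_iff, disjoint_comm, Submodule.disjoint_span_singleton' hw0]
    exact hw
  have := Submodule.finrank_sup_add_finrank_inf_eq (Submodule.span (ZMod 2) {w})
    (LinearMap.ker L)
  rw [hdisj, finrank_bot, finrank_span_singleton hw0] at this
  rw [ker_quadStep]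
  omega

/-- Every subspace is the kernel of a map satisfying the coset sum formula. -/
lemma exists_hasCosetSum (E : Submodule (ZMod 2) K) :
    ∃ (L : K →ₗ[ZMod 2] K) (A : K), LinearMap.ker L = E ∧ HasCosetSum L A := by
  suffices H : ∀ s : Finset K, ∃ (L : K →ₗ[ZMod 2] K) (A : K),
      LinearMap.ker L = Submodule.span (ZMod 2) (s : Set K) ∧ HasCosetSum L A by
    obtain ⟨s, rfl⟩ : E.FG := IsNoetherian.noetherian E
    exact H s
  classical
  intro s
  induction s using Finset.induction_on with
  | empty => exact ⟨LinearMap.id, 1, by simp, HasCosetSum.id⟩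
  | insert w s _ ih =>
    obtain ⟨L, A, hL, h⟩ := ih
    rw [Finset.coe_insert, Submodule.span_insert, ← hL]
    by_cases hw : L w = 0
    · refine ⟨L, A, ?_, h⟩
      rw [right_eq_sup, Submodule.span_singleton_le_iff_mem]
      exact hw
    · exact ⟨_, _, ker_quadStep L w, h.quadStep hw⟩

omit [CharP K 2] in
open scoped Classical in
lemma finsum_submodule_eq (E : Submodule (ZMod 2) K) (f : K → K) :
    ∑ᶠ u : E, f u = ∑ u with u ∈ E, f u := by
  rw [finsum_eq_sum_of_fintype, Finset.sum_subtype (p := fun u => u ∈ E) _ (by simp)]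

open scoped Classical in
/-- A coset of `E` not containing zero has nonzero sum of inverses. -/
lemma sum_inv_coset_ne_zero (E : Submodule (ZMod 2) K) {v : K} (hv : v ∉ E) :
    ∑ u with u ∈ E, (v + u)⁻¹ ≠ 0 := by
  obtain ⟨L, A, rfl, hA, h⟩ := exists_hasCosetSum E
  simp only [LinearMap.mem_ker] at hv ⊢
  rw [h v hv]
  exact div_ne_zero hA hv

open scoped Classical in
lemma sum_inv_coset_of_mem (E : Submodule (ZMod 2) K) {v : K} (hv : v ∈ E) :
    ∑ u with u ∈ E, (v + u)⁻¹ = ∑ u with u ∈ E, u⁻¹ := by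
  refine Finset.sum_bij' (fun u _ => v + u) (fun u _ => v + u) ?_ ?_ ?_ ?_ (fun _ _ => rfl)
  · intro a ha
    simpa [E.add_mem_iff_right hv] using ha
  · intro a ha
    simpa [E.add_mem_iff_right hv] using ha
  · intro a _
    rw [← add_assoc, CharTwo.add_self_eq_zero, zero_add]
  · intro a _
    rw [← add_assoc, CharTwo.add_self_eq_zero, zero_add]

omit [CharP K 2] [Algebra (ZMod 2) K] in
lemma sum_inv_univ (hK : 2 < Fintype.card K) : ∑ x : K, x⁻¹ = 0 := by
  obtain ⟨c, hc0, hc1⟩ : ∃ c : K, c ≠ 0 ∧ c ≠ 1 := by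
    by_contra! H
    classical
    have : (Finset.univ : Finset K) ⊆ {0, 1} := fun x _ => by
      by_cases hx : x = 0
      · simp [hx]
      · simp [H x hx]
    have := (Finset.card_le_card this).trans Finset.card_le_two
    rw [Finset.card_univ] at this
    omega
  have key : c⁻¹ * ∑ x : K, x⁻¹ = ∑ x : K, x⁻¹ := by
    rw [Finset.mul_sum, ← Equiv.sum_comp (Equiv.mulLeft₀ c hc0) (fun x => x⁻¹)]
    exact Finset.sum_congr rfl fun x _ => (mul_inv c x).symm
  by_contra h
  exact hc1 (inv_eq_one.1 ((mul_eq_right₀ h).1 key))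

open scoped Classical in
/-- Duality between the kernel and the range of a linear map with the coset sum formula. -/
lemma exists_dual_sum_inv (hK : 2 < Fintype.card K) (E : Submodule (ZMod 2) K) :
    ∃ (V : Submodule (ZMod 2) K) (A : K),
      Module.finrank (ZMod 2) V + Module.finrank (ZMod 2) E = Module.finrank (ZMod 2) K ∧
      A ≠ 0 ∧ ∑ u with u ∈ E, u⁻¹ = A * ∑ y with y ∈ V, y⁻¹ := by
  obtain ⟨L, A, rfl, hA, h⟩ := exists_hasCosetSum E
  refine ⟨LinearMap.range L, A, LinearMap.finrank_range_add_finrank_ker L, hA, ?_⟩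
  have hfib : ∀ y, ∑ x with L x = y, x⁻¹ =
      (if y = 0 then ∑ u with u ∈ LinearMap.ker L, u⁻¹ else 0) +
        if y ∈ LinearMap.range L then A * y⁻¹ else 0 := by
    intro y
    by_cases hy0 : y = 0
    · subst hy0
      simp
    rw [if_neg hy0, zero_add]
    split_ifs with hy
    · obtain ⟨v, rfl⟩ := hy
      rw [← div_eq_mul_inv, ← h v hy0]
      refine Finset.sum_bij' (fun u _ => v + u) (fun u _ => v + u) ?_ ?_ ?_ ?_ ?_
      · intro a ha
        simp only [Finset.mem_filter, Finset.mem_univ, true_and] at ha ⊢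
        rw [map_add, ha, CharTwo.add_self_eq_zero]
      · intro a ha
        simp only [Finset.mem_filter, Finset.mem_univ, true_and] at ha ⊢
        rw [map_add, ha, add_zero]
      all_goals
        intro a _
        rw [← add_assoc, CharTwo.add_self_eq_zero, zero_add]
    · refine Finset.sum_eq_zero fun x hx => absurd ⟨x, ?_⟩ hy
      simpa using hx
  have h0 := sum_inv_univ hK
  rw [← Finset.sum_fiberwise Finset.univ L, Finset.sum_congr rfl fun y _ => hfib y,
    Finset.sum_add_distrib, Finset.sum_ite_eq' Finset.univ (0 : K), ← Finset.sum_filter,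
    ← Finset.mul_sum, if_pos (Finset.mem_univ _)] at h0
  exact CharTwo.add_eq_zero.1 h0

omit [CharP K 2] in
open scoped Classical in
lemma sum_inv_ne_zero_of_finrank_eq_one (E : Submodule (ZMod 2) K)
    (hE : Module.finrank (ZMod 2) E = 1) : ∑ u with u ∈ E, u⁻¹ ≠ 0 := by
  have b := Module.finBasisOfFinrankEq (ZMod 2) E hE
  rw [← finsum_submodule_eq E (fun u => u⁻¹), finsum_eq_sum_of_fintype,
    ← Equiv.sum_comp b.equivFun.symm.toEquiv,
    ← Equiv.sum_comp (Equiv.funUnique (Fin 1) (ZMod 2)).symm]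
  have hb : (b 0 : K) ≠ 0 := by simpa using b.ne_zero 0
  have : ∀ f : ZMod 2 → K, ∑ i, f i = f 0 + f 1 := fun f => Fin.sum_univ_two f
  rw [this]
  simpa [Module.Basis.equivFun_symm_apply] using hb

open scoped Classical in
lemma sum_inv_ne_zero_of_finrank_eq_two {n : ℕ} (hn : Odd n) (hK : Fintype.card K = 2 ^ n)
    (E : Submodule (ZMod 2) K)
    (hE : Module.finrank (ZMod 2) E = 2) : ∑ u with u ∈ E, u⁻¹ ≠ 0 := by
  have b := Module.finBasisOfFinrankEq (ZMod 2) E hE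
  rw [← finsum_submodule_eq E (fun u => u⁻¹), finsum_eq_sum_of_fintype,
    ← Equiv.sum_comp b.equivFun.symm.toEquiv,
    ← Equiv.sum_comp (finTwoArrowEquiv (ZMod 2)).symm, Fintype.sum_prod_type]
  have hb0 : (b 0 : K) ≠ 0 := by simpa using b.ne_zero 0
  have hb1 : (b 1 : K) ≠ 0 := by simpa using b.ne_zero 1
  have hb : (b 0 : K) + b 1 ≠ 0 := by
    intro h
    have h2 : b 0 = b 1 := Subtype.ext (CharTwo.add_eq_zero.1 h)
    exact absurd (b.injective h2) (by decide)
  have : ∀ f : ZMod 2 → K, ∑ i, f i = f 0 + f 1 := fun f => Fin.sum_univ_two f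
  rw [this, this, this]
  simp only [LinearEquiv.coe_toEquiv, Module.Basis.equivFun_symm_apply, Fin.sum_univ_two,
    finTwoArrowEquiv_symm_apply, Matrix.cons_val_zero, Matrix.cons_val_one, zero_smul, one_smul,
    zero_add, add_zero, Submodule.coe_zero, Submodule.coe_add, inv_zero]
  generalize (b 0 : K) = x at *
  generalize (b 1 : K) = y at *
  intro h
  have h1 : x ^ 2 + x * y + y ^ 2 = 0 := by
    field_simp at h
    linear_combination h - x * y * CharTwo.two_eq_zero (R := K)
  set c := x / y with hc
  have hc2 : c ^ 2 = c + 1 := by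
    rw [hc]
    field_simp
    linear_combination h1 - (x * y + y ^ 2) * CharTwo.two_eq_zero (R := K)
  have hc4 : ∀ m, c ^ 2 ^ (2 * m) = c := by
    intro m
    induction m with
    | zero => simp
    | succ m ih =>
      rw [mul_add, pow_add, pow_mul, ih]
      linear_combination (c ^ 2 + c + 2) * hc2 + (c + 1) * CharTwo.two_eq_zero (R := K)
  obtain ⟨m, rfl⟩ := hn
  have := FiniteField.pow_card c
  rw [hK, pow_add, pow_mul, hc4, pow_one, hc2] at this
  simp at this

end SumFree

/-! ### Binary polynomials encoded as natural numbers -/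

section BinaryArithmetic

/-- Value at `α` of the binary polynomial whose coefficients are the bits of a number. -/
def binEval {R : Type*} [CommRing R] (α : R) : ℕ → R
  | 0 => 0
  | m + 1 => ((m + 1) % 2 : ℕ) + α * binEval α ((m + 1) / 2)
decreasing_by omega

/-- Apply a function to a number, in a form which makes reduction evaluate the number first. -/
def evalFirst {β : Type} (x : ℕ) (f : ℕ → β) : β :=
  Nat.rec (f 0) (fun m _ => f m.succ) x

/-- Fuelled product of binary polynomials modulo `P`, where `h = 2 ^ deg P`. -/
def binMulAux (P h a : ℕ) : ℕ → ℕ → ℕ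
  | 0, _ => 0
  | fuel + 1, b =>
    if b = 0 then 0 else
      evalFirst (b / 2) fun b' =>
      evalFirst (2 * binMulAux P h a fuel b') fun r =>
      evalFirst (r ^^^ P * (r / h % 2)) fun r =>
      r ^^^ a * (b % 2)

/-- Product of binary polynomials modulo `P`, where `h = 2 ^ deg P`. -/
def binMul (P h a b : ℕ) : ℕ :=
  evalFirst a fun a => evalFirst b fun b => binMulAux P h a b b

/-- Iterated squaring of the variable modulo `P`. -/
def binFrob (P h : ℕ) : ℕ → ℕ
  | 0 => 2
  | m + 1 => evalFirst (binFrob P h m) fun y => binMul P h y y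

/-- The power `A ^ (2 ^ (m + 1) - 1)` modulo `P`. -/
def binPow (P h A : ℕ) : ℕ → ℕ
  | 0 => A
  | m + 1 => evalFirst (binPow P h A m) fun y => binMul P h (binMul P h y y) A

/-- Image of `w` under the composition of the maps `x ↦ x * (x + b)`. -/
def binChain (P h : ℕ) : List ℕ → ℕ → ℕ
  | [], w => w
  | b :: bs, w => evalFirst w fun w => binChain P h bs (binMul P h w (w ^^^ b))

/-- Verifies that the given vectors extend `bs` to a basis of a subspace on which the inverses sum
to zero. Here `A` and `B` are the two lowest coefficients of the linearized polynomial, and the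
final `A` is certified to be nonzero by `A ^ (2 ^ (n + 1) - 1) = 1`. -/
def binCheck (P h n : ℕ) : List ℕ → List ℕ → ℕ → ℕ → Bool
  | [], _, A, B => B == 0 && binPow P h A n == 1
  | w :: ws, bs, A, B =>
    evalFirst (binChain P h bs w) fun y =>
    evalFirst (binMul P h y A) fun A' =>
    evalFirst (binMul P h A A ^^^ binMul P h y B) fun B' =>
    binCheck P h n ws (bs ++ [y]) A' B'

@[simp] lemma evalFirst_eq {β : Type} (x : ℕ) (f : ℕ → β) : evalFirst x f = f x := by
  cases x <;> rfl

section Ring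

variable {R : Type*} [CommRing R] (α : R)

@[simp] lemma binEval_zero : binEval α 0 = 0 := by rw [binEval]

lemma binEval_eq (m : ℕ) : binEval α m = (m % 2 : ℕ) + α * binEval α (m / 2) := by
  cases m with
  | zero => simp
  | succ m => rw [binEval]

@[simp] lemma binEval_one : binEval α 1 = 1 := by
  rw [binEval_eq]; simp

@[simp] lemma binEval_two : binEval α 2 = α := by
  rw [binEval_eq]; simp

lemma binEval_two_mul (m : ℕ) : binEval α (2 * m) = α * binEval α m := by
  rw [binEval_eq]; simp

lemma map_binEval {S : Type*} [CommRing S] (φ : R →+* S) (m : ℕ) :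
    φ (binEval α m) = binEval (φ α) m := by
  induction m using Nat.strong_induction_on with
  | _ m ih =>
    rcases Nat.eq_zero_or_pos m with rfl | hm
    · simp
    · rw [binEval_eq, binEval_eq (φ α), map_add, map_mul, map_natCast, ih _ (by omega)]

variable [CharP R 2]

lemma binEval_xor (a b : ℕ) : binEval α (a ^^^ b) = binEval α a + binEval α b := by
  induction a using Nat.strong_induction_on generalizing b with
  | _ a ih =>
    rcases Nat.eq_zero_or_pos a with rfl | ha
    · simp
    · rw [binEval_eq, Nat.xor_div_two, ih _ (by omega), binEval_eq α a, binEval_eq α b,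
        Nat.xor_mod_two_eq]
      have : (((a + b) % 2 : ℕ) : R) = (a % 2 : ℕ) + (b % 2 : ℕ) := by
        rw [← CharP.cast_eq_mod, ← CharP.cast_eq_mod, ← CharP.cast_eq_mod, Nat.cast_add]
      rw [this]
      ring

omit [CharP R 2] in
lemma binEval_mul_mod_two (a c : ℕ) : binEval α (a * (c % 2)) = binEval α a * (c % 2 : ℕ) := by
  rcases Nat.mod_two_eq_zero_or_one c with h | h <;> simp [h]

variable {α} {P : ℕ} (hP : binEval α P = 0) (h : ℕ)

include hP

lemma binEval_binMulAux (a fuel b : ℕ) (hb : b ≤ fuel) :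
    binEval α (binMulAux P h a fuel b) = binEval α a * binEval α b := by
  induction fuel generalizing b with
  | zero => simp [Nat.le_zero.1 hb, binMulAux]
  | succ fuel ih =>
    rw [binMulAux]
    split_ifs with hb0
    · simp [hb0]
    · simp only [evalFirst_eq]
      rw [binEval_xor, binEval_xor, binEval_mul_mod_two, binEval_mul_mod_two, hP,
        binEval_two_mul, ih _ (by omega), binEval_eq α b]
      ring

lemma binEval_binMul (a b : ℕ) : binEval α (binMul P h a b) = binEval α a * binEval α b := by
  simp only [binMul, evalFirst_eq]
  exact binEval_binMulAux hP h a b b le_rfl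

lemma binEval_binFrob (m : ℕ) : binEval α (binFrob P h m) = α ^ 2 ^ m := by
  induction m with
  | zero => simp [binFrob]
  | succ m ih => rw [binFrob, evalFirst_eq, binEval_binMul hP, ih]; ring

lemma binEval_binPow_eq_zero {A : ℕ} (hA : binEval α A = 0) (m : ℕ) :
    binEval α (binPow P h A m) = 0 := by
  induction m with
  | zero => exact hA
  | succ m ih => rw [binPow, evalFirst_eq, binEval_binMul hP, hA, mul_zero]

lemma binEval_binChain_append (bs : List ℕ) (y w : ℕ) :
    binEval α (binChain P h (bs ++ [y]) w) =
      binEval α (binChain P h bs w) * (binEval α (binChain P h bs w) + binEval α y) := by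
  induction bs generalizing w with
  | nil => simp [binChain, binEval_binMul hP, binEval_xor]
  | cons b bs ih => simp only [List.cons_append, binChain, evalFirst_eq, ih]

end Ring

section Field

variable {K : Type*} [Field K] [Fintype K] [CharP K 2] [Algebra (ZMod 2) K] {α : K} {P : ℕ}

omit [Fintype K] [Algebra (ZMod 2) K] in
lemma binEval_ne_zero_of_binCheck (hP : binEval α P = 0) (h n : ℕ) (ws : List ℕ) :
    ∀ (bs : List ℕ) (A B : ℕ), binCheck P h n ws bs A B = true → binEval α A ≠ 0 := by
  induction ws with
  | nil =>
    intro bs A B hc hA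
    simp only [binCheck, Bool.and_eq_true, beq_iff_eq] at hc
    have := binEval_binPow_eq_zero hP h hA n
    rw [hc.2, binEval_one] at this
    exact one_ne_zero this
  | cons w ws ih =>
    intro bs A B hc hA
    simp only [binCheck, evalFirst_eq] at hc
    apply ih _ _ _ hc
    rw [binEval_binMul hP, hA, mul_zero]

open scoped Classical in
lemma exists_sum_inv_eq_zero_of_binCheck_aux (hP : binEval α P = 0) (h n : ℕ) (ws : List ℕ) :
    ∀ (bs : List ℕ) (A B : ℕ) (L : K →ₗ[ZMod 2] K), HasCosetSum L (binEval α A) →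
      binEval α B = binEval α A * ∑ u with L u = 0, u⁻¹ →
      (∀ w, binEval α (binChain P h bs w) = L (binEval α w)) →
      binCheck P h n ws bs A B = true →
      ∃ E : Submodule (ZMod 2) K,
        Module.finrank (ZMod 2) E = Module.finrank (ZMod 2) (LinearMap.ker L) + ws.length ∧
        ∑ u with u ∈ E, u⁻¹ = 0 := by
  induction ws with
  | nil =>
    intro bs A B L hL hB _ hc
    simp only [binCheck, Bool.and_eq_true, beq_iff_eq] at hc
    refine ⟨LinearMap.ker L, by simp, ?_⟩
    rw [hc.1, binEval_zero, zero_eq_mul] at hB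
    simpa only [LinearMap.mem_ker] using hB.resolve_left hL.1
  | cons w ws ih =>
    intro bs A B L hL hB hbs hc
    simp only [binCheck, evalFirst_eq] at hc
    have hA' := binEval_ne_zero_of_binCheck hP h n ws _ _ _ hc
    rw [binEval_binMul hP, hbs] at hA'
    have hw := left_ne_zero_of_mul hA'
    obtain ⟨E, hE, hsum⟩ := ih _ _ _ (quadStep L (L (binEval α w)))
      (by rw [binEval_binMul hP, hbs]; exact hL.quadStep hw)
      (by
        rw [sum_quadStep L hw, hL.2 _ hw, binEval_xor, binEval_binMul hP, binEval_binMul hP,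
          binEval_binMul hP, hbs, hB]
        field_simp
        ring)
      (fun x => by rw [binEval_binChain_append hP, hbs, hbs, quadStep_apply]) hc
    refine ⟨E, ?_, hsum⟩
    rw [hE, finrank_ker_quadStep L hw, List.length_cons]
    ring

open scoped Classical in
lemma exists_sum_inv_eq_zero_of_binCheck (hP : binEval α P = 0) (h n : ℕ) (ws : List ℕ)
    (hc : binCheck P h n ws [] 1 0 = true) :
    ∃ E : Submodule (ZMod 2) K, Module.finrank (ZMod 2) E = ws.length ∧
      ∑ u with u ∈ E, u⁻¹ = 0 := by
  obtain ⟨E, hE, hsum⟩ := exists_sum_inv_eq_zero_of_binCheck_aux hP h n ws [] 1 0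
    (LinearMap.id : K →ₗ[ZMod 2] K)
    (by rw [binEval_one]; exact HasCosetSum.id)
    (by rw [binEval_zero, binEval_one, one_mul, Finset.sum_eq_single 0] <;> simp)
    (fun w => rfl) hc
  exact ⟨E, by rw [hE, LinearMap.ker_id, finrank_bot, zero_add], hsum⟩

end Field

lemma binEval_X_ne_zero {m : ℕ} (hm : m ≠ 0) : binEval (X : (ZMod 2)[X]) m ≠ 0 := by
  induction m using Nat.strong_induction_on with
  | _ m ih =>
    intro h0
    rw [binEval_eq] at h0
    have hc := congrArg (eval 0) h0
    rw [eval_add, eval_mul, eval_X, zero_mul, add_zero, eval_natCast, eval_zero,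
      ZMod.natCast_eq_zero_iff] at hc
    have hmod : m % 2 = 0 := by omega
    rw [hmod, Nat.cast_zero, zero_add] at h0
    exact (mul_ne_zero X_ne_zero (ih (m / 2) (by omega) (by omega))) h0

lemma natDegree_binEval_X_ne_zero {m : ℕ} (hm : 2 ≤ m) :
    (binEval (X : (ZMod 2)[X]) m).natDegree ≠ 0 := by
  rw [binEval_eq, ← C_eq_natCast, natDegree_C_add, natDegree_X_mul (binEval_X_ne_zero (by omega))]
  omega

lemma exists_binEval_eq_zero {n P h : ℕ} (hn : n ≠ 0) (hP2 : 2 ≤ P)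
    (hfrob : binFrob P h n = 2) : ∃ α : GaloisField 2 n, binEval α P = 0 := by
  set p : (ZMod 2)[X] := binEval X P with hp
  have hroot : binEval (AdjoinRoot.root p) P = 0 := by
    rw [← AdjoinRoot.mk_X, ← map_binEval, ← hp, AdjoinRoot.mk_self]
  have hdeg : p.degree ≠ 0 := degree_ne_of_natDegree_ne (natDegree_binEval_X_ne_zero hP2)
  have hchar : CharP (AdjoinRoot p) 2 := by
    have := AdjoinRoot.nontrivial p hdeg
    exact charP_of_injective_algebraMap (algebraMap (ZMod 2) (AdjoinRoot p)).injective 2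
  have hdvd : p ∣ X ^ 2 ^ n - X := by
    rw [← AdjoinRoot.mk_eq_zero, map_sub, map_pow, AdjoinRoot.mk_X,
      ← binEval_binFrob hroot h, hfrob, binEval_two, sub_self]
  have hne : (X ^ 2 ^ n - X : (ZMod 2)[X]) ≠ 0 :=
    FiniteField.X_pow_card_pow_sub_X_ne_zero _ hn one_lt_two
  have hsf := FiniteField.isSplittingField_of_nat_card_eq (K := GaloisField 2 n) 2 n
    (GaloisField.card 2 n hn)
  have hsplit := (IsSplittingField.splits (GaloisField 2 n)
    (X ^ 2 ^ n - X : (ZMod 2)[X])).of_dvd (Polynomial.map_ne_zero hne)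
    (Polynomial.map_dvd (algebraMap (ZMod 2) (GaloisField 2 n)) hdvd)
  obtain ⟨α, hα⟩ := hsplit.exists_eval_eq_zero (by rwa [degree_map])
  refine ⟨α, ?_⟩
  have := map_binEval (X : (ZMod 2)[X]) (eval₂RingHom (algebraMap (ZMod 2) (GaloisField 2 n)) α) P
  rw [coe_eval₂RingHom, eval₂_X, ← hp, eval₂_eq_eval_map, hα] at this
  exact this.symm

end BinaryArithmetic

/-! ### Explicit subspaces on which the inverses sum to zero -/

/-- For `n = 7, 9, …, 27`: an irreducible binary polynomial `P` of degree `n`, and for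
`k = 3, …, (n - 1) / 2` a pair `(c, w)` such that the inverses of the elements of the span of
`1, α, …, α ^ (k - 3), c, w` sum to zero, where `α` is a root of `P`. -/
def zeroSumData : List (ℕ × List (ℕ × ℕ)) :=
  [
   (131, [(24, 98)]),
   (515, [(2, 332), (248, 364)]),
   (2053, [(24, 1838), (36, 1416), (152, 584)]),
   (8219, [(6, 7546), (72, 1920), (344, 680), (176, 352)]),
   (32771, [(2, 6060), (60, 18760), (8, 8672), (976, 25040), (480, 21600)]),
   (131081, [(28, 45516), (16, 91976), (64, 103608), (624, 46528), (224, 32608), (2560,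
    119872)]),
   (524327, [(6, 235578), (36, 482500), (88, 348688), (640, 339424), (3648, 37952), (1152,
    164736), (43008, 328192)]),
   (2097157, [(2, 606056), (12, 1549780), (128, 1671520), (608, 446864), (608, 1342464), (5568,
    1753984), (3200, 1271552), (59392, 1334016)]),
   (8388641, [(6, 8297896), (8, 3512704), (304, 2854984), (912, 1923344), (1888, 2744672),
    (4864, 1745344), (34816, 6383616), (356608, 3279872), (113152, 4226048)]),
   (33554441, [(2, 19905192), (68, 8590336), (32, 462280), (128, 20845104), (1088, 20493088),
    (1984, 1699840), (23680, 28226944), (362496, 25231616), (672256, 8783872), (1331200,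
    7222272)]),
   (134217767, [(24, 48778092), (12, 44411268), (24, 36087744), (576, 200016), (640,
    132365664), (768, 34770176), (33792, 44108288), (21760, 109840896), (323072, 41066496),
    (1870848, 52780032), (7731200, 69707776)])]

/-- Modulus of degree `2 * m + 7`. -/
def zeroSumModulus (m : ℕ) : ℕ := (zeroSumData.getD m (0, [])).1

/-- Basis of a subspace of dimension `i + 3` in degree `2 * m + 7`. -/
def zeroSumBasis (m i : ℕ) : List ℕ :=
  let cw := (zeroSumData.getD m (0, [])).2.getD i (0, 0)
  (List.range (i + 1)).map (2 ^ ·) ++ [cw.1, cw.2]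

lemma zeroSumModulus_valid : ∀ m < 11, 2 ≤ zeroSumModulus m ∧
    binFrob (zeroSumModulus m) (2 ^ (2 * m + 7)) (2 * m + 7) = 2 := by
  decide +kernel

lemma zeroSumBasis_valid : ∀ m < 11, ∀ i < m + 1,
    binCheck (zeroSumModulus m) (2 ^ (2 * m + 7)) (2 * m + 6) (zeroSumBasis m i) [] 1 0 = true := by
  decide +kernel

open scoped Classical in
lemma exists_sum_inv_eq_zero_of_le_half {n k : ℕ} [Fintype (GaloisField 2 n)] (hodd : Odd n)
    (hn27 : n ≤ 27) (hk3 : 3 ≤ k) (hk : 2 * k + 1 ≤ n) :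
    ∃ E : Submodule (ZMod 2) (GaloisField 2 n),
      Module.finrank (ZMod 2) E = k ∧ ∑ u with u ∈ E, u⁻¹ = 0 := by
  obtain ⟨m, rfl⟩ : ∃ m, n = 2 * m + 7 := by
    obtain ⟨j, rfl⟩ := hodd
    exact ⟨j - 3, by omega⟩
  obtain ⟨i, rfl⟩ : ∃ i, k = i + 3 := ⟨k - 3, by omega⟩
  obtain ⟨hP2, hfrob⟩ := zeroSumModulus_valid m (by omega)
  obtain ⟨α, hα⟩ := exists_binEval_eq_zero (by omega) hP2 hfrob
  obtain ⟨E, hE, hsum⟩ := exists_sum_inv_eq_zero_of_binCheck hα _ _ _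
    (zeroSumBasis_valid m (by omega) i (by omega))
  exact ⟨E, by rw [hE]; simp [zeroSumBasis], hsum⟩

open scoped Classical in
lemma exists_sum_inv_eq_zero {n k : ℕ} [Fintype (GaloisField 2 n)] (hodd : Odd n)
    (hn27 : n ≤ 27) (hk3 : 3 ≤ k) (hk : k + 3 ≤ n) :
    ∃ E : Submodule (ZMod 2) (GaloisField 2 n),
      Module.finrank (ZMod 2) E = k ∧ ∑ u with u ∈ E, u⁻¹ = 0 := by
  rcases le_or_gt (2 * k + 1) n with h | h
  · exact exists_sum_inv_eq_zero_of_le_half hodd hn27 hk3 h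
  have hcard : 2 < Fintype.card (GaloisField 2 n) := by
    rw [← Nat.card_eq_fintype_card, GaloisField.card 2 n (by omega)]
    exact lt_self_pow₀ one_lt_two (by omega)
  obtain ⟨E, hE, hsum⟩ := exists_sum_inv_eq_zero_of_le_half (k := n - k) hodd hn27 (by omega)
    (by obtain ⟨j, rfl⟩ := hodd; omega)
  obtain ⟨V, A, hV, hA, hEV⟩ := exists_dual_sum_inv hcard E
  refine ⟨V, ?_, ?_⟩
  · rw [GaloisField.finrank 2 (by omega)] at hV
    omega
  · rw [hsum, zero_eq_mul] at hEV
    exact hEV.resolve_left hA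

open scoped Classical in
lemma sum_inv_ne_zero {n k : ℕ} [Fintype (GaloisField 2 n)] (hodd : Odd n) (hn : 3 ≤ n)
    (hk : k = 1 ∨ k = 2 ∨ k = n - 2 ∨ k = n - 1) (E : Submodule (ZMod 2) (GaloisField 2 n))
    (hE : Module.finrank (ZMod 2) E = k) : ∑ u with u ∈ E, u⁻¹ ≠ 0 := by
  have hcard : Fintype.card (GaloisField 2 n) = 2 ^ n := by
    rw [← Nat.card_eq_fintype_card, GaloisField.card 2 n (by omega)]
  have hcard2 : 2 < Fintype.card (GaloisField 2 n) := by
    rw [hcard]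
    exact lt_self_pow₀ one_lt_two (by omega)
  have hsmall : ∀ V : Submodule (ZMod 2) (GaloisField 2 n),
      (Module.finrank (ZMod 2) V = 1 ∨ Module.finrank (ZMod 2) V = 2) →
      ∑ u with u ∈ V, u⁻¹ ≠ 0 := fun V hV =>
    hV.elim (sum_inv_ne_zero_of_finrank_eq_one V)
      (sum_inv_ne_zero_of_finrank_eq_two hodd hcard V)
  obtain ⟨V, A, hV, hA, hEV⟩ := exists_dual_sum_inv hcard2 E
  rw [GaloisField.finrank 2 (by omega)] at hV
  by_cases hE2 : k = 1 ∨ k = 2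
  · exact hsmall E (hE ▸ hE2)
  · rw [hEV]
    exact mul_ne_zero hA (hsmall V (by omega))


/-- Carlet's conjecture holds for odd `3 ≤ n ≤ 27`: for `1 ≤ k ≤ n − 1`, the
multiplicative inverse function `f_inv(x) = x⁻¹` (with `f_inv(0) = 0`) on `F_{2^n}`
is `k`th order sum-free (i.e. `∑_{x ∈ A} f_inv(x) ≠ 0` for every `k`-dimensional
`F₂`-affine subspace `A = v + E` of `F_{2^n}`) if and only if
`k ∈ {1, 2, n−2, n−1}`. -/
theorem carlet_conjecture_odd_n_le_27 (n k : ℕ) (hodd : Odd n) (hn3 : 3 ≤ n)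
    (hn27 : n ≤ 27) (hk1 : 1 ≤ k) (hk : k ≤ n - 1) :
    (∀ (E : Submodule (ZMod 2) (GaloisField 2 n)) (v : GaloisField 2 n),
        Module.finrank (ZMod 2) E = k →
        ∑ᶠ u : E, (v + (u : GaloisField 2 n))⁻¹ ≠ 0) ↔
      (k = 1 ∨ k = 2 ∨ k = n - 2 ∨ k = n - 1) := by
  classical
  have := Fintype.ofFinite (GaloisField 2 n)
  constructor
  · intro H
    by_contra hk'
    obtain ⟨E, hE, hsum⟩ := exists_sum_inv_eq_zero (k := k) hodd hn27 (by omega) (by omega)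
    apply H E 0 hE
    rw [finsum_submodule_eq E (fun u => (0 + u)⁻¹)]
    simpa only [zero_add] using hsum
  · intro hk' E v hE
    rw [finsum_submodule_eq E (fun u => (v + u)⁻¹)]
    by_cases hv : v ∈ E
    · rw [sum_inv_coset_of_mem E hv]
      exact sum_inv_ne_zero hodd hn3 hk' E hE
    · exact sum_inv_coset_ne_zero E hv
end

section
/- Let n ≥ 3 be an odd integer divisible by 7 and let k be an integer with 1 ≤ k ≤ n − 1 such that (n,k) ≠ (49,23) and (n,k) ≠ (49,26). Then the multiplicative inverse function f_inv on F_{2^n} is kth order sum-free if and only if k ∈ {1, 2, n−2, n−1}. -/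
namespace InvSum

section ShiftProd

open Polynomial

variable {F : Type*} [Field F]

/-- The polynomial `∏_{u ∈ s} (X + u)`. -/
noncomputable def shiftProd (s : Finset F) : F[X] := ∏ u ∈ s, (X + C u)

lemma eval_shiftProd (s : Finset F) (x : F) : (shiftProd s).eval x = ∏ u ∈ s, (x + u) := by
  simp [shiftProd, eval_prod]

lemma monic_shiftProd (s : Finset F) : (shiftProd s).Monic :=
  monic_prod_of_monic _ _ fun u _ => monic_X_add_C u

lemma natDegree_shiftProd (s : Finset F) : (shiftProd s).natDegree = s.card := by
  unfold shiftProd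
  rw [natDegree_prod_of_monic _ _ fun u _ => monic_X_add_C u]
  simp

end ShiftProd

section CharTwo

variable {F : Type*} [Field F] [Algebra (ZMod 2) F]

variable (F) in
lemma charP_two : CharP F 2 := charP_of_injective_algebraMap (algebraMap (ZMod 2) F).injective 2

lemma add_self (x : F) : x + x = 0 := by
  have := charP_two F
  exact CharTwo.add_self_eq_zero x

end CharTwo

section Subspace

variable {F : Type*} [Field F] [Fintype F] [Algebra (ZMod 2) F]

open Classical in
/-- The elements of a subspace as a finset. -/
noncomputable def elts (E : Submodule (ZMod 2) F) : Finset F := Finset.univ.filter (· ∈ E)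

@[simp] lemma mem_elts {E : Submodule (ZMod 2) F} {x : F} : x ∈ elts E ↔ x ∈ E := by
  simp [elts]

/-- The sum of the inverses of the elements of a subspace. -/
noncomputable def invSum (E : Submodule (ZMod 2) F) : F := ∑ x ∈ elts E, x⁻¹

open Classical in
/-- The product of the nonzero elements of a subspace. -/
noncomputable def prodNZ (E : Submodule (ZMod 2) F) : F := ∏ x ∈ (elts E).erase 0, x

lemma prodNZ_ne_zero (E : Submodule (ZMod 2) F) : prodNZ E ≠ 0 := by
  classical
  unfold prodNZ
  exact Finset.prod_ne_zero_iff.2 fun x hx => (Finset.mem_erase.1 hx).1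

open Polynomial

lemma prod_add_mem (E : Submodule (ZMod 2) F) {y : F} (hy : y ∈ E) (x : F) :
    ∏ u ∈ elts E, (x + y + u) = ∏ u ∈ elts E, (x + u) := by
  refine Finset.prod_bij (fun u _ => y + u) ?_ ?_ ?_ ?_
  · intro a ha; rw [mem_elts] at *; exact E.add_mem hy ha
  · intro a _ b _ h; simpa using h
  · intro b hb
    refine ⟨b - y, ?_, by ring⟩
    rw [mem_elts] at *; exact E.sub_mem hb hy
  · intro a _; ring

lemma shiftProd_comp (E : Submodule (ZMod 2) F) (y : F) :
    (shiftProd (elts E)).comp (X + C y) = shiftProd (elts E) + C ((shiftProd (elts E)).eval y) := by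
  have hcard : 0 < (elts E).card := Finset.card_pos.2 ⟨0, by simp⟩
  set f := shiftProd (elts E) with hf
  have hm : (f.comp (X + C y)).Monic := (monic_shiftProd _).comp_X_add_C y
  have hd : (f.comp (X + C y)).natDegree = (elts E).card := by
    rw [natDegree_comp, natDegree_X_add_C, mul_one, hf, natDegree_shiftProd]
  have hd' : f.natDegree = (elts E).card := natDegree_shiftProd _
  have key : f.comp (X + C y) - f - C (f.eval y) = 0 := by
    refine eq_zero_of_natDegree_lt_card_of_eval_eq_zero' _ (elts E) ?_ ?_
    · intro u hu
      have h0 : f.eval u = 0 := by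
        rw [hf, eval_shiftProd]
        exact Finset.prod_eq_zero hu (add_self u)
      simp only [eval_sub, eval_comp, eval_add, eval_X, eval_C, h0]
      rw [hf, eval_shiftProd, eval_shiftProd, add_comm u y, prod_add_mem E (mem_elts.1 hu)]
      ring
    · have h1 : (f.comp (X + C y) - f).natDegree < (elts E).card := by
        by_cases h : f.comp (X + C y) - f = 0
        · rw [h]; simpa using hcard
        have hlt := degree_sub_lt_left (p := f.comp (X + C y)) (q := f) ?_ hm.ne_zero ?_
        · rw [natDegree_lt_iff_degree_lt h]
          rwa [degree_eq_natDegree hm.ne_zero, hd] at hlt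
        · rw [degree_eq_natDegree hm.ne_zero, degree_eq_natDegree (monic_shiftProd _).ne_zero, hd,
            hd']
        · rw [hm.leadingCoeff, (monic_shiftProd _).leadingCoeff]
      refine lt_of_le_of_lt (natDegree_sub_le _ _) (max_lt h1 ?_)
      rwa [natDegree_C]
  linear_combination key

/-- The additive map `x ↦ ∏_{u ∈ E} (x + u)` with kernel `E`. -/
noncomputable def subMap (E : Submodule (ZMod 2) F) : F →ₗ[ZMod 2] F :=
  AddMonoidHom.toZModLinearMap 2
    { toFun := fun x => ∏ u ∈ elts E, (x + u)
      map_zero' := Finset.prod_eq_zero (i := 0) (by simp) (by simp)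
      map_add' := fun x y => by
        have := congrArg (eval x) (shiftProd_comp E y)
        simpa only [eval_comp, eval_shiftProd, eval_add, eval_X, eval_C] using this }

lemma subMap_apply (E : Submodule (ZMod 2) F) (x : F) :
    subMap E x = ∏ u ∈ elts E, (x + u) := rfl

lemma subMap_eq_zero_iff {E : Submodule (ZMod 2) F} {x : F} : subMap E x = 0 ↔ x ∈ E := by
  rw [subMap_apply, Finset.prod_eq_zero_iff]
  constructor
  · rintro ⟨u, hu, h⟩
    have : x = -u := by linear_combination h
    rw [this]; exact E.neg_mem (mem_elts.1 hu)
  · intro h; exact ⟨x, mem_elts.2 h, add_self x⟩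

lemma ker_subMap (E : Submodule (ZMod 2) F) : LinearMap.ker (subMap E) = E := by
  ext x; rw [LinearMap.mem_ker, subMap_eq_zero_iff]

lemma sum_coset (E : Submodule (ZMod 2) F) {v : F} (hv : v ∉ E) :
    ∑ u ∈ elts E, (v + u)⁻¹ = prodNZ E * (subMap E v)⁻¹ := by
  classical
  set f := shiftProd (elts E) with hf
  have hder : ∀ x, f.derivative.eval x = ∑ u ∈ elts E, ∏ w ∈ (elts E).erase u, (x + w) := by
    intro x
    rw [hf, shiftProd, derivative_prod_finset]
    simp [eval_finsetSum, eval_prod]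
  have h1 : f.derivative.eval v = f.derivative.eval 0 := by
    have := congrArg (fun g => eval 0 (derivative g)) (shiftProd_comp E v)
    simpa [derivative_comp, eval_comp] using this
  have h2 : f.derivative.eval 0 = prodNZ E := by
    rw [hder, Finset.sum_eq_single 0]
    · simp [prodNZ]
    · intro b _ hb
      exact Finset.prod_eq_zero (i := 0) (Finset.mem_erase.2 ⟨hb.symm, by simp⟩) (by simp)
    · simp
  have h3 : subMap E v ≠ 0 := fun h => hv (subMap_eq_zero_iff.1 h)
  have h4 : f.derivative.eval v = subMap E v * ∑ u ∈ elts E, (v + u)⁻¹ := by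
    rw [hder, Finset.mul_sum]
    refine Finset.sum_congr rfl fun u hu => ?_
    have hne : v + u ≠ 0 := fun h => hv (by
      have : v = -u := by linear_combination h
      rw [this]; exact E.neg_mem (mem_elts.1 hu))
    rw [subMap_apply, ← Finset.mul_prod_erase _ _ hu]
    field_simp
  rw [← h2, ← h1, h4]
  field_simp

lemma invSum_eq (U E : Submodule (ZMod 2) F) (hUE : U ≤ E) :
    invSum E = invSum U + prodNZ U * invSum (E.map (subMap U)) := by
  classical
  have hmaps : ∀ x ∈ elts E, subMap U x ∈ elts (E.map (subMap U)) := fun x hx =>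
    mem_elts.2 ⟨x, mem_elts.1 hx, rfl⟩
  have hfib : ∀ y ∈ elts (E.map (subMap U)),
      ∑ x ∈ (elts E).filter (fun x => subMap U x = y), x⁻¹
        = (if y = 0 then invSum U else 0) + prodNZ U * y⁻¹ := by
    intro y hy
    obtain ⟨v, hv, rfl⟩ := mem_elts.1 hy
    by_cases h0 : subMap U v = 0
    · have : (elts E).filter (fun x => subMap U x = subMap U v) = elts U := by
        ext x
        simp only [Finset.mem_filter, mem_elts, h0, subMap_eq_zero_iff]
        exact ⟨fun h => h.2, fun h => ⟨hUE h, h⟩⟩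
      rw [this]; simp [h0, invSum]
    · have hvU : v ∉ U := fun h => h0 (subMap_eq_zero_iff.2 h)
      rw [if_neg h0, zero_add, ← sum_coset U hvU]
      symm
      refine Finset.sum_bij (fun u _ => v + u) ?_ ?_ ?_ ?_
      · intro u hu
        simp only [Finset.mem_filter, mem_elts, map_add] at *
        exact ⟨E.add_mem hv (hUE hu), by rw [subMap_eq_zero_iff.2 hu, add_zero]⟩
      · intro a _ b _ h; simpa using h
      · intro x hx
        simp only [Finset.mem_filter, mem_elts] at hx
        refine ⟨x - v, ?_, by ring⟩
        rw [mem_elts, ← subMap_eq_zero_iff, map_sub, hx.2, sub_self]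
      · intro a _; rfl
  rw [invSum, ← Finset.sum_fiberwise_of_maps_to hmaps, Finset.sum_congr rfl hfib,
    Finset.sum_add_distrib, ← Finset.mul_sum]
  congr 1
  rw [Finset.sum_ite_eq']
  simp

lemma finrank_map_subMap (U E : Submodule (ZMod 2) F) (hUE : U ≤ E) :
    Module.finrank (ZMod 2) (E.map (subMap U)) + Module.finrank (ZMod 2) U
      = Module.finrank (ZMod 2) E := by
  have h := LinearMap.finrank_range_add_finrank_ker ((subMap U).domRestrict E)
  rw [LinearMap.range_domRestrict, LinearMap.ker_domRestrict, ker_subMap] at h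
  rw [← h]
  congr 1
  exact (LinearEquiv.finrank_eq (Submodule.comapSubtypeEquivOfLe hUE)).symm

/-- Pull back a subspace of the image of `subMap U`. -/
lemma exists_lift (W U E₀ : Submodule (ZMod 2) F) (hU : U ≤ W) (hE : E₀ ≤ W.map (subMap U)) :
    ∃ E ≤ W, U ≤ E ∧ E.map (subMap U) = E₀ ∧
      Module.finrank (ZMod 2) E = Module.finrank (ZMod 2) U + Module.finrank (ZMod 2) E₀ ∧
      invSum E = invSum U + prodNZ U * invSum E₀ := by
  have hUE : U ≤ W ⊓ E₀.comap (subMap U) := le_inf hU fun x hx => by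
    rw [Submodule.mem_comap, subMap_eq_zero_iff.2 hx]; exact E₀.zero_mem
  have hmap : (W ⊓ E₀.comap (subMap U)).map (subMap U) = E₀ := by
    ext y
    simp only [Submodule.mem_map, Submodule.mem_inf, Submodule.mem_comap]
    constructor
    · rintro ⟨x, ⟨-, hx⟩, rfl⟩; exact hx
    · intro hy
      obtain ⟨x, hx, rfl⟩ := hE hy
      exact ⟨x, ⟨hx, hy⟩, rfl⟩
  refine ⟨_, inf_le_left, hUE, hmap, ?_, ?_⟩
  · have := finrank_map_subMap _ _ hUE
    rw [hmap] at this; omega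
  · have := invSum_eq _ _ hUE
    rwa [hmap] at this

/-- `k` is the dimension of a subspace whose inverses sum to zero. -/
def IsZeroDim (F : Type*) [Field F] [Fintype F] [Algebra (ZMod 2) F] (k : ℕ) : Prop :=
  ∃ E : Submodule (ZMod 2) F, Module.finrank (ZMod 2) E = k ∧ invSum E = 0

lemma elts_bot : elts (⊥ : Submodule (ZMod 2) F) = {0} := by ext; simp

lemma invSum_bot : invSum (⊥ : Submodule (ZMod 2) F) = 0 := by simp [invSum, elts_bot]

lemma elts_top : elts (⊤ : Submodule (ZMod 2) F) = Finset.univ := by ext; simp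

/-- A set of vectors stable under multiplication by some `c ≠ 0, 1` has zero sum of inverses. -/
lemma invSum_eq_zero_of_smul {E : Submodule (ZMod 2) F} {c : F} (h0 : c ≠ 0) (h1 : c ≠ 1)
    (hc : ∀ x ∈ E, c * x ∈ E) : invSum E = 0 := by
  classical
  have h : invSum E = c⁻¹ * invSum E := by
    have hinj : Set.InjOn (fun x => c * x) (elts E : Set F) :=
      fun a _ b _ h => mul_left_cancel₀ h0 h
    have himg : (elts E).image (fun x => c * x) = elts E := by
      refine Finset.eq_of_subset_of_card_le ?_ (le_of_eq ?_)
      · intro y hy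
        obtain ⟨x, hx, rfl⟩ := Finset.mem_image.1 hy
        exact mem_elts.2 (hc x (mem_elts.1 hx))
      · rw [Finset.card_image_of_injOn hinj]
    conv_lhs => rw [invSum, ← himg, Finset.sum_image hinj]
    rw [invSum, Finset.mul_sum]
    exact Finset.sum_congr rfl fun x _ => by rw [mul_inv]
  have h2 : (c - 1) * invSum E = 0 := by
    have h3 := congrArg (fun z => c * z) h
    simp only [mul_inv_cancel_left₀ h0] at h3
    linear_combination h3
  exact (mul_eq_zero.1 h2).resolve_left (sub_ne_zero.2 h1)

/-- Multiplication of a subspace by a scalar of the field. -/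
noncomputable def scale (c : F) (E : Submodule (ZMod 2) F) : Submodule (ZMod 2) F :=
  E.map (LinearMap.mulLeft (ZMod 2) c)

omit [Fintype F] in
lemma mem_scale {c : F} {E : Submodule (ZMod 2) F} {x : F} :
    x ∈ scale c E ↔ ∃ y ∈ E, c * y = x := by
  simp [scale, Submodule.mem_map]

omit [Fintype F] in
lemma finrank_scale {c : F} (hc : c ≠ 0) (E : Submodule (ZMod 2) F) :
    Module.finrank (ZMod 2) (scale c E) = Module.finrank (ZMod 2) E :=
  (LinearEquiv.finrank_eq (Submodule.equivMapOfInjective _ (mul_right_injective₀ hc) E)).symm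

lemma invSum_scale {c : F} (hc : c ≠ 0) (E : Submodule (ZMod 2) F) :
    invSum (scale c E) = c⁻¹ * invSum E := by
  rw [invSum, invSum, Finset.mul_sum]
  symm
  refine Finset.sum_bij (fun x _ => c * x) ?_ ?_ ?_ ?_
  · intro x hx; exact mem_elts.2 (mem_scale.2 ⟨x, mem_elts.1 hx, rfl⟩)
  · intro a _ b _ h; exact mul_left_cancel₀ hc h
  · intro y hy
    obtain ⟨x, hx, rfl⟩ := mem_scale.1 (mem_elts.1 hy)
    exact ⟨x, mem_elts.2 hx, rfl⟩
  · intro x _; rw [mul_inv]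

/-- Sums over affine subspaces not containing `0` never vanish. -/
lemma sum_coset_ne_zero (E : Submodule (ZMod 2) F) {v : F} (hv : v ∉ E) :
    ∑ u ∈ elts E, (v + u)⁻¹ ≠ 0 := by
  rw [sum_coset E hv]
  exact mul_ne_zero (prodNZ_ne_zero E) (inv_ne_zero fun h => hv (subMap_eq_zero_iff.1 h))

lemma sum_coset_mem (E : Submodule (ZMod 2) F) {v : F} (hv : v ∈ E) :
    ∑ u ∈ elts E, (v + u)⁻¹ = invSum E := by
  refine Finset.sum_bij (fun u _ => v + u) ?_ ?_ ?_ ?_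
  · intro u hu; exact mem_elts.2 (E.add_mem hv (mem_elts.1 hu))
  · intro a _ b _ h; simpa using h
  · intro x hx
    exact ⟨x - v, mem_elts.2 (E.sub_mem (mem_elts.1 hx) hv), by ring⟩
  · intro a _; rfl

omit [Algebra (ZMod 2) F] in
lemma exists_ne_zero_ne_one (h : 2 < Fintype.card F) : ∃ c : F, c ≠ 0 ∧ c ≠ 1 := by
  classical
  obtain ⟨c, -, hc⟩ := Finset.exists_mem_notMem_of_card_lt_card
    (s := ({0, 1} : Finset F)) (t := Finset.univ)
    (lt_of_le_of_lt Finset.card_le_two (by simpa using h))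
  exact ⟨c, by simpa using hc⟩

lemma IsZeroDim.dual {k : ℕ} (h2 : 2 < Fintype.card F) (h : IsZeroDim F k) :
    IsZeroDim F (Module.finrank (ZMod 2) F - k) := by
  obtain ⟨E, rfl, hE⟩ := h
  refine ⟨(⊤ : Submodule (ZMod 2) F).map (subMap E), ?_, ?_⟩
  · have := finrank_map_subMap E ⊤ le_top
    rw [finrank_top] at this
    exact Nat.eq_sub_of_add_eq this
  · have h1 := invSum_eq E ⊤ le_top
    obtain ⟨c, hc0, hc1⟩ := exists_ne_zero_ne_one h2
    rw [invSum_eq_zero_of_smul hc0 hc1 fun _ _ => Submodule.mem_top, hE, zero_add] at h1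
    exact (mul_eq_zero.1 h1.symm).resolve_left (prodNZ_ne_zero E)

lemma card_elts (E : Submodule (ZMod 2) F) :
    (elts E).card = 2 ^ Module.finrank (ZMod 2) E := by
  classical
  have h := Module.card_eq_pow_finrank (K := ZMod 2) (V := E)
  rw [ZMod.card] at h
  rw [← h, elts, Fintype.card_subtype]

lemma not_isZeroDim_one : ¬ IsZeroDim F 1 := by
  classical
  rintro ⟨E, hE, h⟩
  have hc := card_elts E
  rw [hE] at hc
  obtain ⟨v, hv, hv0⟩ := Finset.exists_mem_ne (by omega : 1 < (elts E).card) 0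
  have he : {0, v} = elts E := by
    refine Finset.eq_of_subset_of_card_le ?_ ?_
    · intro x hx
      rcases Finset.mem_insert.1 hx with rfl | hx
      · simp
      · rwa [Finset.mem_singleton.1 hx]
    · rw [hc, Finset.card_pair hv0.symm]; norm_num
  rw [invSum, ← he, Finset.sum_pair hv0.symm] at h
  simp [hv0] at h

lemma sq_add_self_add_one_ne_zero {n : ℕ} (hn : Odd n) (hF : Fintype.card F = 2 ^ n) (r : F) :
    r ^ 2 + r + 1 ≠ 0 := by
  intro h
  have h3 : r ^ 3 = 1 := by linear_combination (r - 1) * h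
  have h2 : r ^ 2 = r := by
    have h1 := FiniteField.pow_card r
    obtain ⟨m, rfl⟩ := hn
    obtain ⟨q, hq⟩ : ∃ q, 2 ^ (2 * m + 1) = 3 * q + 2 := by
      refine ⟨2 ^ (2 * m + 1) / 3, ?_⟩
      have : 2 ^ (2 * m + 1) % 3 = 2 := by
        rw [pow_succ, pow_mul, Nat.mul_mod, Nat.pow_mod]; norm_num
      omega
    rwa [hF, hq, pow_add, pow_mul, h3, one_pow, one_mul] at h1
  rw [h2, add_self, zero_add] at h
  exact one_ne_zero h

lemma elts_eq_of_finrank_two {E : Submodule (ZMod 2) F} (hE : Module.finrank (ZMod 2) E = 2)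
    {u w : F} (hu : u ∈ E) (hw : w ∈ E) (hu0 : u ≠ 0) (hw0 : w ≠ 0) (huw : u ≠ w) :
    ∀ f : F → F, ∑ x ∈ elts E, f x = f 0 + f u + f w + f (u + w) := by
  classical
  have hne : u + w ≠ 0 := fun h => huw (by linear_combination h - add_self w)
  have h1 : u ∉ ({w, u + w} : Finset F) := by simp [huw, hw0]
  have h2 : w ∉ ({u + w} : Finset F) := by simp [hu0]
  have h3 : (0 : F) ∉ ({u, w, u + w} : Finset F) := by simp [hu0.symm, hw0.symm, hne.symm]
  have he : {0, u, w, u + w} = elts E := by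
    refine Finset.eq_of_subset_of_card_le ?_ ?_
    · intro x hx
      simp only [Finset.mem_insert, Finset.mem_singleton] at hx
      rw [mem_elts]
      rcases hx with rfl | rfl | rfl | rfl
      exacts [E.zero_mem, hu, hw, E.add_mem hu hw]
    · rw [card_elts, hE, Finset.card_insert_of_notMem h3, Finset.card_insert_of_notMem h1,
        Finset.card_insert_of_notMem h2]; simp
  intro f
  rw [← he, Finset.sum_insert h3, Finset.sum_insert h1, Finset.sum_insert h2,
    Finset.sum_singleton]
  ring

lemma not_isZeroDim_two {n : ℕ} (hn : Odd n) (hF : Fintype.card F = 2 ^ n) :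
    ¬ IsZeroDim F 2 := by
  classical
  rintro ⟨E, hE, h⟩
  have hc := card_elts E
  rw [hE] at hc
  obtain ⟨u, hu, hu0⟩ := Finset.exists_mem_ne (by omega : 1 < (elts E).card) 0
  obtain ⟨w, hw, hw'⟩ := Finset.exists_mem_notMem_of_card_lt_card (s := ({0, u} : Finset F))
    (t := elts E) (lt_of_le_of_lt Finset.card_le_two (by omega))
  simp only [Finset.mem_insert, Finset.mem_singleton, not_or] at hw'
  rw [invSum, elts_eq_of_finrank_two hE (mem_elts.1 hu) (mem_elts.1 hw) hu0 hw'.1 (Ne.symm hw'.2)]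
    at h
  have hne : u + w ≠ 0 := fun h => hw'.2 (by linear_combination h - add_self u)
  have hw0 := hw'.1
  apply sq_add_self_add_one_ne_zero hn hF (u / w)
  rw [inv_zero] at h
  field_simp at h ⊢
  linear_combination h - add_self (u * w)

end Subspace

lemma exists_submodule_finrank_eq {k V : Type*} [Field k] [AddCommGroup V] [Module k V]
    [FiniteDimensional k V] (W : Submodule k V) {e : ℕ} (he : e ≤ Module.finrank k W) :
    ∃ E ≤ W, Module.finrank k E = e := by
  induction e with
  | zero => exact ⟨⊥, bot_le, finrank_bot k V⟩
  | succ e ih =>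
    obtain ⟨E, hEW, hE⟩ := ih (by omega)
    have hlt : E < W := lt_of_le_of_ne hEW fun h => by subst h; omega
    obtain ⟨x, hxW, hxE⟩ := SetLike.exists_of_lt hlt
    refine ⟨E ⊔ k ∙ x, sup_le hEW (by simpa [Submodule.span_le] using hxW), ?_⟩
    rw [Submodule.finrank_sup_span_singleton hxE, hE]

section Subfield

variable {F : Type*} [Field F] [Fintype F] [Algebra (ZMod 2) F]

lemma exists_mul_mem (Y W B : Submodule (ZMod 2) F) (hW : W ≤ Y)
    (hB : ∀ b ∈ B, ∀ y ∈ Y, b * y ∈ Y) :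
    ∃ S ≤ Y, (∀ x ∈ Y, x ∈ S ↔ ∀ b ∈ B, b * x ∈ W) ∧
      Module.finrank (ZMod 2) Y ≤ Module.finrank (ZMod 2) S +
        Module.finrank (ZMod 2) B * (Module.finrank (ZMod 2) Y - Module.finrank (ZMod 2) W) := by
  let P := Y.map (subMap W)
  let Φ : Y →ₗ[ZMod 2] B →ₗ[ZMod 2] P := LinearMap.mk₂ (ZMod 2)
    (fun y b => ⟨subMap W (b * y), ⟨_, hB b b.2 y y.2, rfl⟩⟩)
    (fun y y' b => by ext; simp [mul_add])
    (fun c y b => by ext; simp)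
    (fun y b b' => by ext; simp [add_mul])
    (fun c y b => by ext; simp)
  have hker : ∀ y : Y, y ∈ LinearMap.ker Φ ↔ ∀ b ∈ B, b * (y : F) ∈ W := by
    intro y
    rw [LinearMap.mem_ker, LinearMap.ext_iff]
    refine ⟨fun h b hb => ?_, fun h b => ?_⟩
    · have := congrArg Subtype.val (h ⟨b, hb⟩)
      exact subMap_eq_zero_iff.1 this
    · exact Subtype.ext (subMap_eq_zero_iff.2 (h b b.2))
  refine ⟨(LinearMap.ker Φ).map Y.subtype, Submodule.map_subtype_le _ _, fun x hx => ?_, ?_⟩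
  · rw [← hker ⟨x, hx⟩]
    simp [hx]
  · rw [Submodule.finrank_map_subtype_eq]
    have h1 := LinearMap.finrank_range_add_finrank_ker Φ
    have h2 := Submodule.finrank_le (LinearMap.range Φ)
    rw [Module.finrank_linearMap] at h2
    have h3 : Module.finrank (ZMod 2) P =
        Module.finrank (ZMod 2) Y - Module.finrank (ZMod 2) W := by
      have := finrank_map_subMap W Y hW
      exact Nat.eq_sub_of_add_eq this
    rw [h3] at h2
    omega

variable {K : Type*} [Field K] [Fintype K] [Algebra (ZMod 2) K] [Algebra K F]
  [IsScalarTower (ZMod 2) K F]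

/-- The image in `F` of an `𝔽₂`-subspace of a subfield `K`. -/
noncomputable def ofSubfield (F : Type*) [Field F] [Algebra (ZMod 2) F] {K : Type*} [Field K]
    [Algebra (ZMod 2) K] [Algebra K F] [IsScalarTower (ZMod 2) K F]
    (B : Submodule (ZMod 2) K) : Submodule (ZMod 2) F :=
  B.map (IsScalarTower.toAlgHom (ZMod 2) K F).toLinearMap

omit [Fintype F] [Fintype K] in
lemma mem_ofSubfield {B : Submodule (ZMod 2) K} {x : F} :
    x ∈ ofSubfield F B ↔ ∃ b ∈ B, algebraMap K F b = x := by
  simp [ofSubfield]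

omit [Fintype F] [Fintype K] in
lemma finrank_ofSubfield (B : Submodule (ZMod 2) K) :
    Module.finrank (ZMod 2) (ofSubfield F B) = Module.finrank (ZMod 2) B :=
  (Submodule.equivMapOfInjective _ (algebraMap K F).injective B).finrank_eq.symm

lemma invSum_ofSubfield (B : Submodule (ZMod 2) K) :
    invSum (ofSubfield F B) = algebraMap K F (invSum B) := by
  rw [invSum, invSum, map_sum]
  refine (Finset.sum_bij (fun b _ => algebraMap K F b) ?_ ?_ ?_ ?_).symm
  · intro b hb; exact mem_elts.2 (mem_ofSubfield.2 ⟨b, mem_elts.1 hb, rfl⟩)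
  · intro a _ b _ h; exact (algebraMap K F).injective h
  · intro x hx
    obtain ⟨b, hb, rfl⟩ := mem_ofSubfield.1 (mem_elts.1 hx)
    exact ⟨b, mem_elts.2 hb, rfl⟩
  · intro b _; simp

variable (K) in
lemma exists_subfield_subspace (W : Submodule (ZMod 2) F) {d e : ℕ}
    (hd : Module.finrank (ZMod 2) W + d = Module.finrank (ZMod 2) F)
    (he : e + d ≤ Module.finrank K F) :
    ∃ V : Submodule K F, Module.finrank K V = e ∧ V.restrictScalars (ZMod 2) ≤ W := by
  have : FiniteDimensional K F := Module.Finite.of_finite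
  obtain ⟨S, -, hS, hfin⟩ := exists_mul_mem ⊤ W (ofSubfield F (⊤ : Submodule (ZMod 2) K)) le_top
    (fun _ _ _ _ => trivial)
  rw [finrank_ofSubfield, finrank_top, finrank_top] at hfin
  have hS' : ∀ x, x ∈ S ↔ ∀ c : K, c • x ∈ W := by
    intro x
    rw [hS x trivial]
    simp [mem_ofSubfield, Algebra.smul_def]
  let V₀ : Submodule K F :=
    { carrier := S
      add_mem' := fun ha hb => S.add_mem ha hb
      zero_mem' := S.zero_mem
      smul_mem' := fun c x hx => by
        rw [SetLike.mem_coe, hS'] at hx ⊢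
        intro c'
        rw [smul_smul]; exact hx _ }
  have hV₀ : V₀.restrictScalars (ZMod 2) = S := rfl
  have h1 : Module.finrank (ZMod 2) K * Module.finrank K V₀ = Module.finrank (ZMod 2) S := by
    rw [← hV₀]; exact Module.finrank_mul_finrank (ZMod 2) K V₀
  have h2 := Module.finrank_mul_finrank (ZMod 2) K F
  have hl : 0 < Module.finrank (ZMod 2) K := Module.finrank_pos
  have h3 : e ≤ Module.finrank K V₀ := by
    have hd' : Module.finrank (ZMod 2) F - Module.finrank (ZMod 2) W = d := by omega
    rw [hd', ← h1, ← h2, ← mul_add] at hfin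
    have := Nat.le_of_mul_le_mul_left hfin hl
    omega
  obtain ⟨V, hV, hVe⟩ := exists_submodule_finrank_eq V₀ h3
  refine ⟨V, hVe, fun x hx => ?_⟩
  have := (hS' x).1 (hV hx) 1
  simpa using this

lemma subMap_smul (V : Submodule K F) (c : K) (x : F) :
    subMap (V.restrictScalars (ZMod 2)) (c • x) = c • subMap (V.restrictScalars (ZMod 2)) x := by
  classical
  have : FiniteDimensional K F := Module.Finite.of_finite
  rcases eq_or_ne c 0 with rfl | hc
  · simp
  · have hcard : (elts (V.restrictScalars (ZMod 2))).card =
        Fintype.card K ^ Module.finrank K V := by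
      have h := Module.card_eq_pow_finrank (K := K) (V := V)
      rw [← h, elts, Fintype.card_subtype]
      simp
    have h1 : ∏ u ∈ elts (V.restrictScalars (ZMod 2)), (c • x + u) =
        ∏ u ∈ elts (V.restrictScalars (ZMod 2)), c • (x + u) := by
      refine (Finset.prod_bij (fun u _ => c • u) ?_ ?_ ?_ ?_).symm
      · intro u hu
        simp only [mem_elts, Submodule.restrictScalars_mem] at *
        exact V.smul_mem c hu
      · intro a _ b _ h; exact smul_right_injective F hc h
      · intro u hu
        simp only [mem_elts, Submodule.restrictScalars_mem] at *
        exact ⟨c⁻¹ • u, V.smul_mem _ hu, smul_inv_smul₀ hc u⟩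
      · intro u _; rw [smul_add]
    rw [subMap_apply, subMap_apply, h1, Finset.prod_smul, Finset.prod_const, hcard,
      FiniteField.pow_card_pow]

lemma finrank_restrictScalars (V : Submodule K F) :
    Module.finrank (ZMod 2) (V.restrictScalars (ZMod 2)) =
      Module.finrank (ZMod 2) K * Module.finrank K V := by
  have : FiniteDimensional K F := Module.Finite.of_finite
  exact (Module.finrank_mul_finrank (ZMod 2) K V).symm

lemma invSum_restrictScalars (hK : 2 < Fintype.card K) (V : Submodule K F) :
    invSum (V.restrictScalars (ZMod 2)) = 0 := by
  obtain ⟨c, hc0, hc1⟩ := exists_ne_zero_ne_one hK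
  refine invSum_eq_zero_of_smul (c := algebraMap K F c) (by simpa using hc0) (by simpa using hc1) ?_
  intro x hx
  rw [← Algebra.smul_def]
  exact V.smul_mem c hx

variable (K) in
/-- Extending a zero-sum space by a `K`-subspace. -/
lemma IsZeroDim.add_mul (hK : 2 < Fintype.card K) {d e : ℕ} (h : IsZeroDim F d)
    (he : e + d ≤ Module.finrank K F) :
    IsZeroDim F (d + Module.finrank (ZMod 2) K * e) := by
  obtain ⟨E₁, rfl, h1⟩ := h
  have hW := finrank_map_subMap E₁ ⊤ le_top
  rw [finrank_top] at hW
  obtain ⟨V, rfl, hV⟩ := exists_subfield_subspace K _ hW he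
  obtain ⟨E, -, -, -, hfin, hsum⟩ := exists_lift ⊤ E₁ (V.restrictScalars (ZMod 2)) le_top hV
  refine ⟨E, by rw [hfin, finrank_restrictScalars], ?_⟩
  rw [hsum, h1, invSum_restrictScalars hK]; simp

variable (K) in
/-- Extending a zero-sum space by a `K`-subspace and a multiple of a zero-sum subspace of `K`. -/
lemma IsZeroDim.add_add_mul (hK : 2 < Fintype.card K) {d b e : ℕ} (h : IsZeroDim F d)
    (hb : IsZeroDim K b) (he : e + d ≤ Module.finrank K F ∨ e = 0)
    (hlt : d * b + Module.finrank (ZMod 2) K * e < Module.finrank (ZMod 2) F) :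
    IsZeroDim F (d + b + Module.finrank (ZMod 2) K * e) := by
  obtain ⟨E₁, rfl, h1⟩ := h
  obtain ⟨B, rfl, hB⟩ := hb
  have hW := finrank_map_subMap E₁ ⊤ le_top
  rw [finrank_top] at hW
  set W := (⊤ : Submodule (ZMod 2) F).map (subMap E₁) with hWdef
  obtain ⟨V, rfl, hV⟩ : ∃ V : Submodule K F, Module.finrank K V = e ∧
      V.restrictScalars (ZMod 2) ≤ W := by
    rcases he with he | rfl
    · exact exists_subfield_subspace K _ hW he
    · exact ⟨⊥, finrank_bot K F, fun x hx => by
        have : x = 0 := by simpa using hx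
        rw [this]; exact W.zero_mem⟩
  set V' := V.restrictScalars (ZMod 2) with hV'
  have hVfin : Module.finrank (ZMod 2) V' = Module.finrank (ZMod 2) K * Module.finrank K V :=
    finrank_restrictScalars V
  have hY := finrank_map_subMap V' ⊤ le_top
  rw [finrank_top] at hY
  have hW2 := finrank_map_subMap V' W hV
  obtain ⟨S, hSY, hS, hfin⟩ := exists_mul_mem ((⊤ : Submodule (ZMod 2) F).map (subMap V'))
    (W.map (subMap V')) (ofSubfield F B) (Submodule.map_mono le_top) (by
      rintro _ hb _ ⟨y, -, rfl⟩
      obtain ⟨b, -, rfl⟩ := mem_ofSubfield.1 hb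
      rw [← Algebra.smul_def, ← subMap_smul]
      exact ⟨_, trivial, rfl⟩)
  rw [finrank_ofSubfield] at hfin
  have hSpos : 0 < Module.finrank (ZMod 2) S := by
    have : Module.finrank (ZMod 2) ((⊤ : Submodule (ZMod 2) F).map (subMap V')) -
        Module.finrank (ZMod 2) (W.map (subMap V')) = Module.finrank (ZMod 2) E₁ := by omega
    rw [this, mul_comm] at hfin
    omega
  have hSne : S ≠ ⊥ := by rintro rfl; simp at hSpos
  obtain ⟨y, hyS, hy0⟩ := S.ne_bot_iff.1 hSne
  obtain ⟨E₀, hE₀W, -, -, hfin₀, hsum₀⟩ := exists_lift W V' (scale y (ofSubfield F B)) hV (by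
    intro x hx
    obtain ⟨b, hb, rfl⟩ := mem_scale.1 hx
    rw [mul_comm]
    exact (hS y (hSY hyS)).1 hyS b hb)
  obtain ⟨E, -, -, -, hfinE, hsumE⟩ := exists_lift ⊤ E₁ E₀ le_top hE₀W
  refine ⟨E, ?_, ?_⟩
  · rw [hfinE, hfin₀, finrank_scale hy0, finrank_ofSubfield, hVfin]; ring
  · rw [hsumE, hsum₀, invSum_scale hy0, invSum_ofSubfield, hB, invSum_restrictScalars hK, h1]
    simp

end Subfield

section SevenBits

open Polynomial

variable {F : Type*} [Field F] [Fintype F] [Algebra (ZMod 2) F]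

lemma sum_elts_sup_span (E : Submodule (ZMod 2) F) {x : F} (hx : x ∉ E) {M : Type*}
    [AddCommMonoid M] (f : F → M) :
    ∑ y ∈ elts (E ⊔ (ZMod 2) ∙ x), f y = ∑ u ∈ elts E, (f u + f (u + x)) := by
  classical
  have hdisj : Disjoint (elts E) ((elts E).image (· + x)) := by
    rw [Finset.disjoint_left]
    intro y hy hy'
    obtain ⟨u, hu, rfl⟩ := Finset.mem_image.1 hy'
    rw [mem_elts] at hy hu
    exact hx ((E.add_mem_iff_right hu).1 hy)
  have h2 : ∀ a : ZMod 2, a = 0 ∨ a = 1 := by decide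
  have hun : elts (E ⊔ (ZMod 2) ∙ x) = elts E ∪ (elts E).image (· + x) := by
    ext y
    simp only [mem_elts, Finset.mem_union, Finset.mem_image, Submodule.mem_sup,
      Submodule.mem_span_singleton]
    constructor
    · rintro ⟨u, hu, _, ⟨a, rfl⟩, rfl⟩
      rcases h2 a with rfl | rfl
      · left; simpa using hu
      · right; exact ⟨u, hu, by simp⟩
    · rintro (hy | ⟨u, hu, rfl⟩)
      · exact ⟨y, hy, 0, ⟨0, by simp⟩, by simp⟩
      · exact ⟨u, hu, x, ⟨1, by simp⟩, rfl⟩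
  rw [hun, Finset.sum_union hdisj, Finset.sum_image (fun a _ b _ h => add_right_cancel h),
    Finset.sum_add_distrib]

/-- The span of three elements, presented so that dimensions and sums are easy to compute. -/
noncomputable def span₃ (a b c : F) : Submodule (ZMod 2) F :=
  ((⊥ ⊔ (ZMod 2) ∙ a) ⊔ (ZMod 2) ∙ b) ⊔ (ZMod 2) ∙ c

omit [Fintype F] in
lemma mem_sup_span {E : Submodule (ZMod 2) F} {x y : F} :
    y ∈ E ⊔ (ZMod 2) ∙ x ↔ y ∈ E ∨ y + x ∈ E := by
  have h2 : ∀ a : ZMod 2, a = 0 ∨ a = 1 := by decide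
  rw [Submodule.mem_sup]
  constructor
  · rintro ⟨u, hu, v, hv, rfl⟩
    obtain ⟨a, rfl⟩ := Submodule.mem_span_singleton.1 hv
    rcases h2 a with rfl | rfl
    · left; simpa using hu
    · right; simpa [add_assoc, add_self] using hu
  · rintro (h | h)
    · exact ⟨y, h, 0, zero_mem _, by simp⟩
    · exact ⟨y + x, h, x, Submodule.mem_span_singleton_self x, by simp [add_assoc, add_self]⟩

/-- Three elements of a field of characteristic two are linearly independent over `𝔽₂`. -/
def Indep₃ (a b c : F) : Prop :=
  a ≠ 0 ∧ (b ≠ 0 ∧ b ≠ a) ∧ (c ≠ 0 ∧ c ≠ a ∧ c ≠ b ∧ c ≠ a + b)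

omit [Fintype F] in
lemma mem_span₂ {a b x : F} :
    x ∈ (⊥ ⊔ (ZMod 2) ∙ a) ⊔ (ZMod 2) ∙ b ↔ x = 0 ∨ x = a ∨ x = b ∨ x = a + b := by
  have := charP_two F
  simp only [mem_sup_span, Submodule.mem_bot]
  grind

omit [Fintype F] in
lemma Indep₃.notMem {a b c : F} (h : Indep₃ a b c) :
    a ∉ (⊥ : Submodule (ZMod 2) F) ∧ b ∉ (⊥ : Submodule (ZMod 2) F) ⊔ (ZMod 2) ∙ a ∧
      c ∉ (⊥ ⊔ (ZMod 2) ∙ a) ⊔ (ZMod 2) ∙ b := by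
  have := charP_two F
  obtain ⟨h1, ⟨h2, h3⟩, h4, h5, h6, h7⟩ := h
  refine ⟨by simpa using h1, ?_, ?_⟩
  · rw [mem_sup_span]; simp only [Submodule.mem_bot]; grind
  · rw [mem_span₂]; grind

lemma finrank_span₃ {a b c : F} (h : Indep₃ a b c) :
    Module.finrank (ZMod 2) (span₃ a b c) = 3 := by
  obtain ⟨h1, h2, h3⟩ := h.notMem
  rw [span₃, Submodule.finrank_sup_span_singleton h3, Submodule.finrank_sup_span_singleton h2,
    Submodule.finrank_sup_span_singleton h1, finrank_bot]

lemma sum_span₃ {a b c : F} (h : Indep₃ a b c) (f : F → F) :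
    ∑ x ∈ elts (span₃ a b c), f x = f 0 + f c + (f b + f (b + c)) +
      (f a + f (a + c) + (f (a + b) + f (a + b + c))) := by
  obtain ⟨h1, h2, h3⟩ := h.notMem
  rw [span₃, sum_elts_sup_span _ h3, sum_elts_sup_span _ h2, sum_elts_sup_span _ h1, elts_bot]
  simp

lemma exists_root_of_card (hF : Fintype.card F = 2 ^ 7) : ∃ c : F, c ^ 7 + c ^ 3 + 1 = 0 := by
  classical
  have := charP_two F
  let p : F[X] := X ^ 16 + X ^ 8 + X ^ 4 + X
  have hp : p.natDegree = 16 := by simp only [p]; compute_degree!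
  have hp0 : p ≠ 0 := by rintro h; simp [h] at hp
  obtain ⟨a, ha⟩ : ∃ a : F, p.eval a ≠ 0 := by
    by_contra! hall
    have := Polynomial.card_le_degree_of_subset_roots (p := p) (Z := Finset.univ)
      (fun a _ => (Polynomial.mem_roots hp0).2 (hall a))
    rw [hp, Finset.card_univ, hF] at this
    norm_num at this
  have ha' : a ^ 128 = a := by
    have := FiniteField.pow_card a
    rwa [hF] at this
  simp only [p, eval_add, eval_pow, eval_X] at ha
  refine ⟨a ^ 16 + a ^ 8 + a ^ 4 + a, mul_left_cancel₀ ha ?_⟩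
  set c := a ^ 16 + a ^ 8 + a ^ 4 + a with hc
  have h2 : c ^ 2 = a ^ 32 + a ^ 16 + a ^ 8 + a ^ 2 := by rw [hc]; simp only [CharTwo.add_sq]; ring
  have h4 : c ^ 4 = a ^ 64 + a ^ 32 + a ^ 16 + a ^ 4 := by
    rw [show c ^ 4 = (c ^ 2) ^ 2 by ring, h2]; simp only [CharTwo.add_sq]; ring
  have h8 : c ^ 8 = a ^ 128 + a ^ 64 + a ^ 32 + a ^ 8 := by
    rw [show c ^ 8 = (c ^ 4) ^ 2 by ring, h4]; simp only [CharTwo.add_sq]; ring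
  have : c * (c ^ 7 + c ^ 3 + 1) = c ^ 8 + c ^ 4 + c := by ring
  rw [this, h8, h4, ha', hc]
  have h0 : (2 : F) = 0 := CharTwo.two_eq_zero
  linear_combination (a ^ 64 + a ^ 32 + a ^ 16 + a ^ 8 + a ^ 4 + a) * h0

lemma isZeroDim_three (hF : Fintype.card F = 2 ^ 7) : IsZeroDim F 3 := by
  have := charP_two F
  obtain ⟨c, hc⟩ := exists_root_of_card hF
  have hc0 : c ≠ 0 := by rintro rfl; simp at hc
  have hc1 : c ≠ 1 := by rintro rfl; grind
  have hind : Indep₃ c (c ^ 2) (c ^ 4) := by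
    refine ⟨hc0, ⟨by positivity, by grind⟩, by positivity, by grind, by grind, by grind⟩
  refine ⟨span₃ c (c ^ 2) (c ^ 4), finrank_span₃ hind, ?_⟩
  have hd7 : c⁻¹ ^ 7 = c⁻¹ ^ 4 + 1 := by
    have : c⁻¹ ^ 7 * (c ^ 7 + c ^ 3 + 1) = 1 + c⁻¹ ^ 4 + c⁻¹ ^ 7 := by field_simp
    rw [hc, mul_zero] at this
    clear hind
    generalize c⁻¹ = d at *
    grind
  have e8 : c + c ^ 4 = c ^ 8 := by grind
  have e16 : c + c ^ 2 + c ^ 4 = c ^ 16 := by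
    rw [show c ^ 16 = (c ^ 8) ^ 2 by ring, ← e8, CharTwo.add_sq]; grind
  have e32 : c + c ^ 2 = c ^ 32 := by
    rw [show c ^ 32 = (c ^ 16) ^ 2 by ring, ← e16, CharTwo.add_sq, CharTwo.add_sq]; grind
  have e64 : c ^ 2 + c ^ 4 = c ^ 64 := by
    rw [show c ^ 64 = (c ^ 32) ^ 2 by ring, ← e32, CharTwo.add_sq]; ring
  rw [invSum, sum_span₃ hind, e16, e32, e64, e8]
  simp only [← inv_pow, inv_zero]
  generalize c⁻¹ = d at hd7
  have h8 : d ^ 8 = d ^ 5 + d := by grind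
  have h16 : d ^ 16 = d ^ 4 + 1 + d ^ 3 + d ^ 2 := by
    rw [show d ^ 16 = (d ^ 8) ^ 2 by ring, h8, CharTwo.add_sq]; grind
  have h32 : d ^ 32 = d ^ 6 + d ^ 5 + d ^ 4 + d + 1 := by
    rw [show d ^ 32 = (d ^ 16) ^ 2 by ring, h16]; simp only [CharTwo.add_sq]; grind
  have h64 : d ^ 64 = d ^ 6 + d ^ 4 + d ^ 3 + d := by
    rw [show d ^ 64 = (d ^ 32) ^ 2 by ring, h32]; simp only [CharTwo.add_sq]; grind
  rw [h8, h16, h32, h64]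
  grind

end SevenBits

section Trace

variable {F : Type*} [Field F] [Fintype F] [Algebra (ZMod 2) F]

lemma trace_sq (x : F) : Algebra.trace (ZMod 2) F (x ^ 2) = Algebra.trace (ZMod 2) F x := by
  have := charP_two F
  have : ExpChar F 2 := ExpChar.prime Nat.prime_two
  have h := Algebra.trace_eq_of_algEquiv (FiniteField.frobeniusAlgEquiv (ZMod 2) F 2) x
  rw [← h]
  simp

variable (F) in
/-- The Artin–Schreier map `y ↦ y² + y`. -/
def artinSchreier : F →ₗ[ZMod 2] F :=
  have := charP_two F
  AddMonoidHom.toZModLinearMap 2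
    { toFun := fun y => y ^ 2 + y
      map_zero' := by simp
      map_add' := fun x y => by rw [CharTwo.add_sq]; ring }

omit [Fintype F] in
lemma artinSchreier_apply (y : F) : artinSchreier F y = y ^ 2 + y := rfl

lemma exists_sq_add_of_trace_eq_zero {x : F} (hx : Algebra.trace (ZMod 2) F x = 0) :
    ∃ y, y ^ 2 + y = x := by
  have := charP_two F
  have hker : LinearMap.ker (artinSchreier F) = ⊥ ⊔ (ZMod 2) ∙ (1 : F) := by
    ext y
    rw [LinearMap.mem_ker, artinSchreier_apply, mem_sup_span, Submodule.mem_bot, Submodule.mem_bot,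
      ← mul_eq_zero]
    ring_nf
  have h1 := LinearMap.finrank_range_add_finrank_ker (artinSchreier F)
  have h2 := LinearMap.finrank_range_add_finrank_ker (Algebra.trace (ZMod 2) F)
  rw [hker, Submodule.finrank_sup_span_singleton (by simp), finrank_bot] at h1
  rw [LinearMap.range_eq_top.2 (Algebra.trace_surjective (ZMod 2) F), finrank_top,
    Module.finrank_self] at h2
  have hle : LinearMap.range (artinSchreier F) ≤ LinearMap.ker (Algebra.trace (ZMod 2) F) := by
    rintro _ ⟨y, rfl⟩
    rw [LinearMap.mem_ker, artinSchreier_apply, map_add, trace_sq, ← two_mul]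
    exact mul_eq_zero_of_left (by decide) _
  have heq := Submodule.eq_of_le_of_finrank_eq hle (by omega)
  have hx' : x ∈ LinearMap.range (artinSchreier F) := by rw [heq]; exact hx
  exact hx'

lemma elts_span₂ {a b : F} :
    (elts ((⊥ ⊔ (ZMod 2) ∙ a) ⊔ (ZMod 2) ∙ b) : Set F) = {0, a, b, a + b} := by
  ext x
  rw [Finset.mem_coe, mem_elts, mem_span₂]
  simp

/-- A criterion for the existence of a five-dimensional zero-sum space. -/
lemma isZeroDim_five_of_trace {n : ℕ} (hn : Odd n) (hF : Fintype.card F = 2 ^ n) {w : F}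
    (hw0 : w ≠ 0) (hw1 : w ≠ 1) {T : Submodule (ZMod 2) F}
    (hT : Module.finrank (ZMod 2) T = 3) (hTs : invSum T = 1)
    (h1 : ∀ e ∈ T, Algebra.trace (ZMod 2) F (e * (1 + w + w ^ 2)⁻¹) = 0)
    (h2 : ∀ e ∈ T, Algebra.trace (ZMod 2) F (e * (w ^ 2 * (1 + w + w ^ 2)⁻¹)) = 0) :
    IsZeroDim F 5 := by
  classical
  have := charP_two F
  have htwo : (2 : F) = 0 := CharTwo.two_eq_zero
  have hs : 1 + w + w ^ 2 ≠ 0 := by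
    have := sq_add_self_add_one_ne_zero hn hF w
    intro h; apply this; linear_combination h
  have hw1' : 1 + w ≠ 0 := by intro h; apply hw1; linear_combination h - htwo
  set U : Submodule (ZMod 2) F := (⊥ ⊔ (ZMod 2) ∙ 1) ⊔ (ZMod 2) ∙ w with hU
  have hUfin : Module.finrank (ZMod 2) U = 2 := by
    rw [hU, Submodule.finrank_sup_span_singleton, Submodule.finrank_sup_span_singleton,
      finrank_bot]
    · simp
    · rw [mem_sup_span, Submodule.mem_bot, Submodule.mem_bot, add_comm]
      tauto
  have helts : elts U = {0, 1, w, 1 + w} := by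
    apply Finset.coe_injective
    rw [elts_span₂]; simp
  have hne1 : (1 : F) ≠ 1 + w := by simpa using hw0
  have hne2 : w ≠ 1 + w := by simp
  have hsum : invSum U = (1 + w + w ^ 2) * (w * (1 + w))⁻¹ := by
    rw [invSum, helts, Finset.sum_insert (by simp [hw0.symm, hw1'.symm]),
      Finset.sum_insert (by simp [hw1.symm, hne1]), Finset.sum_insert (by simp),
      Finset.sum_singleton]
    field_simp
    linear_combination w * htwo
  have hprod : prodNZ U = w * (1 + w) := by
    rw [prodNZ, helts, Finset.erase_insert (by simp [hw0.symm, hw1'.symm]),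
      Finset.prod_insert (by simp [hw1.symm, hne1]), Finset.prod_insert (by simp),
      Finset.prod_singleton, one_mul]
  have hmap : ∀ x, subMap U x = (x ^ 2 + x) * (x ^ 2 + x + w * (1 + w)) := by
    intro x
    rw [subMap_apply, helts, Finset.prod_insert (by simp [hw0.symm, hw1'.symm]),
      Finset.prod_insert (by simp [hw1.symm, hne1]), Finset.prod_insert (by simp),
      Finset.prod_singleton]
    linear_combination (x ^ 2 + x) * w * x * htwo
  set c : F := (w * (1 + w)) ^ 2 * (1 + w + w ^ 2)⁻¹ with hc
  have hc0 : c ≠ 0 := by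
    rw [hc]; positivity
  obtain ⟨E, -, -, -, hfin, hE⟩ := exists_lift ⊤ U (scale c T) le_top (by
    intro y hy
    obtain ⟨e, he, rfl⟩ := mem_scale.1 hy
    obtain ⟨Y, hY⟩ := exists_sq_add_of_trace_eq_zero (h1 e he)
    have htr : Algebra.trace (ZMod 2) F (w * (1 + w) * Y) = 0 := by
      have h := h2 e he
      rw [show e * (w ^ 2 * (1 + w + w ^ 2)⁻¹) = (w * Y) ^ 2 + w ^ 2 * Y by
        linear_combination -w ^ 2 * hY, map_add, trace_sq, ← map_add] at h
      rw [← h]; congr 1; ring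
    obtain ⟨x, hx⟩ := exists_sq_add_of_trace_eq_zero htr
    refine ⟨x, trivial, ?_⟩
    rw [hmap, hx, hc]
    linear_combination (w * (1 + w)) ^ 2 * hY)
  refine ⟨E, by rw [hfin, hUfin, finrank_scale hc0, hT], ?_⟩
  rw [hE, hsum, hprod, invSum_scale hc0, hTs, hc]
  field_simp
  linear_combination (1 + w + w ^ 2) * htwo

end Trace

section Character

variable {F : Type*} [Field F] [Fintype F] [Algebra (ZMod 2) F]

open Classical in
/-- The canonical additive character `x ↦ (-1)^{Tr x}`. -/
noncomputable def chi (x : F) : ℤ := if Algebra.trace (ZMod 2) F x = 0 then 1 else -1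

omit [Fintype F] in
lemma chi_zero : chi (0 : F) = 1 := by simp [chi]

omit [Fintype F] in
lemma chi_add (x y : F) : chi (x + y) = chi x * chi y := by
  have h : ∀ a b : ZMod 2, (if a + b = 0 then (1 : ℤ) else -1) =
      (if a = 0 then 1 else -1) * (if b = 0 then 1 else -1) := by decide
  unfold chi
  rw [map_add]
  convert h (Algebra.trace (ZMod 2) F x) (Algebra.trace (ZMod 2) F y)

lemma sum_chi_eq_zero {T : Submodule (ZMod 2) F} {y e : F} (he : e ∈ T)
    (hy : Algebra.trace (ZMod 2) F (e * y) ≠ 0) : ∑ c ∈ elts T, chi (c * y) = 0 := by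
  have h : ∑ c ∈ elts T, chi (c * y) = ∑ c ∈ elts T, chi ((e + c) * y) :=
    (Finset.sum_bij (fun c _ => e + c)
      (fun c hc => mem_elts.2 (T.add_mem he (mem_elts.1 hc)))
      (fun a _ b _ h => add_left_cancel h)
      (fun c hc => ⟨c - e, mem_elts.2 (T.sub_mem (mem_elts.1 hc) he), by ring⟩)
      (fun c _ => rfl)).symm
  simp only [add_mul, chi_add, ← Finset.mul_sum] at h
  have h1 : chi (e * y) = -1 := by simp [chi, hy]
  rw [h1] at h
  linarith

lemma sum_chi_mul [DecidableEq F] (a : F) :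
    ∑ c, chi (c * a) = if a = 0 then (Fintype.card F : ℤ) else 0 := by
  split_ifs with ha
  · simp [ha, chi_zero]
  · obtain ⟨x, hx⟩ := Algebra.trace_surjective (ZMod 2) F 1
    rw [← elts_top]
    refine sum_chi_eq_zero (e := x * a⁻¹) trivial ?_
    rw [inv_mul_cancel_right₀ ha, hx]
    exact one_ne_zero

lemma sum_sq_sum_chi [DecidableEq F] (Ω : Finset F) (φ : F → F) :
    ∑ α, (∑ w ∈ Ω, chi (α * φ w)) ^ 2 =
      ∑ w ∈ Ω, ∑ w' ∈ Ω, if φ w' = φ w then (Fintype.card F : ℤ) else 0 := by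
  have := charP_two F
  simp only [pow_two, Finset.sum_mul_sum, ← chi_add, ← mul_add]
  rw [Finset.sum_comm]
  refine Finset.sum_congr rfl fun w _ => ?_
  rw [Finset.sum_comm]
  refine Finset.sum_congr rfl fun w' _ => ?_
  rw [sum_chi_mul]
  simp only [CharTwo.add_eq_zero, eq_comm]

lemma sum_sq_sum_chi_le (Ω : Finset F) (φ g : F → F)
    (h : ∀ w ∈ Ω, ∀ w' ∈ Ω, φ w' = φ w → w' = w ∨ w' = g w) :
    ∑ α, (∑ w ∈ Ω, chi (α * φ w)) ^ 2 ≤ 2 * Fintype.card F * Ω.card := by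
  classical
  rw [sum_sq_sum_chi, mul_comm _ (Ω.card : ℤ), ← nsmul_eq_mul, ← Finset.sum_const]
  refine Finset.sum_le_sum fun w hw => ?_
  rw [← Finset.sum_filter, Finset.sum_const, nsmul_eq_mul]
  have hcard : (Ω.filter fun w' => φ w' = φ w).card ≤ 2 := by
    refine (Finset.card_le_card (t := {w, g w}) fun w' hw' => ?_).trans Finset.card_le_two
    rw [Finset.mem_filter] at hw'
    simpa using h w hw w' hw'.1 hw'.2
  exact mul_le_mul_of_nonneg_right (by exact_mod_cast hcard) (by positivity)

lemma sum_sum_sq_sum_chi (Ω : Finset F) (φ ψ : F → F)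
    (h : ∀ w ∈ Ω, ∀ w' ∈ Ω, φ w' = φ w → ψ w' = ψ w → w' = w) :
    ∑ α, ∑ β, (∑ w ∈ Ω, chi (α * φ w + β * ψ w)) ^ 2 =
      (Fintype.card F : ℤ) ^ 2 * Ω.card := by
  classical
  have := charP_two F
  have key : ∀ w ∈ Ω, ∀ w' ∈ Ω,
      ∑ α, ∑ β, chi (α * φ w + β * ψ w + (α * φ w' + β * ψ w')) =
        if w = w' then (Fintype.card F : ℤ) ^ 2 else 0 := by
    intro w hw w' hw'
    have : ∀ α β : F, chi (α * φ w + β * ψ w + (α * φ w' + β * ψ w')) =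
        chi (α * (φ w + φ w')) * chi (β * (ψ w + ψ w')) := by
      intro α β; rw [← chi_add]; congr 1; ring
    simp only [this, ← Finset.mul_sum, ← Finset.sum_mul, sum_chi_mul, CharTwo.add_eq_zero]
    by_cases hww : w = w'
    · subst hww; simp [pow_two]
    · rw [if_neg hww]
      by_cases h1 : φ w = φ w'
      · rw [if_neg (fun h2 => hww (h w' hw' w hw h1 h2)), mul_zero]
      · rw [if_neg h1, zero_mul]
  calc _ = ∑ α, ∑ β, ∑ w ∈ Ω, ∑ w' ∈ Ω, chi (α * φ w + β * ψ w + (α * φ w' + β * ψ w')) := by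
        simp only [pow_two, Finset.sum_mul_sum, ← chi_add]
    _ = ∑ w ∈ Ω, ∑ w' ∈ Ω, ∑ α, ∑ β, chi (α * φ w + β * ψ w + (α * φ w' + β * ψ w')) := by
        rw [Finset.sum_congr rfl fun α _ => Finset.sum_comm]
        rw [Finset.sum_comm]
        refine Finset.sum_congr rfl fun w _ => ?_
        rw [Finset.sum_congr rfl fun α _ => Finset.sum_comm]
        rw [Finset.sum_comm]
    _ = ∑ w ∈ Ω, ∑ w' ∈ Ω, if w = w' then (Fintype.card F : ℤ) ^ 2 else 0 :=
        Finset.sum_congr rfl fun w hw => Finset.sum_congr rfl fun w' hw' => key w hw w' hw'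
    _ = _ := by
        simp [Finset.sum_ite_eq, mul_comm]

end Character

section Counting

variable {F : Type*} [Field F] [Fintype F] [Algebra (ZMod 2) F]

lemma invSum_sup_span {U : Submodule (ZMod 2) F} {z : F} (hz : z ∉ U) :
    invSum (U ⊔ (ZMod 2) ∙ z) = invSum U + prodNZ U * (subMap U z)⁻¹ := by
  rw [invSum, sum_elts_sup_span _ hz, Finset.sum_add_distrib, ← sum_coset U hz, invSum]
  congr 1
  exact Finset.sum_congr rfl fun u _ => by rw [add_comm]

variable (F) in
/-- The three-dimensional subspaces whose inverses sum to one. -/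
noncomputable def unitSpaces : Finset (Submodule (ZMod 2) F) :=
  (Set.toFinite {T : Submodule (ZMod 2) F | Module.finrank (ZMod 2) T = 3 ∧ invSum T = 1}).toFinset

lemma mem_unitSpaces {T : Submodule (ZMod 2) F} :
    T ∈ unitSpaces F ↔ Module.finrank (ZMod 2) T = 3 ∧ invSum T = 1 := by
  simp [unitSpaces]

lemma eq_of_mem_unitSpaces {T T' : Submodule (ZMod 2) F} (hT : T ∈ unitSpaces F)
    (hT' : T' ∈ unitSpaces F) {a b : F} (ha : a ≠ 0) (hb : b ≠ 0) (hab : b ≠ a)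
    (haT : a ∈ T) (hbT : b ∈ T) (haT' : a ∈ T') (hbT' : b ∈ T') : T = T' := by
  have := charP_two F
  rw [mem_unitSpaces] at hT hT'
  have hb' : b ∉ (⊥ : Submodule (ZMod 2) F) ⊔ (ZMod 2) ∙ a := by
    rw [mem_sup_span, Submodule.mem_bot, Submodule.mem_bot, CharTwo.add_eq_zero]; tauto
  set U := ((⊥ : Submodule (ZMod 2) F) ⊔ (ZMod 2) ∙ a) ⊔ (ZMod 2) ∙ b with hU
  have hUfin : Module.finrank (ZMod 2) U = 2 := by
    rw [hU, Submodule.finrank_sup_span_singleton hb', Submodule.finrank_sup_span_singleton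
      (by simpa using ha), finrank_bot]
  have key : ∀ S : Submodule (ZMod 2) F, Module.finrank (ZMod 2) S = 3 ∧ invSum S = 1 →
      a ∈ S → b ∈ S → U ≤ S ∧ ∃ z ∈ S, z ∉ U ∧ S = U ⊔ (ZMod 2) ∙ z ∧
        prodNZ U * (subMap U z)⁻¹ = 1 - invSum U := by
    rintro S ⟨hS3, hS1⟩ haS hbS
    have hUS : U ≤ S := by
      intro x hx
      rcases mem_span₂.1 hx with rfl | rfl | rfl | rfl
      exacts [S.zero_mem, haS, hbS, S.add_mem haS hbS]
    have hlt : U < S := lt_of_le_of_ne hUS fun h => by rw [← h] at hS3; omega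
    obtain ⟨z, hzS, hzU⟩ := SetLike.exists_of_lt hlt
    have hle : U ⊔ (ZMod 2) ∙ z ≤ S := sup_le hUS (by simpa [Submodule.span_le] using hzS)
    have heq := Submodule.eq_of_le_of_finrank_eq hle (by
      rw [Submodule.finrank_sup_span_singleton hzU]; omega)
    refine ⟨hUS, z, hzS, hzU, heq.symm, ?_⟩
    rw [← hS1, ← heq, invSum_sup_span hzU]; ring
  obtain ⟨-, z, hzT, hzU, hzeq, hz⟩ := key T hT haT hbT
  obtain ⟨hUT', z', hzT', hzU', hzeq', hz'⟩ := key T' hT' haT' hbT'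
  have h1 : subMap U z = subMap U z' :=
    inv_injective (mul_left_cancel₀ (prodNZ_ne_zero U) (hz.trans hz'.symm))
  have h2 : z - z' ∈ U := by
    rw [← subMap_eq_zero_iff, map_sub, h1, sub_self]
  have h3 : z ∈ T' := by
    have := T'.add_mem (hUT' h2) hzT'
    simpa using this
  refine Submodule.eq_of_le_of_finrank_eq ?_ (hT.1.trans hT'.1.symm)
  rw [hzeq]
  exact sup_le hUT' (by simpa [Submodule.span_le] using h3)

open Classical in
lemma card_unitSpaces_pair {a b : F} (ha : a ≠ 0) (hb : b ≠ 0) (hab : b ≠ a) :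
    ((unitSpaces F).filter fun T => a ∈ T ∧ b ∈ T).card ≤ 1 := by
  rw [Finset.card_le_one]
  intro T hT T' hT'
  rw [Finset.mem_filter] at hT hT'
  exact eq_of_mem_unitSpaces hT.1 hT'.1 ha hb hab hT.2.1 hT.2.2 hT'.2.1 hT'.2.2

open Classical in
lemma card_unitSpaces_mem {a : F} (ha : a ≠ 0) :
    ((unitSpaces F).filter fun T => a ∈ T).card ≤ Fintype.card F := by
  have hex : ∀ T : Submodule (ZMod 2) F, ∃ b : F, T ∈ (unitSpaces F).filter (fun T => a ∈ T) →
      b ≠ 0 ∧ b ≠ a ∧ b ∈ T := by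
    intro T
    by_cases hT : T ∈ (unitSpaces F).filter (fun T => a ∈ T)
    swap
    · exact ⟨0, fun h => absurd h hT⟩
    rw [Finset.mem_filter, mem_unitSpaces] at hT
    have hlt : ({0, a} : Finset F).card < (elts T).card := by
      rw [card_elts, hT.1.1]
      exact Finset.card_le_two.trans_lt (by norm_num)
    obtain ⟨b, hb, hb'⟩ := Finset.exists_mem_notMem_of_card_lt_card hlt
    refine ⟨b, fun _ => ?_⟩
    simp only [Finset.mem_insert, Finset.mem_singleton, not_or] at hb'
    exact ⟨hb'.1, hb'.2, mem_elts.1 hb⟩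
  choose b hb using hex
  rw [← Finset.card_univ]
  refine Finset.card_le_card_of_injOn b (fun _ _ => Finset.mem_coe.2 (Finset.mem_univ _)) ?_
  intro T hT T' hT' h
  have h1 := hb T hT
  have h2 := hb T' hT'
  rw [Finset.mem_coe, Finset.mem_filter] at hT hT'
  rw [← h] at h2
  exact eq_of_mem_unitSpaces hT.1 hT'.1 ha h1.1 h1.2.1 hT.2 h1.2.2 hT'.2 h2.2.2

open Classical in
lemma card_subMap_eq_le (U : Submodule (ZMod 2) F) (y : F) :
    (Finset.univ.filter fun z => subMap U z = y).card ≤ (elts U).card := by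
  by_cases h : ∃ z₀, subMap U z₀ = y
  · obtain ⟨z₀, rfl⟩ := h
    refine Finset.card_le_card_of_injOn (fun z => z - z₀) (fun z hz => ?_)
      (fun a _ b _ h => by simpa using h)
    simp only [Finset.coe_filter, Finset.mem_univ, true_and, Set.mem_ofPred_eq] at hz
    rw [Finset.mem_coe, mem_elts, ← subMap_eq_zero_iff, map_sub, hz, sub_self]
  · push Not at h
    rw [Finset.filter_false_of_mem (fun z _ => h z)]
    simp

open Classical in
variable (F) in
lemma card_unitSpaces_ge :
    (Fintype.card F - 2) * (Fintype.card F - 8) ≤ 512 * (unitSpaces F).card := by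
  have := charP_two F
  let S : F → F → F := fun b z => invSum (span₃ 1 b z)
  let good : F → Finset F := fun b =>
    Finset.univ.filter fun z => Indep₃ 1 b z ∧ S b z ≠ 0
  let I := (Finset.univ \ {0, 1} : Finset F).sigma good
  have hgood : ∀ b ∈ (Finset.univ \ {0, 1} : Finset F), Fintype.card F - 8 ≤ (good b).card := by
    intro b hb
    simp only [Finset.mem_sdiff, Finset.mem_univ, Finset.mem_insert, Finset.mem_singleton,
      true_and, not_or] at hb
    set U := ((⊥ : Submodule (ZMod 2) F) ⊔ (ZMod 2) ∙ 1) ⊔ (ZMod 2) ∙ b with hU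
    have hU4 : (elts U).card = 4 := by
      rw [card_elts, hU, Submodule.finrank_sup_span_singleton, Submodule.finrank_sup_span_singleton
        (by simp), finrank_bot]
      · norm_num
      · rw [mem_sup_span, Submodule.mem_bot, Submodule.mem_bot, CharTwo.add_eq_zero]; tauto
    have hsub : Finset.univ ⊆ good b ∪ (Finset.univ.filter (fun z => subMap U z = 0) ∪
        Finset.univ.filter fun z => subMap U z = prodNZ U * (invSum U)⁻¹) := by
      intro z _
      simp only [Finset.mem_union, Finset.mem_filter, Finset.mem_univ, true_and, good]
      by_cases h0 : subMap U z = 0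
      · tauto
      · by_cases hS : S b z = 0
        · right; right
          have hz : z ∉ U := fun h => h0 (subMap_eq_zero_iff.2 h)
          have h1 : invSum U + prodNZ U * (subMap U z)⁻¹ = 0 := by
            rw [← invSum_sup_span hz]; exact hS
          have h2 : invSum U = prodNZ U * (subMap U z)⁻¹ := CharTwo.add_eq_zero.1 h1
          rw [h2, mul_inv, inv_inv, mul_inv_cancel_left₀ (prodNZ_ne_zero U)]
        · left
          refine ⟨⟨one_ne_zero, hb, ?_⟩, hS⟩
          have hz : z ∉ U := fun h => h0 (subMap_eq_zero_iff.2 h)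
          rw [hU, mem_span₂] at hz
          tauto
    have h1 := Finset.card_le_card hsub
    have h2 := Finset.card_union_le (good b) (Finset.univ.filter (fun z => subMap U z = 0) ∪
        Finset.univ.filter fun z => subMap U z = prodNZ U * (invSum U)⁻¹)
    have h3 := Finset.card_union_le (Finset.univ.filter (fun z => subMap U z = 0))
        (Finset.univ.filter fun z => subMap U z = prodNZ U * (invSum U)⁻¹)
    have h4 := card_subMap_eq_le U 0
    have h5 := card_subMap_eq_le U (prodNZ U * (invSum U)⁻¹)
    rw [Finset.card_univ] at h1
    omega
  have hI : (Fintype.card F - 2) * (Fintype.card F - 8) ≤ I.card := by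
    rw [Finset.card_sigma]
    refine le_trans ?_ (Finset.card_nsmul_le_sum _ _ _ hgood)
    rw [smul_eq_mul, Finset.card_sdiff_of_subset (Finset.subset_univ _), Finset.card_univ,
      Finset.card_pair zero_ne_one]
  refine hI.trans ?_
  let J := (unitSpaces F).sigma fun T => elts T ×ˢ elts T ×ˢ elts T
  have hJ : J.card = 512 * (unitSpaces F).card := by
    rw [Finset.card_sigma, Finset.sum_congr rfl (g := fun _ => 512), Finset.sum_const,
      smul_eq_mul, mul_comm]
    intro T hT
    rw [Finset.card_product, Finset.card_product, card_elts, (mem_unitSpaces.1 hT).1]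
    norm_num
  rw [← hJ]
  refine Finset.card_le_card_of_injOn
    (fun p => ⟨scale (S p.1 p.2) (span₃ 1 p.1 p.2), S p.1 p.2, S p.1 p.2 * p.1, S p.1 p.2 * p.2⟩)
    ?_ ?_
  · rintro ⟨b, z⟩ hp
    simp only [Finset.mem_coe, I, Finset.mem_sigma, good, Finset.mem_filter] at hp
    obtain ⟨-, -, hind, hS⟩ := hp
    simp only [Finset.mem_coe, J, Finset.mem_sigma, Finset.mem_product, mem_elts, mem_unitSpaces]
    refine ⟨⟨?_, ?_⟩, ?_, ?_, ?_⟩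
    · rw [finrank_scale hS, finrank_span₃ hind]
    · rw [invSum_scale hS]; exact inv_mul_cancel₀ hS
    · exact mem_scale.2 ⟨1, by rw [span₃, mem_sup_span, mem_span₂]; tauto, mul_one _⟩
    · exact mem_scale.2 ⟨b, by rw [span₃, mem_sup_span, mem_span₂]; tauto, rfl⟩
    · exact mem_scale.2 ⟨z, by rw [span₃, mem_sup_span, add_self]; simp, rfl⟩
  · rintro ⟨b, z⟩ hp ⟨b', z'⟩ hp' h
    simp only [Finset.mem_coe, I, Finset.mem_sigma, good, Finset.mem_filter] at hp
    obtain ⟨-, -, hind, hS⟩ := hp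
    simp only [Sigma.mk.injEq, heq_eq_eq, Prod.mk.injEq] at h
    obtain ⟨-, h1, h2, h3⟩ := h
    rw [← h1] at h2 h3
    have hb := mul_left_cancel₀ hS h2
    have hz := mul_left_cancel₀ hS h3
    rw [hb, hz]

end Counting

section Five

variable {F : Type*} [Field F] [Fintype F] [Algebra (ZMod 2) F]

open Classical in
/-- The weighted number of unit spaces is controlled by full and degenerate second moments. -/
lemma sum_unitSpaces_le (H : F → F → ℤ) (hH : ∀ a b, 0 ≤ H a b) :
    ∑ T ∈ unitSpaces F, ∑ p ∈ (elts T ×ˢ elts T).erase (0, 0), H p.1 p.2 ≤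
      ∑ a, ∑ b, H a b + Fintype.card F * (∑ a, H a 0 + ∑ b, H 0 b + ∑ a, H a a) := by
  have h1 : ∑ T ∈ unitSpaces F, ∑ p ∈ (elts T ×ˢ elts T).erase (0, 0), H p.1 p.2 =
      ∑ p ∈ (Finset.univ : Finset (F × F)).erase (0, 0),
        ((unitSpaces F).filter fun T => p.1 ∈ T ∧ p.2 ∈ T).card * H p.1 p.2 := by
    rw [Finset.sum_comm' (t' := (Finset.univ : Finset (F × F)).erase (0, 0))
      (s' := fun p => (unitSpaces F).filter fun T => p.1 ∈ T ∧ p.2 ∈ T)]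
    · simp
    · intro T p
      simp only [Finset.mem_erase, Finset.mem_product, mem_elts, Finset.mem_filter,
        Finset.mem_univ]
      tauto
  have h2 : ∑ a, ∑ b, H a b + Fintype.card F * (∑ a, H a 0 + ∑ b, H 0 b + ∑ a, H a a) =
      ∑ p : F × F, (1 + Fintype.card F * ((if p.2 = 0 then 1 else 0) +
        (if p.1 = 0 then 1 else 0) + (if p.1 = p.2 then 1 else 0))) * H p.1 p.2 := by
    simp only [add_mul, mul_add, Finset.sum_add_distrib, one_mul, mul_assoc, ← Finset.mul_sum,
      ite_mul, zero_mul, Fintype.sum_prod_type]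
    congr 1
    congr 1
    · congr 2
      · simp
      · rw [Finset.sum_comm]; simp
    · simp
  rw [h1, h2]
  refine (Finset.sum_le_sum fun p hp => ?_).trans
    (Finset.sum_le_sum_of_subset_of_nonneg (Finset.erase_subset _ _) fun p _ _ =>
      mul_nonneg (by positivity) (hH _ _))
  refine mul_le_mul_of_nonneg_right ?_ (hH _ _)
  obtain ⟨a, b⟩ := p
  simp only [Finset.mem_erase, ne_eq, Prod.mk.injEq, Finset.mem_univ, and_true] at hp
  simp only
  have hmem : ∀ c : F, c ≠ 0 → (c = a ∨ c = b) →
      (((unitSpaces F).filter fun T => a ∈ T ∧ b ∈ T).card : ℤ) ≤ Fintype.card F := by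
    intro c hc hcab
    refine Nat.cast_le.2 ((Finset.card_le_card fun T hT => ?_).trans (card_unitSpaces_mem hc))
    rw [Finset.mem_filter] at hT ⊢
    rcases hcab with rfl | rfl
    exacts [⟨hT.1, hT.2.1⟩, ⟨hT.1, hT.2.2⟩]
  have hN : (0 : ℤ) ≤ Fintype.card F := by positivity
  by_cases ha : a = 0
  · have := hmem b (fun hb => hp ⟨ha, hb⟩) (Or.inr rfl)
    split_ifs <;> linarith
  by_cases hb : b = 0
  · have := hmem a ha (Or.inl rfl)
    split_ifs <;> linarith
  by_cases hab : a = b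
  · have := hmem a ha (Or.inl rfl)
    split_ifs; linarith
  · have : (((unitSpaces F).filter fun T => a ∈ T ∧ b ∈ T).card : ℤ) ≤ 1 := by
      exact_mod_cast card_unitSpaces_pair ha hb (Ne.symm hab)
    split_ifs
    linarith

/-- A zero-sum space of dimension five exists in all sufficiently large fields. -/
lemma isZeroDim_five {n : ℕ} (hn : Odd n) (hF : Fintype.card F = 2 ^ n) (hn21 : 21 ≤ n) :
    IsZeroDim F 5 := by
  classical
  have := charP_two F
  have htwo : (2 : F) = 0 := CharTwo.two_eq_zero
  by_contra hcon
  set N : ℤ := (Fintype.card F : ℤ) with hN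
  have hNge : 2 ^ 21 ≤ N := by
    rw [hN, hF]
    exact_mod_cast Nat.pow_le_pow_right two_pos hn21
  have hs : ∀ w : F, 1 + w + w ^ 2 ≠ 0 := by
    intro w
    have := sq_add_self_add_one_ne_zero hn hF w
    intro h; apply this; linear_combination h
  let φ : F → F := fun w => (1 + w + w ^ 2)⁻¹
  let ψ : F → F := fun w => w ^ 2 * (1 + w + w ^ 2)⁻¹
  let Ω : Finset F := Finset.univ \ {0, 1}
  have hΩ : ∀ {w}, w ∈ Ω ↔ w ≠ 0 ∧ w ≠ 1 := by intro w; simp [Ω]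
  have hΩcard : (Ω.card : ℤ) = N - 2 := by
    rw [Finset.card_sdiff_of_subset (Finset.subset_univ _), Finset.card_univ,
      Finset.card_pair zero_ne_one, Nat.cast_sub]
    · rfl
    · have : (2 : ℤ) ≤ Fintype.card F := by linarith
      exact_mod_cast this
  let G : F → F → ℤ := fun a b => ∑ w ∈ Ω, chi (a * φ w + b * ψ w)
  have hG0 : G 0 0 = N - 2 := by simp [G, chi_zero, hΩcard]
  have hGT : ∀ T ∈ unitSpaces F, ∑ p ∈ elts T ×ˢ elts T, G p.1 p.2 = 0 := by
    intro T hT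
    rw [Finset.sum_comm]
    refine Finset.sum_eq_zero fun w hw => ?_
    rw [Finset.sum_product]
    simp only [chi_add, ← Finset.mul_sum, ← Finset.sum_mul]
    obtain ⟨hw0, hw1⟩ := hΩ.1 hw
    obtain ⟨hT3, hT1⟩ := mem_unitSpaces.1 hT
    by_cases h1 : ∀ e ∈ T, Algebra.trace (ZMod 2) F (e * φ w) = 0
    · by_cases h2 : ∀ e ∈ T, Algebra.trace (ZMod 2) F (e * ψ w) = 0
      · exact absurd (isZeroDim_five_of_trace hn hF hw0 hw1 hT3 hT1 h1 h2) hcon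
      · push Not at h2
        obtain ⟨e, he, h⟩ := h2
        rw [sum_chi_eq_zero he h, mul_zero]
    · push Not at h1
      obtain ⟨e, he, h⟩ := h1
      rw [sum_chi_eq_zero he h, zero_mul]
  have hCS : ∀ T ∈ unitSpaces F, (N - 2) ^ 2 ≤
      63 * ∑ p ∈ (elts T ×ˢ elts T).erase (0, 0), G p.1 p.2 ^ 2 := by
    intro T hT
    have hmem : ((0, 0) : F × F) ∈ elts T ×ˢ elts T := by simp
    have h := Finset.add_sum_erase _ (fun p : F × F => G p.1 p.2) hmem
    rw [hGT T hT] at h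
    simp only [hG0] at h
    have h63 : ((elts T ×ˢ elts T).erase (0, 0)).card = 63 := by
      rw [Finset.card_erase_of_mem hmem, Finset.card_product, card_elts,
        (mem_unitSpaces.1 hT).1]
      norm_num
    have hcs := sq_sum_le_card_mul_sum_sq (s := (elts T ×ˢ elts T).erase (0, 0))
      (f := fun p : F × F => G p.1 p.2)
    rw [h63, show ∑ p ∈ (elts T ×ˢ elts T).erase (0, 0), G p.1 p.2 = -(N - 2) by linarith,
      neg_sq] at hcs
    exact_mod_cast hcs
  have hsum : (unitSpaces F).card * (N - 2) ^ 2 ≤ 63 * ∑ T ∈ unitSpaces F,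
      ∑ p ∈ (elts T ×ˢ elts T).erase (0, 0), G p.1 p.2 ^ 2 := by
    rw [Finset.mul_sum, ← nsmul_eq_mul, ← Finset.sum_const]
    exact Finset.sum_le_sum hCS
  have hmain := sum_unitSpaces_le (fun a b => G a b ^ 2) (fun a b => sq_nonneg _)
  have hφ : ∀ w w', φ w' = φ w → w' = w ∨ w' = w + 1 := by
    intro w w' h
    have h' : (w' + w) * (w' + w + 1) = 0 := by
      linear_combination inv_injective h + (w * w' + w + w ^ 2) * htwo
    rcases mul_eq_zero.1 h' with h | h
    · left; linear_combination h - w * htwo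
    · right; linear_combination h - (w + 1) * htwo
  have hm1 : ∑ a, G a 0 ^ 2 ≤ 2 * N * (N - 2) := by
    have := sum_sq_sum_chi_le Ω φ (fun w => w + 1) (fun w _ w' _ h => hφ w w' h)
    simpa [G, hΩcard] using this
  have hm2 : ∑ b, G 0 b ^ 2 ≤ 2 * N * (N - 2) := by
    have := sum_sq_sum_chi_le Ω ψ (fun w => w * (w + 1)⁻¹) (fun w hw w' hw' h => by
      have hw1 : w + 1 ≠ 0 := by
        intro h; exact (hΩ.1 hw).2 (by linear_combination h - htwo)
      have h1 := hs w
      have h2 := hs w'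
      simp only [ψ] at h
      field_simp at h
      have h' : (w' + w) * (w' * (w + 1) + w) = 0 := by
        linear_combination h + (w * w' + w ^ 2 + w ^ 2 * w') * htwo
      rcases mul_eq_zero.1 h' with h | h
      · left; linear_combination h - w * htwo
      · right
        rw [← div_eq_mul_inv, eq_div_iff hw1]
        linear_combination h - w * htwo)
    simpa [G, hΩcard] using this
  have hm3 : ∑ a, G a a ^ 2 ≤ 2 * N * (N - 2) := by
    have := sum_sq_sum_chi_le Ω (fun w => φ w + ψ w) (fun w => w⁻¹) (fun w hw w' hw' h => by
      have hw0 := (hΩ.1 hw).1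
      have h1 := hs w
      have h2 := hs w'
      simp only [φ, ψ] at h
      field_simp at h
      have h' : (w' + w) * (w' * w + 1) = 0 := by
        linear_combination h + (w' + w ^ 2 * w') * htwo
      rcases mul_eq_zero.1 h' with h | h
      · left; linear_combination h - w * htwo
      · right
        rw [← one_div, eq_div_iff hw0]
        linear_combination h - htwo)
    simpa [G, hΩcard, mul_add] using this
  have hm : ∑ a, ∑ b, G a b ^ 2 = N ^ 2 * (N - 2) := by
    rw [← hΩcard]
    refine sum_sum_sq_sum_chi Ω φ ψ fun w hw w' hw' h1 h2 => ?_
    have h1' : 1 + w + w ^ 2 = 1 + w' + w' ^ 2 := (inv_injective h1).symm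
    have h2' : w' ^ 2 = w ^ 2 := by
      simp only [ψ, h1'] at h2
      exact mul_right_cancel₀ (inv_ne_zero (hs w')) h2
    linear_combination -h2' - h1'
  have hlow : (N - 2) * (N - 8) ≤ 512 * (unitSpaces F).card := by
    have h := card_unitSpaces_ge F
    have h8 : 8 ≤ Fintype.card F := by
      have : (8 : ℤ) ≤ Fintype.card F := by linarith
      exact_mod_cast this
    zify [h8, (by omega : 2 ≤ Fintype.card F)] at h
    exact h
  set M : ℤ := ((unitSpaces F).card : ℤ) with hM
  have hfin : M * (N - 2) ^ 2 ≤ 63 * (7 * N ^ 3) := by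
    have h1 : N * (2 * N * (N - 2) + 2 * N * (N - 2) + 2 * N * (N - 2)) ≤ 6 * N ^ 3 := by
      nlinarith [sq_nonneg N]
    have h2 : N * (∑ a, G a 0 ^ 2 + ∑ b, G 0 b ^ 2 + ∑ a, G a a ^ 2) ≤
        N * (2 * N * (N - 2) + 2 * N * (N - 2) + 2 * N * (N - 2)) :=
      mul_le_mul_of_nonneg_left (by linarith) (by linarith)
    have h3 : N ^ 2 * (N - 2) ≤ N ^ 3 := by nlinarith [sq_nonneg N]
    rw [hm] at hmain
    linarith
  have h1 : (N - 2) ^ 3 * (N - 8) ≤ 225792 * N ^ 3 := by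
    nlinarith [mul_le_mul_of_nonneg_right hlow (sq_nonneg (N - 2))]
  have h2 : N ^ 3 ≤ 2 * (N - 2) ^ 3 := by
    have : 0 ≤ N - 2097152 := by linarith
    nlinarith [mul_nonneg (sq_nonneg N) this, mul_nonneg (sq_nonneg (N - 2)) this]
  have h3 : (0 : ℤ) < (N - 2) ^ 3 := pow_pos (by linarith) 3
  nlinarith

end Five

section Coverage

/-- The dimensions reached by the extension, product and duality constructions. -/
lemma covers_of_closure {P : ℕ → Prop} {m : ℕ} (hm : Odd m) (h0 : P 0)
    (hplain : ∀ d e, P d → e + d ≤ m → P (d + 7 * e))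
    (hprod : ∀ d b e, P d → b = 3 ∨ b = 4 → e + d ≤ m ∨ e = 0 → d * b + 7 * e < 7 * m →
      P (d + b + 7 * e))
    (hdual : ∀ k, P k → P (7 * m - k))
    (h5 : 3 ≤ m → P 5) (h19 : m = 5 → P 4 → P 19)
    {k : ℕ} (hk3 : 3 ≤ k) (hkm : k + 3 ≤ 7 * m)
    (hex1 : ¬ (m = 7 ∧ k = 23)) (hex2 : ¬ (m = 7 ∧ k = 26)) : P k := by
  have hdual' : ∀ k, k ≤ 7 * m → P (7 * m - k) → P k := by
    intro k hk h
    have := hdual _ h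
    rwa [Nat.sub_sub_self hk] at this
  have p3 : ∀ e, e < m → P (3 + 7 * e) := fun e he => by
    simpa using hprod 0 3 e h0 (Or.inl rfl) (Or.inl (by omega)) (by omega)
  have p4 : ∀ e, e < m → P (4 + 7 * e) := fun e he => by
    simpa using hprod 0 4 e h0 (Or.inr rfl) (Or.inl (by omega)) (by omega)
  have p7 : ∀ e, e ≤ m → P (7 * e) := fun e he => by
    simpa using hplain 0 e h0 (by omega)
  obtain ⟨j, hj⟩ := hm
  rcases Nat.eq_zero_or_pos j with rfl | hjpos
  · obtain rfl | rfl : k = 3 ∨ k = 4 := by omega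
    exacts [p3 0 (by omega), p4 0 (by omega)]
  have hm3 : 3 ≤ m := by omega
  have p5 := h5 hm3
  have p6 : P 6 := hprod 3 3 0 (p3 0 (by omega)) (Or.inl rfl) (Or.inr rfl) (by omega)
  have p8 : P 8 := hprod 4 4 0 (p4 0 (by omega)) (Or.inr rfl) (Or.inr rfl) (by omega)
  have p6' : ∀ e, e + 2 ≤ m → P (6 + 7 * e) := by
    intro e he
    rcases eq_or_ne (e + 2) m with h | h
    · have := hdual 8 p8
      rwa [show 7 * m - 8 = 6 + 7 * e by omega] at this
    rcases eq_or_ne e 0 with rfl | h'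
    · exact p6
    · exact hprod 3 3 e (p3 0 (by omega)) (Or.inl rfl) (Or.inl (by omega)) (by omega)
  have p5' : ∀ e, e + 5 ≤ m ∨ e = 0 → P (5 + 7 * e) := by
    rintro e (he | rfl)
    · exact hplain 5 e p5 he
    · exact p5
  have p9' : ∀ e, e + 6 ≤ m ∨ e = 0 → P (9 + 7 * e) := fun e he =>
    hprod 6 3 e p6 (Or.inl rfl) he (by omega)
  have p2' : ∀ f, 1 ≤ f → f + 1 ≤ m → ¬ (m = 7 ∧ f = 3) → P (2 + 7 * f) := by
    intro f hf1 hfm hex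
    by_cases hA : f + 1 = m ∨ 4 ≤ f
    · refine hdual' _ (by omega) ?_
      rw [show 7 * m - (2 + 7 * f) = 5 + 7 * (m - 1 - f) by omega]
      exact p5' _ (by omega)
    by_cases hB : f + 5 ≤ m ∨ f = 1
    · rw [show 2 + 7 * f = 9 + 7 * (f - 1) by omega]
      exact p9' _ (by omega)
    have hm5 : m = 5 := by omega
    subst hm5
    obtain rfl | rfl : f = 2 ∨ f = 3 := by omega
    · exact hdual' _ (by omega) (h19 rfl (p4 0 (by omega)))
    · exact hdual' _ (by omega)
        (hprod 8 4 0 p8 (Or.inr rfl) (Or.inr rfl) (by omega))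
  have hmod := Nat.mod_add_div k 7
  have hlt := Nat.mod_lt k (show 7 > 0 by omega)
  generalize k % 7 = r at hmod hlt
  generalize k / 7 = f at hmod
  subst hmod
  interval_cases r
  · rw [zero_add]; exact p7 f (by omega)
  · refine hdual' _ (by omega) ?_
    rw [show 7 * m - (1 + 7 * f) = 6 + 7 * (m - 1 - f) by omega]
    exact p6' _ (by omega)
  · exact p2' f (by omega) (by omega) (by omega)
  · exact p3 f (by omega)
  · exact p4 f (by omega)
  · refine hdual' _ (by omega) ?_
    rw [show 7 * m - (5 + 7 * f) = 2 + 7 * (m - 1 - f) by omega]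
    exact p2' _ (by omega) (by omega) (by omega)
  · exact p6' f (by omega)

variable {F : Type*} [Field F] [Fintype F] [Algebra (ZMod 2) F]

omit [Fintype F] in
lemma exists_algebra_galoisField [Finite F] {l : ℕ} (hl : l ≠ 0)
    (h : l ∣ Module.finrank (ZMod 2) F) :
    ∃ _ : Algebra (GaloisField 2 l) F, IsScalarTower (ZMod 2) (GaloisField 2 l) F := by
  obtain ⟨f⟩ := FiniteField.nonempty_algHom_of_finrank_dvd (F := ZMod 2) (K := GaloisField 2 l)
    (L := F) (by rwa [GaloisField.finrank 2 hl])
  let _ : Algebra (GaloisField 2 l) F := f.toRingHom.toAlgebra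
  exact ⟨inferInstance, IsScalarTower.of_algebraMap_eq fun x => (f.commutes x).symm⟩

lemma card_eq_two_pow : Fintype.card F = 2 ^ Module.finrank (ZMod 2) F := by
  have h := Module.card_eq_pow_finrank (K := ZMod 2) (V := F)
  rwa [ZMod.card] at h

lemma isZeroDim_of_seven_dvd {n k : ℕ} (hn : Odd n) (hF : Module.finrank (ZMod 2) F = n)
    (h7 : 7 ∣ n) (hk3 : 3 ≤ k) (hkn : k + 3 ≤ n)
    (hex1 : ¬ (n = 49 ∧ k = 23)) (hex2 : ¬ (n = 49 ∧ k = 26)) : IsZeroDim F k := by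
  have hcard := card_eq_two_pow (F := F)
  rw [hF] at hcard
  have hcard2 : 2 < Fintype.card F := by
    rw [hcard]
    exact (show 2 < 2 ^ 2 by norm_num).trans_le (Nat.pow_le_pow_right two_pos (by omega))
  obtain ⟨_, _⟩ := exists_algebra_galoisField (F := F) (l := 7) (by norm_num) (hF ▸ h7)
  let _ : Fintype (GaloisField 2 7) := Fintype.ofFinite _
  have hl : Module.finrank (ZMod 2) (GaloisField 2 7) = 7 := GaloisField.finrank 2 (by norm_num)
  have hKcard : Fintype.card (GaloisField 2 7) = 2 ^ 7 := by rw [card_eq_two_pow, hl]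
  have hK2 : 2 < Fintype.card (GaloisField 2 7) := by rw [hKcard]; norm_num
  have htower := Module.finrank_mul_finrank (ZMod 2) (GaloisField 2 7) F
  rw [hl, hF] at htower
  obtain ⟨m, hm⟩ : ∃ m, Module.finrank (GaloisField 2 7) F = m := ⟨_, rfl⟩
  rw [hm] at htower
  subst htower
  have hz3 : IsZeroDim (GaloisField 2 7) 3 := isZeroDim_three hKcard
  have hz4 : IsZeroDim (GaloisField 2 7) 4 := by
    have := hz3.dual hK2
    rwa [hl] at this
  refine covers_of_closure (P := IsZeroDim F) (m := m) (Nat.odd_mul.1 hn).2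
    ⟨⊥, finrank_bot _ _, invSum_bot⟩ ?_ ?_ ?_ ?_ ?_ hk3 hkn (by omega) (by omega)
  · intro d e hd hde
    have := hd.add_mul (GaloisField 2 7) hK2 (hm ▸ hde)
    rwa [hl] at this
  · intro d b e hd hb hde hlt
    have hb' : IsZeroDim (GaloisField 2 7) b := by
      rcases hb with rfl | rfl
      exacts [hz3, hz4]
    have := hd.add_add_mul (GaloisField 2 7) hK2 hb' (hm ▸ hde) (by rwa [hl, hF])
    rwa [hl] at this
  · intro k hk
    have := hk.dual hcard2
    rwa [hF] at this
  · intro hm3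
    exact isZeroDim_five hn hcard (by omega)
  · rintro rfl hz
    obtain ⟨_, _⟩ := exists_algebra_galoisField (F := F) (l := 5) (by norm_num)
      (by rw [hF]; norm_num)
    let _ : Fintype (GaloisField 2 5) := Fintype.ofFinite _
    have hl5 : Module.finrank (ZMod 2) (GaloisField 2 5) = 5 := GaloisField.finrank 2 (by norm_num)
    have hK5 : 2 < Fintype.card (GaloisField 2 5) := by
      rw [card_eq_two_pow, hl5]; norm_num
    have htower := Module.finrank_mul_finrank (ZMod 2) (GaloisField 2 5) F
    rw [hl5, hF] at htower
    have := hz.add_mul (GaloisField 2 5) hK5 (e := 3) (by omega)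
    rwa [hl5] at this

lemma finsum_coset_eq (E : Submodule (ZMod 2) F) (v : F) :
    ∑ᶠ u : E, (v + (u : F))⁻¹ = ∑ u ∈ elts E, (v + u)⁻¹ := by
  classical
  rw [finsum_eq_sum_of_fintype]
  exact (Finset.sum_subtype (elts E) (fun x => mem_elts) fun u => (v + u)⁻¹).symm

/-- Sum-freedom over all affine subspaces is the absence of zero-sum linear subspaces. -/
lemma forall_coset_ne_zero_iff {k : ℕ} :
    (∀ (E : Submodule (ZMod 2) F) (v : F), Module.finrank (ZMod 2) E = k →
      ∑ᶠ u : E, (v + (u : F))⁻¹ ≠ 0) ↔ ¬ IsZeroDim F k := by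
  simp only [finsum_coset_eq]
  constructor
  · rintro h ⟨E, hE, hsum⟩
    exact h E 0 hE ((sum_coset_mem E E.zero_mem).trans hsum)
  · intro h E v hE
    by_cases hv : v ∈ E
    · rw [sum_coset_mem E hv]
      exact fun hsum => h ⟨E, hE, hsum⟩
    · exact sum_coset_ne_zero E hv

end Coverage

end InvSum

/-- Carlet's conjecture holds when `n` is odd and divisible by `7`, except possibly for
`(n,k) = (49,23)` and `(49,26)`: for `1 ≤ k ≤ n − 1` with `(n,k)` not one of these two
pairs, the multiplicative inverse function `f_inv(x) = x⁻¹` (with `f_inv(0) = 0`) on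
`F_{2^n}` is `k`th order sum-free (i.e. `∑_{x ∈ A} f_inv(x) ≠ 0` for every
`k`-dimensional `F₂`-affine subspace `A = v + E`) if and only if
`k ∈ {1, 2, n−2, n−1}`. -/
theorem carlet_conjecture_seven_dvd (n k : ℕ) (hodd : Odd n) (hn3 : 3 ≤ n)
    (h7 : 7 ∣ n) (hk1 : 1 ≤ k) (hk : k ≤ n - 1)
    (hex1 : ¬(n = 49 ∧ k = 23)) (hex2 : ¬(n = 49 ∧ k = 26)) :
    (∀ (E : Submodule (ZMod 2) (GaloisField 2 n)) (v : GaloisField 2 n),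
        Module.finrank (ZMod 2) E = k →
        ∑ᶠ u : E, (v + (u : GaloisField 2 n))⁻¹ ≠ 0) ↔
      (k = 1 ∨ k = 2 ∨ k = n - 2 ∨ k = n - 1) := by
  let _ : Fintype (GaloisField 2 n) := Fintype.ofFinite _
  have hfin : Module.finrank (ZMod 2) (GaloisField 2 n) = n := GaloisField.finrank 2 (by omega)
  have hcard : Fintype.card (GaloisField 2 n) = 2 ^ n := by
    rw [InvSum.card_eq_two_pow, hfin]
  have hcard2 : 2 < Fintype.card (GaloisField 2 n) := by
    rw [hcard]
    exact (show 2 < 2 ^ 2 by norm_num).trans_le (Nat.pow_le_pow_right two_pos (by omega))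
  rw [InvSum.forall_coset_ne_zero_iff]
  constructor
  · intro h
    by_contra hne
    exact h (InvSum.isZeroDim_of_seven_dvd hodd hfin h7 (by omega) (by omega) hex1 hex2)
  · intro hk' hz
    have hdual := hz.dual hcard2
    rw [hfin] at hdual
    rcases hk' with rfl | rfl | rfl | rfl
    · exact InvSum.not_isZeroDim_one hz
    · exact InvSum.not_isZeroDim_two hodd hcard hz
    · rw [show n - (n - 2) = 2 by omega] at hdual
      exact InvSum.not_isZeroDim_two hodd hcard hdual
    · rw [show n - (n - 1) = 1 by omega] at hdual
      exact InvSum.not_isZeroDim_one hdual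
end
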